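/- Let G = (V,E) be a 2-vertex-connected finite simple graph on n vertices, let s, t ∈ V, and let G' = (V, E ∪ {st}). Then G contains a spanning walk from s to t of length at most (10/9)·OPT_LP(G') + (n + dist_G(s,t) − 2)/3, where dist_G(s,t) is the graph distance between s and t in G. -/

import Mathlib

open scoped Classical

/-- The total LP value of edges of `G` crossing the cut `(S, Sᶜ)`:
the sum of `x e` over edges `e` of `G` with exactly one endpoint in `S`. -/
noncomputable def cutValue {V : Type*} [Fintype V] (G : SimpleGraph V)
    (x : Sym2 V → ℝ) (S : Set V) : ℝ :=
  ∑ e ∈ Finset.univ.filter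
      (fun e : Sym2 V => e ∈ G.edgeSet ∧ ∃ a b, e = s(a, b) ∧ a ∈ S ∧ b ∉ S), x e

/-- The total value `∑_{e ∈ E} x_e` of a putative Held-Karp solution. -/
noncomputable def lpValue {V : Type*} [Fintype V] (G : SimpleGraph V)
    (x : Sym2 V → ℝ) : ℝ :=
  ∑ e ∈ Finset.univ.filter (fun e : Sym2 V => e ∈ G.edgeSet), x e

/-- `x` is a feasible Held-Karp solution for `G`. -/
def IsHeldKarp {V : Type*} [Fintype V] (G : SimpleGraph V) (x : Sym2 V → ℝ) : Prop :=
  (∀ e ∈ G.edgeSet, 0 ≤ x e) ∧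
  ∀ S : Set V, S.Nonempty → S ≠ Set.univ → 2 ≤ cutValue G x S

/-- The Held-Karp value `OPT_LP(G)`. -/
noncomputable def optLP {V : Type*} [Fintype V] (G : SimpleGraph V) : ℝ :=
  sInf {y | ∃ x, IsHeldKarp G x ∧ lpValue G x = y}

/-- `G` is 2-vertex-connected: it has at least 3 vertices and deleting any single
vertex leaves a connected (induced) graph. -/
def IsTwoVertexConnected {V : Type*} [Fintype V] (G : SimpleGraph V) : Prop :=
  3 ≤ Fintype.card V ∧ ∀ v : V, (G.induce ({v}ᶜ : Set V)).Connected

set_option linter.unusedSectionVars false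

section TJoin

variable {V E : Type*} [DecidableEq V] [DecidableEq E]

/-- The indicator, modulo two, of the two ends of a (possibly degenerate) edge. -/
def endPair (a b : V) : V → ZMod 2 := Pi.single a 1 + Pi.single b 1

/-- The parity vector of a set of edges. -/
def bd (h : E → V × V) (P : Finset E) : V → ZMod 2 := ∑ e ∈ P, endPair (h e).1 (h e).2

/-- The edge `e` has exactly one end in `S`. -/
def Crosses (h : E → V × V) (S : Finset V) (e : E) : Prop := ¬((h e).1 ∈ S ↔ (h e).2 ∈ S)

lemma charTwo_fun (T : V → ZMod 2) : T + T = 0 := funext fun v => CharTwo.add_self_eq_zero (T v)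

lemma endPair_self (a : V) : endPair a a = 0 := charTwo_fun _

lemma endPair_comm (a b : V) : endPair a b = endPair b a := add_comm _ _

lemma endPair_trans (a b c : V) : endPair a b + endPair b c = endPair a c := by
  have := charTwo_fun (Pi.single b (1 : ZMod 2))
  unfold endPair
  linear_combination this

lemma endPair_apply (a b v : V) :
    endPair a b v = (if v = a then 1 else 0) + (if v = b then 1 else 0) := by
  simp [endPair, Pi.single_apply]

lemma endPair_eq_one_iff (a b v : V) : endPair a b v = 1 ↔ ¬(v = a ↔ v = b) := by
  rw [endPair_apply]
  split_ifs <;> simp_all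

lemma zmod_two_ne_zero {z : ZMod 2} : z ≠ 0 ↔ z = 1 := by revert z; decide

lemma zmod_two_ne_one {z : ZMod 2} : z ≠ 1 ↔ z = 0 := by revert z; decide

lemma bd_empty (h : E → V × V) : bd h ∅ = 0 := rfl

lemma bd_singleton (h : E → V × V) (e : E) : bd h {e} = endPair (h e).1 (h e).2 := by
  simp [bd]

lemma bd_insert (h : E → V × V) {e : E} {P : Finset E} (he : e ∉ P) :
    bd h (insert e P) = endPair (h e).1 (h e).2 + bd h P := Finset.sum_insert he

lemma bd_union (h : E → V × V) {P Q : Finset E} (hd : Disjoint P Q) :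
    bd h (P ∪ Q) = bd h P + bd h Q := Finset.sum_union hd

lemma bd_sdiff (h : E → V × V) {P Q : Finset E} (hd : Q ⊆ P) :
    bd h (P \ Q) = bd h P + bd h Q := by
  have h1 : bd h (P \ Q) + bd h Q = bd h P := Finset.sum_sdiff hd
  have := charTwo_fun (bd h Q)
  linear_combination h1 - this

lemma bd_erase (h : E → V × V) {e : E} {P : Finset E} (he : e ∈ P) :
    bd h (P.erase e) = bd h P + endPair (h e).1 (h e).2 := by
  rw [← Finset.sdiff_singleton_eq_erase, bd_sdiff h (by simpa using he), bd_singleton]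

lemma bd_symmDiff (h : E → V × V) (P Q : Finset E) :
    bd h (symmDiff P Q) = bd h P + bd h Q := by
  have h3 : symmDiff P Q = (P \ (P ∩ Q)) ∪ (Q \ (P ∩ Q)) := by
    ext; simp [Finset.mem_symmDiff]
  have hd : Disjoint (P \ (P ∩ Q)) (Q \ (P ∩ Q)) := by
    rw [Finset.disjoint_left]; intro a; simp; tauto
  rw [h3, bd_union h hd, bd_sdiff h Finset.inter_subset_left, bd_sdiff h Finset.inter_subset_right]
  linear_combination charTwo_fun (bd h (P ∩ Q))

lemma crosses_singleton_iff (h : E → V × V) (x : V) (e : E) :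
    Crosses h {x} e ↔ endPair (h e).1 (h e).2 x = 1 := by
  rw [endPair_eq_one_iff, Crosses]; simp [eq_comm]

lemma exists_other_end {h : E → V × V} {x : V} {e : E} (he : Crosses h {x} e) :
    ∃ a, a ≠ x ∧ endPair (h e).1 (h e).2 = endPair x a := by
  rw [Crosses] at he
  simp only [Finset.mem_singleton] at he
  by_cases h1 : (h e).1 = x
  · exact ⟨(h e).2, fun h2 => he (by simp [h1, h2]), by rw [h1]⟩
  · have h2 : (h e).2 = x := by tauto
    exact ⟨(h e).1, h1, by rw [h2, endPair_comm]⟩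

lemma bd_apply_eq_card (h : E → V × V) (P : Finset E) (x : V) :
    bd h P x = ((P.filter (Crosses h {x})).card : ZMod 2) := by
  rw [bd, Finset.sum_apply, Finset.card_filter, Nat.cast_sum]
  refine Finset.sum_congr rfl fun e _ => ?_
  by_cases he : Crosses h {x} e
  · rw [(crosses_singleton_iff h x e).1 he]; simp [he]
  · have := he
    rw [crosses_singleton_iff, ← ne_eq, zmod_two_ne_one] at this
    rw [this]; simp [he]

lemma exists_crosses_of_bd {h : E → V × V} {P : Finset E} {x : V} (hx : bd h P x = 1) :
    ∃ e ∈ P, Crosses h {x} e := by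
  by_contra! hc
  rw [bd_apply_eq_card, Finset.filter_false_of_mem hc] at hx
  simp at hx

lemma exists_sub_path (h : E → V × V) (C : Finset E) (a : V) (ha : bd h C a = 1) :
    ∃ z, z ≠ a ∧ bd h C z = 1 ∧ ∃ Q ⊆ C, bd h Q = endPair a z := by
  induction C using Finset.strongInduction generalizing a with
  | H C ih =>
    obtain ⟨e, heC, he⟩ := exists_crosses_of_bd ha
    obtain ⟨b, hba, hb⟩ := exists_other_end he
    by_cases hCb : bd h C b = 1
    · exact ⟨b, hba, hCb, {e}, by simpa using heC, by rw [bd_singleton, hb]⟩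
    · rw [← ne_eq, zmod_two_ne_one] at hCb
      have key : bd h (C.erase e) = bd h C + endPair a b := by rw [bd_erase h heC, hb]
      obtain ⟨z, hzb, hz, Q, hQ, hQz⟩ := ih (C.erase e) (Finset.erase_ssubset heC) b (by
        rw [key, Pi.add_apply, hCb, endPair_apply]; simp [hba])
      have hza : z ≠ a := by
        rintro rfl
        rw [key, Pi.add_apply, ha, endPair_apply] at hz
        simp [hba.symm] at hz
      refine ⟨z, hza, ?_, insert e Q, ?_, ?_⟩
      · rw [key, Pi.add_apply, endPair_apply] at hz
        simpa [hza, hzb] using hz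
      · exact Finset.insert_subset heC (hQ.trans (Finset.erase_subset _ _))
      · rw [bd_insert h (fun hh => by simpa using hQ hh), hb, hQz, endPair_trans]

end TJoin

section TJoin

variable {V E : Type*} [DecidableEq V] [DecidableEq E]

lemma sum_symmDiff_cost (c : E → ℤ) (J Z : Finset E) :
    ∑ e ∈ symmDiff J Z, c e = ∑ e ∈ J, c e + ∑ e ∈ Z, (if e ∈ J then -c e else c e) := by
  have h1 : symmDiff J Z = (J \ (J ∩ Z)) ∪ (Z \ (J ∩ Z)) := by
    ext; simp [Finset.mem_symmDiff]
  have hd : Disjoint (J \ (J ∩ Z)) (Z \ (J ∩ Z)) := by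
    rw [Finset.disjoint_left]; intro a; simp; tauto
  have h2 : ∑ e ∈ Z, (if e ∈ J then -c e else c e)
      = ∑ e ∈ Z \ (J ∩ Z), c e - ∑ e ∈ J ∩ Z, c e := by
    rw [← Finset.sum_sdiff (Finset.inter_subset_right : J ∩ Z ⊆ Z), sub_eq_add_neg,
      ← Finset.sum_neg_distrib]
    congr 1 <;> refine Finset.sum_congr rfl fun e he => ?_ <;> simp at he <;> simp [he]
  have h3 := Finset.sum_sdiff (f := c) (Finset.inter_subset_left : J ∩ Z ⊆ J)
  rw [h1, Finset.sum_union hd, h2]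
  linarith

variable [Fintype E]

/-- In a conservatively weighted graph whose negative edges are those of `J`, there is a vertex
incident with exactly one edge of `J` around which the weights may be moved one step to zero. -/
lemma exists_reducing_vertex (h : E → V × V) (J : Finset E) (w : E → ℤ)
    (hneg : ∀ e ∈ J, (h e).1 ≠ (h e).2 → w e ≤ -1)
    (hpos : ∀ e ∉ J, (h e).1 ≠ (h e).2 → 1 ≤ w e)
    (hcons : ∀ Z, bd h Z = 0 → 0 ≤ ∑ e ∈ Z, w e)
    (heven : ∀ Z, bd h Z = 0 → Even (∑ e ∈ Z, w e))
    (hJ : ∃ e ∈ J, (h e).1 ≠ (h e).2) :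
    ∃ x, (∃ j ∈ J, Crosses h {x} j ∧ ∀ e ∈ J, Crosses h {x} e → e = j) ∧
      ∀ Z, bd h Z = 0 → 0 ≤ ∑ e ∈ Z,
        (w e + if Crosses h {x} e then (if e ∈ J then 1 else -1) else 0) := by
  have nl : ∀ {x e}, Crosses h {x} e → (h e).1 ≠ (h e).2 := fun {x e} hc he => hc (by rw [he])
  set W : Finset E → ℤ := fun P => ∑ e ∈ P, w e with hW
  have Wins : ∀ {e P}, e ∉ P → W (insert e P) = w e + W P := fun he => Finset.sum_insert he
  have Wuni : ∀ {P Q}, Disjoint P Q → W (P ∪ Q) = W P + W Q := fun he => Finset.sum_union he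
  have Wsd : ∀ {P Q}, Q ⊆ P → W (P \ Q) = W P - W Q := fun he =>
    eq_sub_of_add_eq (Finset.sum_sdiff he)
  have Wer : ∀ {e P}, e ∈ P → W (P.erase e) = W P - w e := fun he =>
    eq_sub_of_add_eq (Finset.sum_erase_add _ _ he)
  obtain ⟨P, u, x, hux, hP, hPneg, hPmin, hPcard⟩ : ∃ P u x, u ≠ x ∧ bd h P = endPair u x ∧ W P < 0 ∧
      (∀ P' u' x', u' ≠ x' → bd h P' = endPair u' x' → W P ≤ W P') ∧
      (∀ P' u' x', u' ≠ x' → bd h P' = endPair u' x' → W P' ≤ W P → P.card ≤ P'.card) := by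
    set F : Finset (Finset E) := Finset.univ.filter
      fun P => ∃ u x, u ≠ x ∧ bd h P = endPair u x with hF
    obtain ⟨e, heJ, he⟩ := hJ
    have heF : {e} ∈ F := by
      simp only [hF, Finset.mem_filter, Finset.mem_univ, true_and]
      exact ⟨_, _, he, bd_singleton h e⟩
    obtain ⟨P0, hP0, hmin0⟩ := F.exists_min_image W ⟨_, heF⟩
    obtain ⟨P, hP, hmin⟩ := (F.filter fun P => W P ≤ W P0).exists_min_image Finset.card
      ⟨P0, by simp [hP0]⟩
    rw [Finset.mem_filter] at hP
    have hPF := hP.1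
    simp only [hF, Finset.mem_filter, Finset.mem_univ, true_and] at hPF
    obtain ⟨u, x, hux, hb⟩ := hPF
    refine ⟨P, u, x, hux, hb, ?_, ?_, ?_⟩
    · have h1 := hmin0 _ heF
      have h2 := hneg e heJ he
      have h3 : W {e} = w e := Finset.sum_singleton _ _
      linarith [hP.2]
    · intro P' u' x' hne hb'
      exact hP.2.trans (hmin0 _ (by simp only [hF, Finset.mem_filter, Finset.mem_univ, true_and]; exact ⟨_, _, hne, hb'⟩))
    · intro P' u' x' hne hb' hle
      refine hmin _ (Finset.mem_filter.2 ⟨?_, hle.trans hP.2⟩)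
      simp only [hF, Finset.mem_filter, Finset.mem_univ, true_and]
      exact ⟨_, _, hne, hb'⟩
  have hPmin' : ∀ P' u' x', bd h P' = endPair u' x' → W P ≤ W P' := by
    intro P' u' x' hb
    by_cases hne : u' = x'
    · rw [hne, endPair_self] at hb
      have := hcons _ hb
      exact hPneg.le.trans this
    · exact hPmin _ _ _ hne hb
  have noeven : ∀ Z ⊆ P, bd h Z = 0 → Z = ∅ := by
    intro Z hZ hb
    have h1 := hPcard (P \ Z) u x hux (by rw [bd_sdiff h hZ, hb, hP, add_zero])
      (by rw [Wsd hZ]; have := hcons _ hb; simp only [hW]; linarith)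
    have h2 := Finset.card_sdiff_add_card_eq_card hZ
    exact Finset.card_eq_zero.1 (by omega)
  have starP : ∀ e, Crosses h {x} e → (e ∈ J ↔ e ∈ P) := by
    intro e hc
    obtain ⟨a, hax, ha⟩ := exists_other_end hc
    by_contra hne
    by_cases heJ : e ∈ J
    · have heP : e ∉ P := by tauto
      have h1 := hPmin' (insert e P) u a (by rw [bd_insert h heP, ha, hP, add_comm, endPair_trans])
      rw [Wins heP] at h1
      linarith [hneg e heJ (nl hc)]
    · have heP : e ∈ P := by tauto
      have h1 := hPmin' (P.erase e) u a (by rw [bd_erase h heP, ha, hP, endPair_trans])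
      rw [Wer heP] at h1
      linarith [hpos e heJ (nl hc)]
  obtain ⟨j, hjP, hjx⟩ : ∃ e ∈ P, Crosses h {x} e := exists_crosses_of_bd (by
    rw [hP, endPair_apply]; simp [hux.symm])
  have hjJ : j ∈ J := (starP j hjx).2 hjP
  have huniq : ∀ e ∈ J, Crosses h {x} e → e = j := by
    intro e heJ hc
    have heP := (starP e hc).1 heJ
    by_contra hne
    obtain ⟨a, hax, ha⟩ := exists_other_end hc
    obtain ⟨b, hbx, hb⟩ := exists_other_end hjx
    have hj' : j ∈ P.erase e := Finset.mem_erase.2 ⟨fun hh => hne hh.symm, hjP⟩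
    have hP0 : bd h ((P.erase e).erase j) = endPair u x + endPair x a + endPair x b := by
      rw [bd_erase h hj', bd_erase h heP, ha, hb, hP]
    obtain ⟨z, hzx, hz, Q, hQ, hQz⟩ := exists_sub_path h ((P.erase e).erase j) x (by
      rw [hP0]; simp [endPair_apply, hux.symm, hax.symm, hbx.symm]; decide)
    have hQe : e ∉ Q := fun hh => by simpa using hQ hh
    have hQj : j ∉ Q := fun hh => by simpa using hQ hh
    have hQP : Q ⊆ P := hQ.trans ((Finset.erase_subset _ _).trans (Finset.erase_subset _ _))
    have hz' : z = u ∨ z = a ∨ z = b := by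
      by_contra! hcon
      rw [hP0] at hz
      simp [endPair_apply, hcon, hzx] at hz
    rcases hz' with rfl | rfl | rfl
    · have := noeven (P \ Q) Finset.sdiff_subset (by
        rw [bd_sdiff h hQP, hP, hQz, endPair_trans, endPair_self])
      have h2 : e ∈ P \ Q := by simp [heP, hQe]
      simp [this] at h2
    · have := noeven (insert e Q) (Finset.insert_subset heP hQP) (by
        rw [bd_insert h hQe, ha, hQz]; exact charTwo_fun _)
      simp at this
    · have := noeven (insert j Q) (Finset.insert_subset hjP hQP) (by
        rw [bd_insert h hQj, hb, hQz]; exact charTwo_fun _)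
      simp at this
  refine ⟨x, ⟨j, hjJ, hjx, huniq⟩, ?_⟩
  by_contra! hbad
  set w' : E → ℤ := fun e => w e + if Crosses h {x} e then (if e ∈ J then 1 else -1) else 0 with hw'
  obtain ⟨Z, hZ, hZmin⟩ := (Finset.univ.filter fun Z => bd h Z = 0 ∧ ∑ e ∈ Z, w' e < 0).exists_min_image
    Finset.card (by obtain ⟨Z, h1, h2⟩ := hbad; exact ⟨Z, by simpa using ⟨h1, h2⟩⟩)
  simp only [Finset.mem_filter, Finset.mem_univ, true_and] at hZ hZmin
  obtain ⟨hZ0, hZneg⟩ := hZ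
  have noprop : ∀ Y ⊆ Z, bd h Y = 0 → Y.Nonempty → Y = Z := by
    intro Y hY hb hne
    by_contra hYZ
    have hss := Finset.ssubset_iff_subset_ne.2 ⟨hY, hYZ⟩
    have h1 : 0 ≤ ∑ e ∈ Y, w' e := by
      by_contra! hlt
      have := hZmin Y ⟨hb, hlt⟩
      exact absurd (Finset.card_lt_card hss) (by omega)
    have h2 : 0 ≤ ∑ e ∈ Z \ Y, w' e := by
      by_contra! hlt
      have := hZmin (Z \ Y) ⟨by rw [bd_sdiff h hY, hZ0, hb, add_zero], hlt⟩
      have h3 := Finset.card_sdiff_add_card_eq_card hY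
      have := hne.card_pos
      omega
    have := Finset.sum_sdiff (f := w') hY
    linarith
  have hsum : ∑ e ∈ Z, w' e = W Z + ∑ e ∈ Z.filter (Crosses h {x}), (if e ∈ J then 1 else -1) := by
    rw [hw', Finset.sum_add_distrib, Finset.sum_filter]
  have hcardeven : Even (Z.filter (Crosses h {x})).card := by
    have := bd_apply_eq_card h Z x
    rw [hZ0, Pi.zero_apply] at this
    exact (ZMod.natCast_eq_zero_iff_even).1 this.symm
  have hWZ : 0 ≤ W Z := hcons _ hZ0
  obtain ⟨e1, he1⟩ : (Z.filter (Crosses h {x})).Nonempty := by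
    by_contra hne
    rw [Finset.not_nonempty_iff_eq_empty] at hne
    rw [hsum, hne, Finset.sum_empty] at hZneg
    linarith
  obtain ⟨e2, he2⟩ : ((Z.filter (Crosses h {x})).erase e1).Nonempty := by
    rw [← Finset.card_pos, Finset.card_erase_of_mem he1]
    obtain ⟨k, hk⟩ := hcardeven
    have := Finset.card_pos.2 ⟨e1, he1⟩
    omega
  obtain ⟨he21, he2⟩ := Finset.mem_erase.1 he2
  obtain ⟨he1Z, he1x⟩ := Finset.mem_filter.1 he1
  obtain ⟨he2Z, he2x⟩ := Finset.mem_filter.1 he2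
  obtain ⟨a, hax, ha⟩ := exists_other_end he1x
  obtain ⟨b, hbx, hb⟩ := exists_other_end he2x
  have he2Z' : e2 ∈ Z.erase e1 := Finset.mem_erase.2 ⟨he21, he2Z⟩
  set C := (Z.erase e1).erase e2 with hC
  have hCZ : C ⊆ Z := (Finset.erase_subset _ _).trans (Finset.erase_subset _ _)
  have he1C : e1 ∉ C := by simp [hC]
  have he2C : e2 ∉ C := by simp [hC]
  have hbC : bd h C = endPair a b := by
    rw [hC, bd_erase h he2Z', bd_erase h he1Z, hZ0, ha, hb, zero_add, endPair_comm x a, endPair_trans]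
  have hCx : ∀ e ∈ C, ¬ Crosses h {x} e := by
    intro e heC hc
    obtain ⟨d, hdx, hd⟩ := exists_other_end hc
    have hC3 : bd h (C.erase e) = endPair a b + endPair x d := by rw [bd_erase h heC, hbC, hd]
    obtain ⟨z, hzx, hz, Q, hQ, hQz⟩ := exists_sub_path h (C.erase e) x (by
      rw [hC3]; simp [endPair_apply, hax.symm, hbx.symm, hdx.symm])
    have hQZ : Q ⊆ Z := hQ.trans ((Finset.erase_subset _ _).trans hCZ)
    have hQe : e ∉ Q := fun hh => by simpa using hQ hh
    have hQ1 : e1 ∉ Q := fun hh => he1C (Finset.mem_of_mem_erase (hQ hh))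
    have hQ2 : e2 ∉ Q := fun hh => he2C (Finset.mem_of_mem_erase (hQ hh))
    have hz' : z = a ∨ z = b ∨ z = d := by
      by_contra! hcon
      rw [hC3] at hz
      simp [endPair_apply, hcon, hzx] at hz
    rcases hz' with rfl | rfl | rfl
    · have := noprop (insert e1 Q) (Finset.insert_subset he1Z hQZ) (by
        rw [bd_insert h hQ1, ha, hQz]; exact charTwo_fun _) (by simp)
      rw [← this] at he2Z
      simp [hQ2, he21] at he2Z
    · have := noprop (insert e2 Q) (Finset.insert_subset he2Z hQZ) (by
        rw [bd_insert h hQ2, hb, hQz]; exact charTwo_fun _) (by simp)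
      rw [← this] at he1Z
      simp [hQ1, he21.symm] at he1Z
    · have := noprop (insert e Q) (Finset.insert_subset (hCZ heC) hQZ) (by
        rw [bd_insert h hQe, hd, hQz]; exact charTwo_fun _) (by simp)
      rw [← this] at he1Z
      have : e1 ≠ e := fun hh => he1C (hh ▸ heC)
      simp [hQ1, this] at he1Z
  have hfil : Z.filter (Crosses h {x}) = {e1, e2} := by
    ext e
    simp only [Finset.mem_filter, Finset.mem_insert, Finset.mem_singleton]
    constructor
    · rintro ⟨h1, h2⟩
      by_contra! hcon
      exact hCx e (by simp [hC, hcon, h1]) h2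
    · rintro (rfl | rfl)
      exacts [⟨he1Z, he1x⟩, ⟨he2Z, he2x⟩]
  rw [hsum, hfil, Finset.sum_pair he21.symm] at hZneg
  have he1J : e1 ∉ J := by
    intro h1; simp only [h1, if_true] at hZneg; split_ifs at hZneg <;> linarith
  have he2J : e2 ∉ J := by
    intro h1; simp only [h1, if_true] at hZneg; split_ifs at hZneg; linarith
  have hWZ0 : W Z = 0 := by
    simp only [he1J, he2J, if_false] at hZneg
    obtain ⟨k, hk⟩ := heven Z hZ0
    have : W Z = k + k := hk
    omega
  have hWC : W C = - w e1 - w e2 := by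
    rw [hC, Wer he2Z', Wer he1Z, hWZ0]; ring
  have he1P : e1 ∉ P := fun hh => he1J ((starP e1 he1x).2 hh)
  have he2P : e2 ∉ P := fun hh => he2J ((starP e2 he2x).2 hh)
  have hw1 := hpos e1 he1J (nl he1x)
  have hw2 := hpos e2 he2J (nl he2x)
  by_cases hPC : Disjoint P C
  · have h1 : e1 ∉ P ∪ C := by simp [he1P, he1C]
    have h2 := hPmin' (insert e1 (P ∪ C)) u b (by
      rw [bd_insert h h1, bd_union h hPC, ha, hP, hbC, add_left_comm, endPair_trans, endPair_trans])
    rw [Wins h1, Wuni hPC, hWC] at h2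
    linarith
  · obtain ⟨f, hfP, hfC⟩ := Finset.not_disjoint_iff.1 hPC
    have hsplit : bd h P = bd h (P \ C) + bd h (P ∩ C) := by
      rw [← bd_union h (Finset.disjoint_sdiff_inter P C), Finset.sdiff_union_inter]
    have hPCx : bd h (P ∩ C) x = 0 := by
      rw [bd_apply_eq_card, Finset.filter_false_of_mem]
      · simp
      · intro e he; exact hCx e (Finset.mem_inter.1 he).2
    obtain ⟨z, hzx, hz, Q, hQ, hQz⟩ := exists_sub_path h (P \ C) x (by
      have := congrFun hsplit x
      rw [Pi.add_apply, hPCx, add_zero, hP, endPair_apply] at this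
      rw [← this]; simp [hux.symm])
    have hQP : Q ⊆ P := hQ.trans Finset.sdiff_subset
    have hQC : Disjoint Q C := Finset.disjoint_of_subset_left hQ Finset.sdiff_disjoint
    by_cases hzu : z = u
    · have := noeven (P \ Q) Finset.sdiff_subset (by
        rw [bd_sdiff h hQP, hP, hQz, hzu, endPair_trans, endPair_self])
      have h2 : f ∈ P \ Q := by
        simp only [Finset.mem_sdiff, hfP, true_and]
        exact fun hh => Finset.disjoint_left.1 hQC hh hfC
      simp [this] at h2
    · have hz1 : bd h (P ∩ C) z = 1 := by
        have := congrFun hsplit z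
        rw [Pi.add_apply, hz, hP, endPair_apply] at this
        simp only [hzu, hzx, if_false] at this
        by_contra hcon
        rw [← ne_eq, zmod_two_ne_one] at hcon
        rw [hcon] at this
        simp at this
      obtain ⟨g, hg, hgz⟩ := exists_crosses_of_bd hz1
      have hgC : g ∈ C := (Finset.mem_inter.1 hg).2
      obtain ⟨z', hz'z, hz'⟩ := exists_other_end hgz
      obtain ⟨C1, hC1, hbC1⟩ : ∃ C1 ⊆ C, bd h C1 = endPair a z := by
        by_cases hza : z = a
        · exact ⟨∅, by simp, by rw [hza, endPair_self, bd_empty]⟩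
        by_cases hzb : z = b
        · exact ⟨C, subset_rfl, by rw [hbC, hzb]⟩
        have hCg : bd h (C.erase g) = endPair a b + endPair z z' := by rw [bd_erase h hgC, hbC, hz']
        obtain ⟨q, hqz, hq, Q', hQ', hQq⟩ := exists_sub_path h (C.erase g) z (by
          rw [hCg]; simp [endPair_apply, hza, hzb, hz'z.symm])
        have hQ'C : Q' ⊆ C := hQ'.trans (Finset.erase_subset _ _)
        have hq' : q = a ∨ q = b ∨ q = z' := by
          by_contra! hcon
          rw [hCg] at hq
          simp [endPair_apply, hcon, hqz] at hq
        rcases hq' with rfl | rfl | rfl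
        · exact ⟨Q', hQ'C, by rw [hQq, endPair_comm]⟩
        · exact ⟨C \ Q', Finset.sdiff_subset, by
            rw [bd_sdiff h hQ'C, hbC, hQq, endPair_comm z q, endPair_trans]⟩
        · have hgQ : g ∉ Q' := fun hh => by simpa using hQ' hh
          have := noprop (insert g Q') (Finset.insert_subset (hCZ hgC) (hQ'C.trans hCZ)) (by
            rw [bd_insert h hgQ, hz', hQq]; exact charTwo_fun _) (by simp)
          rw [← this] at he1Z
          have h1 : e1 ≠ g := fun hh => he1C (hh ▸ hgC)
          have h2 : e1 ∉ Q' := fun hh => he1C (hQ'C hh)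
          simp [h1, h2] at he1Z
      have hQ1 : Disjoint Q C1 := Finset.disjoint_of_subset_right hC1 hQC
      have hQ2 : Disjoint Q (C \ C1) := Finset.disjoint_of_subset_right Finset.sdiff_subset hQC
      have hn1 : e1 ∉ Q ∪ C1 := by
        simp only [Finset.mem_union, not_or]; exact ⟨fun hh => he1P (hQP hh), fun hh => he1C (hC1 hh)⟩
      have hn2 : e2 ∉ Q ∪ (C \ C1) := by
        simp only [Finset.mem_union, not_or, Finset.mem_sdiff]
        exact ⟨fun hh => he2P (hQP hh), fun hh => he2C hh.1⟩
      have k1 : 0 ≤ W (insert e1 (Q ∪ C1)) := hcons _ (by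
        rw [bd_insert h hn1, bd_union h hQ1, hQz, hbC1, ha, add_left_comm, endPair_trans]
        exact charTwo_fun _)
      have k2 : 0 ≤ W (insert e2 (Q ∪ (C \ C1))) := hcons _ (by
        rw [bd_insert h hn2, bd_union h hQ2, hQz, bd_sdiff h hC1, hbC, hbC1, hb,
          endPair_comm a b, endPair_trans, add_left_comm, endPair_trans]
        exact charTwo_fun _)
      rw [Wins hn1, Wuni hQ1] at k1
      rw [Wins hn2, Wuni hQ2, Wsd hC1, hWC] at k2
      have k3 : 0 ≤ W Q := by linarith
      have k4 := hPcard (P \ Q) u z (Ne.symm hzu) (by rw [bd_sdiff h hQP, hP, hQz, endPair_trans])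
        (by rw [Wsd hQP]; linarith)
      have k5 := Finset.card_sdiff_add_card_eq_card hQP
      have k6 : Q = ∅ := Finset.card_eq_zero.1 (by omega)
      rw [k6, bd_empty] at hQz
      have := congrFun hQz x
      rw [endPair_apply] at this
      simp [hzx.symm] at this

end TJoin

section TJoin

variable {V E : Type*} [DecidableEq V] [DecidableEq E] 

/-- Contracting `b` onto `a`, on parity vectors. -/
lemma bd_contract (h : E → V × V) (a b : V) (hab : a ≠ b) (P : Finset E) (v : V) :
    bd (fun e => (if (h e).1 = b then a else (h e).1, if (h e).2 = b then a else (h e).2)) P v =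
      bd h P v + bd h P b * endPair a b v := by
  simp only [bd, Finset.sum_apply, Finset.sum_mul]
  rw [← Finset.sum_add_distrib]
  refine Finset.sum_congr rfl fun e _ => ?_
  simp only [endPair_apply]
  grind

variable [Fintype E]

theorem exists_tjoin_of_even (N : ℕ) : ∀ (h : E → V × V) (T : V → ZMod 2) (c : E → ℕ),
    ∑ e, c e + (Finset.univ.filter fun e => (h e).1 ≠ (h e).2).card ≤ N →
    (∃ J, bd h J = T) → (∀ Z, bd h Z = 0 → Even (∑ e ∈ Z, c e)) →
    ∀ y : E → ℝ, (∀ e, 0 ≤ y e) →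
    (∀ S : Finset V, ∑ v ∈ S, T v = 1 → 1 ≤ ∑ e with Crosses h S e, y e) →
    ∃ J, bd h J = T ∧ (∑ e ∈ J, (c e : ℝ)) ≤ ∑ e, c e * y e := by
  induction N with
  | zero =>
    rintro h T c hN ⟨J, hJ⟩ - y hy -
    refine ⟨J, hJ, ?_⟩
    have hc : ∀ e, c e = 0 := fun e => by
      have : ∑ e, c e = 0 := by omega
      exact (Finset.sum_eq_zero_iff.1 this) e (Finset.mem_univ e)
    simp [hc]
  | succ N ih =>
    rintro h T c hN ⟨J0, hJ0⟩ heven y hy hcut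
    by_cases hz : ∃ e, (h e).1 ≠ (h e).2 ∧ c e = 0
    · obtain ⟨e0, hne, hc0⟩ := hz
      set a := (h e0).1 with ha
      set b := (h e0).2 with hb
      set h' : E → V × V :=
        fun e => (if (h e).1 = b then a else (h e).1, if (h e).2 = b then a else (h e).2) with hh'
      have hbd : ∀ P v, bd h' P v = bd h P v + bd h P b * endPair a b v :=
        bd_contract h a b hne
      have hlift : ∀ (U : V → ZMod 2) (P : Finset E), (∀ v, bd h' P v = U v + U b * endPair a b v) →
          ∃ P', bd h P' = U ∧ ∑ e ∈ P', c e = ∑ e ∈ P, c e := by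
        intro U P hP
        by_cases hUb : bd h P b + U b = 0
        · refine ⟨P, funext fun v => ?_, rfl⟩
          have h1 := hP v
          rw [hbd] at h1
          have h2 : U b = bd h P b := by grind
          rw [h2] at h1
          exact add_right_cancel h1
        · rw [← ne_eq, zmod_two_ne_zero] at hUb
          refine ⟨symmDiff P {e0}, funext fun v => ?_, ?_⟩
          · rw [bd_symmDiff, bd_singleton, Pi.add_apply]
            have h1 := hP v
            rw [hbd] at h1
            grind
          · have := sum_symmDiff_cost (fun e => (c e : ℤ)) P {e0}
            simp [hc0] at this
            exact_mod_cast this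
      have hN' : ∑ e, c e + (Finset.univ.filter fun e => (h' e).1 ≠ (h' e).2).card ≤ N := by
        have : (Finset.univ.filter fun e => (h' e).1 ≠ (h' e).2).card
            < (Finset.univ.filter fun e => (h e).1 ≠ (h e).2).card := by
          refine Finset.card_lt_card (Finset.ssubset_iff_of_subset ?_ |>.2 ⟨e0, ?_, ?_⟩)
          · intro e; simp only [Finset.mem_filter, Finset.mem_univ, true_and, hh']
            exact fun h1 h2 => h1 (by rw [h2])
          · simpa using hne
          · simp [hh', ← ha, ← hb, hne]
        omega
      have heven' : ∀ Z, bd h' Z = 0 → Even (∑ e ∈ Z, c e) := by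
        intro Z hZ
        obtain ⟨Z', hZ', hcc⟩ := hlift 0 Z (fun v => by simp [hZ])
        rw [← hcc]; exact heven _ hZ'
      have hcut' : ∀ S : Finset V, ∑ v ∈ S, (T v + T b * endPair a b v) = 1 →
          1 ≤ ∑ e with Crosses h' S e, y e := by
        intro S hS
        set S' : Finset V := if a ∈ S then insert b S else S.erase b with hS'
        have hmem : ∀ v, v ∈ S' ↔ (if v = b then a else v) ∈ S := by
          intro v; rw [hS']; split_ifs <;> simp_all
        have hcr : ∀ e, Crosses h' S e ↔ Crosses h S' e := by
          intro e; simp only [Crosses, hh', hmem]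
        simp only [hcr]
        refine hcut S' ?_
        rw [Finset.sum_add_distrib, ← Finset.mul_sum] at hS
        have h2 : ∑ v ∈ S, endPair a b v = (if a ∈ S then 1 else 0) + (if b ∈ S then 1 else 0) := by
          simp only [endPair_apply, Finset.sum_add_distrib, Finset.sum_ite_eq']
        rw [h2] at hS
        rw [hS']
        by_cases haS : a ∈ S <;> by_cases hbS : b ∈ S
        · simp only [haS, hbS, if_true, Finset.insert_eq_of_mem] at hS ⊢
          grind
        · simp only [haS, hbS, if_true, if_false] at hS ⊢
          rw [Finset.sum_insert hbS]; grind
        · simp only [haS, hbS, if_true, if_false] at hS ⊢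
          have := Finset.sum_erase_add S T hbS
          grind
        · simp only [haS, hbS, if_false, Finset.erase_eq_of_notMem, not_false_eq_true] at hS ⊢
          grind
      obtain ⟨J, hJ, hJc⟩ := ih h' (fun v => T v + T b * endPair a b v) c hN'
        ⟨J0, funext fun v => by rw [hbd, hJ0]⟩ heven' y hy hcut'
      obtain ⟨J', hJ', hcc⟩ := hlift T J (fun v => by rw [hJ])
      refine ⟨J', hJ', ?_⟩
      have : (∑ e ∈ J', (c e : ℝ)) = ∑ e ∈ J, (c e : ℝ) := by exact_mod_cast hcc
      rwa [this]
    · push Not at hz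
      obtain ⟨J, hJT, hJmin⟩ := (Finset.univ.filter fun J => bd h J = T).exists_min_image
        (fun J => ∑ e ∈ J, c e) ⟨J0, by simpa using hJ0⟩
      simp only [Finset.mem_filter, Finset.mem_univ, true_and] at hJT hJmin
      by_cases hJc : ∃ e ∈ J, c e ≠ 0
      swap
      · push Not at hJc
        refine ⟨J, hJT, ?_⟩
        rw [Finset.sum_eq_zero fun e he => by rw [hJc e he, Nat.cast_zero]]
        exact Finset.sum_nonneg fun e _ => mul_nonneg (Nat.cast_nonneg _) (hy e)
      have hloop : ∀ e ∈ J, (h e).1 = (h e).2 → c e = 0 := by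
        intro e heJ hl
        have := hJmin (J.erase e) (by rw [bd_erase h heJ, hl, endPair_self, add_zero, hJT])
        have h2 := Finset.sum_erase_add J c heJ
        omega
      set w : E → ℤ := fun e => if e ∈ J then -(c e : ℤ) else c e with hw
      have hneg : ∀ e ∈ J, (h e).1 ≠ (h e).2 → w e ≤ -1 := by
        intro e he hne; simp only [hw, he, if_true]; have := hz e hne; omega
      have hpos : ∀ e ∉ J, (h e).1 ≠ (h e).2 → 1 ≤ w e := by
        intro e he hne; simp only [hw, he, if_false]; have := hz e hne; omega
      have hcons0 : ∀ Z, bd h Z = 0 → 0 ≤ ∑ e ∈ Z, w e := by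
        intro Z hZ
        have h1 := hJmin (symmDiff J Z) (by rw [bd_symmDiff, hZ, hJT, add_zero])
        have h2 := sum_symmDiff_cost (fun e => (c e : ℤ)) J Z
        zify at h1
        simp only [hw]; linarith
      have hweven : ∀ Z, bd h Z = 0 → Even (∑ e ∈ Z, w e) := by
        intro Z hZ
        have h1 := heven Z hZ
        rw [← Int.even_coe_nat] at h1
        push_cast at h1
        have h2 : ∑ e ∈ Z, w e = ∑ e ∈ Z, (c e : ℤ) - 2 * ∑ e ∈ Z, (if e ∈ J then (c e : ℤ) else 0) := by
          rw [Finset.mul_sum, ← Finset.sum_sub_distrib]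
          refine Finset.sum_congr rfl fun e _ => ?_
          simp only [hw]; split_ifs <;> ring
        rw [h2]
        exact h1.sub (even_two_mul _)
      have hJne : ∃ e ∈ J, (h e).1 ≠ (h e).2 := by
        obtain ⟨e, heJ, hec⟩ := hJc
        exact ⟨e, heJ, fun hl => hec (hloop e heJ hl)⟩
      obtain ⟨x, ⟨j, hjJ, hjx, huniq⟩, hcons⟩ :=
        exists_reducing_vertex h J w hneg hpos hcons0 hweven hJne
      have hTx : T x = 1 := by
        rw [← hJT, bd_apply_eq_card]
        have : J.filter (Crosses h {x}) = {j} := by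
          ext e; simp only [Finset.mem_filter, Finset.mem_singleton]
          exact ⟨fun hh => huniq e hh.1 hh.2, fun hh => hh ▸ ⟨hjJ, hjx⟩⟩
        rw [this]; simp
      have hcx := hcut {x} (by simpa using hTx)
      have hc1 : ∀ e, Crosses h {x} e → 1 ≤ c e := fun e he =>
        Nat.one_le_iff_ne_zero.2 (hz e fun hl => he (by rw [hl]))
      set c' : E → ℕ := fun e => c e - if Crosses h {x} e then 1 else 0 with hc'
      have hcc : ∀ e, c e = c' e + if Crosses h {x} e then 1 else 0 := by
        intro e; simp only [hc']; split_ifs with hh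
        · have := hc1 e hh; omega
        · omega
      have hccs : ∀ P : Finset E, ∑ e ∈ P, c e = ∑ e ∈ P, c' e + (P.filter (Crosses h {x})).card := by
        intro P
        rw [Finset.card_filter, ← Finset.sum_add_distrib]
        exact Finset.sum_congr rfl fun e _ => hcc e
      have hN' : ∑ e, c' e + (Finset.univ.filter fun e => (h e).1 ≠ (h e).2).card ≤ N := by
        have h1 := hccs Finset.univ
        have h2 : 0 < (Finset.univ.filter (Crosses h {x})).card :=
          Finset.card_pos.2 ⟨j, by simpa using hjx⟩
        omega
      have heven' : ∀ Z, bd h Z = 0 → Even (∑ e ∈ Z, c' e) := by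
        intro Z hZ
        have h1 := heven Z hZ
        rw [hccs] at h1
        have h2 := bd_apply_eq_card h Z x
        rw [hZ, Pi.zero_apply] at h2
        have h3 := (ZMod.natCast_eq_zero_iff_even).1 h2.symm
        exact (Nat.even_add.1 h1).2 h3
      obtain ⟨J', hJ', hJ'c⟩ := ih h T c' hN' ⟨J0, hJ0⟩ heven' y hy hcut
      refine ⟨J, hJT, ?_⟩
      have h1 := hcons (symmDiff J J') (by rw [bd_symmDiff, hJT, hJ']; exact charTwo_fun _)
      have h2 := sum_symmDiff_cost (fun e => (c' e : ℤ)) J (symmDiff J J')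
      rw [symmDiff_symmDiff_cancel_left] at h2
      have h3 : ∑ e ∈ symmDiff J J', (w e + if Crosses h {x} e then (if e ∈ J then 1 else -1) else 0)
          = ∑ e ∈ symmDiff J J', (if e ∈ J then -(c' e : ℤ) else c' e) := by
        refine Finset.sum_congr rfl fun e _ => ?_
        have := hcc e
        simp only [hw]
        split_ifs at this ⊢ <;> push_cast [this] <;> ring
      rw [h3] at h1
      have h4 : (∑ e ∈ J, c' e) ≤ ∑ e ∈ J', c' e := by zify; linarith
      have h5 : ∑ e ∈ J, c e = ∑ e ∈ J, c' e + 1 := by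
        rw [hccs]; congr 1
        rw [Finset.card_eq_one]
        refine ⟨j, ?_⟩
        ext e; simp only [Finset.mem_filter, Finset.mem_singleton]
        exact ⟨fun hh => huniq e hh.1 hh.2, fun hh => hh ▸ ⟨hjJ, hjx⟩⟩
      have h6 : ∑ e, (c e : ℝ) * y e = ∑ e, (c' e : ℝ) * y e + ∑ e with Crosses h {x} e, y e := by
        rw [Finset.sum_filter, ← Finset.sum_add_distrib]
        refine Finset.sum_congr rfl fun e _ => ?_
        rw [hcc e]; push_cast; split_ifs <;> ring
      have h7 : (∑ e ∈ J, (c e : ℝ)) = ∑ e ∈ J, (c' e : ℝ) + 1 := by exact_mod_cast h5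
      have h8 : (∑ e ∈ J, (c' e : ℝ)) ≤ ∑ e ∈ J', (c' e : ℝ) := by exact_mod_cast h4
      linarith

/-- A fractional point of the `T`-join dominant is at least as costly as some `T`-join. -/
theorem exists_tjoin (h : E → V × V) (J0 : Finset E) (c : E → ℕ) (y : E → ℝ) (hy : ∀ e, 0 ≤ y e)
    (hcut : ∀ S : Finset V, ∑ v ∈ S, bd h J0 v = 1 → 1 ≤ ∑ e with Crosses h S e, y e) :
    ∃ J, bd h J = bd h J0 ∧ (∑ e ∈ J, (c e : ℝ)) ≤ ∑ e, c e * y e := by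
  obtain ⟨J, hJ, hJc⟩ := exists_tjoin_of_even _ h (bd h J0) (fun e => 2 * c e) le_rfl ⟨J0, rfl⟩
    (fun Z _ => by rw [← Finset.mul_sum]; exact even_two_mul _) y hy hcut
  refine ⟨J, hJ, ?_⟩
  push_cast at hJc
  simp only [mul_assoc] at hJc
  rw [← Finset.mul_sum, ← Finset.mul_sum] at hJc
  linarith

end TJoin

section Euler

variable {V E : Type*} [DecidableEq V] [DecidableEq E]

/-- `Q` is a set of edges traversed by a walk from `a` to `z`. -/
def TraversedBy (G : SimpleGraph V) (h : E → V × V) (Q : Finset E) (a z : V) (w : G.Walk a z) :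
    Prop :=
  bd h Q = endPair a z ∧ w.length = Q.card ∧ ∀ e ∈ Q, (h e).1 ∈ w.support ∧ (h e).2 ∈ w.support

lemma exists_other_end_adj {G : SimpleGraph V} {h : E → V × V} {x : V} {e : E}
    (hG : G.Adj (h e).1 (h e).2) (he : Crosses h {x} e) :
    ∃ a, a ≠ x ∧ endPair (h e).1 (h e).2 = endPair x a ∧ G.Adj x a ∧
      (((h e).1 = x ∧ (h e).2 = a) ∨ ((h e).1 = a ∧ (h e).2 = x)) := by
  rw [Crosses] at he
  simp only [Finset.mem_singleton] at he
  by_cases h1 : (h e).1 = x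
  · exact ⟨(h e).2, fun h2 => he (by simp [h1, h2]), by rw [h1], by rwa [h1] at hG, by tauto⟩
  · have h2 : (h e).2 = x := by tauto
    exact ⟨(h e).1, h1, by rw [h2, endPair_comm], by rw [h2] at hG; exact hG.symm, by tauto⟩

lemma exists_sub_walk (G : SimpleGraph V) (h : E → V × V) (C : Finset E)
    (hG : ∀ e ∈ C, G.Adj (h e).1 (h e).2) (a : V) (ha : bd h C a = 1) :
    ∃ z, z ≠ a ∧ bd h C z = 1 ∧ ∃ Q ⊆ C, ∃ w : G.Walk a z, TraversedBy G h Q a z w := by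
  induction C using Finset.strongInduction generalizing a with
  | H C ih =>
    obtain ⟨e, heC, he⟩ := exists_crosses_of_bd ha
    obtain ⟨b, hba, hb, hadj, hends⟩ := exists_other_end_adj (hG e heC) he
    by_cases hCb : bd h C b = 1
    · refine ⟨b, hba, hCb, {e}, by simpa using heC, hadj.toWalk, by rw [bd_singleton, hb], by simp, ?_⟩
      intro e' he'
      rw [Finset.mem_singleton] at he'
      subst he'
      rcases hends with ⟨h1, h2⟩ | ⟨h1, h2⟩ <;> simp [h1, h2]
    · rw [← ne_eq, zmod_two_ne_one] at hCb
      have key : bd h (C.erase e) = bd h C + endPair a b := by rw [bd_erase h heC, hb]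
      obtain ⟨z, hzb, hz, Q, hQ, w, hQz, hlen, hsup⟩ := ih (C.erase e) (Finset.erase_ssubset heC)
        (fun e' he' => hG e' (Finset.mem_of_mem_erase he')) b (by
          rw [key, Pi.add_apply, hCb, endPair_apply]; simp [hba])
      have hza : z ≠ a := by
        rintro rfl
        rw [key, Pi.add_apply, ha, endPair_apply] at hz
        simp [hba.symm] at hz
      have heQ : e ∉ Q := fun hh => by simpa using hQ hh
      refine ⟨z, hza, ?_, insert e Q, ?_, SimpleGraph.Walk.cons hadj w, ?_, ?_, ?_⟩
      · rw [key, Pi.add_apply, endPair_apply] at hz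
        simpa [hza, hzb] using hz
      · exact Finset.insert_subset heC (hQ.trans (Finset.erase_subset _ _))
      · rw [bd_insert h heQ, hb, hQz, endPair_trans]
      · rw [SimpleGraph.Walk.length_cons, hlen, Finset.card_insert_of_notMem heQ]
      · intro e' he'
        rw [SimpleGraph.Walk.support_cons]
        rcases Finset.mem_insert.1 he' with rfl | he'
        · rcases hends with ⟨h1, h2⟩ | ⟨h1, h2⟩ <;> simp [h1, h2]
        · exact ⟨List.mem_cons_of_mem _ (hsup e' he').1, List.mem_cons_of_mem _ (hsup e' he').2⟩

/-- An Eulerian walk argument: a connected edge family with odd degrees exactly at `s` and `t`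
carries a spanning walk from `s` to `t`. -/
theorem exists_spanning_walk (G : SimpleGraph V) (h : E → V × V) (M : Finset E)
    (hG : ∀ e ∈ M, G.Adj (h e).1 (h e).2) (s t : V) (hbd : bd h M = endPair s t)
    (hconn : ∀ S : Set V, s ∈ S → (∀ e ∈ M, (h e).1 ∈ S ↔ (h e).2 ∈ S) → ∀ v, v ∈ S) :
    ∃ w : G.Walk s t, (∀ u, u ∈ w.support) ∧ w.length ≤ M.card := by
  obtain ⟨Q, hQ, hmax⟩ := (M.powerset.filter fun Q =>
      ∃ w : G.Walk s t, TraversedBy G h Q s t w).exists_max_image Finset.card (by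
    by_cases hst : s = t
    · subst hst
      exact ⟨∅, by
        simp only [Finset.mem_filter, Finset.empty_mem_powerset, true_and]
        exact ⟨SimpleGraph.Walk.nil, by rw [endPair_self, bd_empty], by simp, by simp⟩⟩
    · obtain ⟨z, hzs, hz, Q, hQ, w, hw⟩ := exists_sub_walk G h M hG s (by
        rw [hbd, endPair_apply]; simp [hst])
      have hzt : z = t := by
        by_contra hne
        rw [hbd, endPair_apply] at hz
        simp [hzs, hne] at hz
      subst hzt
      exact ⟨Q, by simp only [Finset.mem_filter, Finset.mem_powerset]; exact ⟨hQ, w, hw⟩⟩)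
  simp only [Finset.mem_filter, Finset.mem_powerset] at hQ hmax
  obtain ⟨hQM, w, hQb, hlen, hsup⟩ := hQ
  refine ⟨w, ?_, hlen.le.trans (Finset.card_le_card hQM)⟩
  by_contra hcon
  have hex : ∃ e ∈ M, ¬((h e).1 ∈ w.support ↔ (h e).2 ∈ w.support) := by
    by_contra! hno
    exact hcon (hconn {v | v ∈ w.support} w.start_mem_support hno)
  obtain ⟨e, heM, hecr⟩ := hex
  have heQ : e ∉ Q := fun hh => hecr (by simp [(hsup e hh).1, (hsup e hh).2])
  obtain ⟨a, b, haS, hadj, hab, hends⟩ : ∃ a b, a ∈ w.support ∧ G.Adj a b ∧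
      endPair (h e).1 (h e).2 = endPair a b ∧
      (((h e).1 = a ∧ (h e).2 = b) ∨ ((h e).1 = b ∧ (h e).2 = a)) := by
    by_cases h1 : (h e).1 ∈ w.support
    · exact ⟨_, _, h1, hG e heM, rfl, by tauto⟩
    · exact ⟨(h e).2, (h e).1, by tauto, (hG e heM).symm, endPair_comm _ _, by tauto⟩
  have heR : e ∈ M \ Q := Finset.mem_sdiff.2 ⟨heM, heQ⟩
  have hR : bd h ((M \ Q).erase e) = endPair a b := by
    rw [bd_erase h heR, bd_sdiff h hQM, hbd, hQb, hab, charTwo_fun, zero_add]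
  obtain ⟨z, hzb, hz, Q', hQ', w', hQb', hlen', hsup'⟩ := exists_sub_walk G h ((M \ Q).erase e)
    (fun e' he' => hG e' (Finset.mem_sdiff.1 (Finset.mem_of_mem_erase he')).1) b (by
      rw [hR, endPair_apply]; simp [hadj.ne'])
  have hza : z = a := by
    by_contra hne
    rw [hR, endPair_apply] at hz
    simp [hzb, hne] at hz
  subst hza
  have heQ' : e ∉ Q' := fun hh => by simpa using hQ' hh
  have hdis : Disjoint Q Q' := by
    rw [Finset.disjoint_left]
    intro f hf hf'
    exact (Finset.mem_sdiff.1 (Finset.mem_of_mem_erase (hQ' hf'))).2 hf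
  have henew : e ∉ Q ∪ Q' := by simp [heQ, heQ']
  have := hmax (insert e (Q ∪ Q')) ⟨?_, (w.takeUntil z haS).append
    ((SimpleGraph.Walk.cons hadj w').append (w.dropUntil z haS)), ?_, ?_, ?_⟩
  · rw [Finset.card_insert_of_notMem henew, Finset.card_union_of_disjoint hdis] at this
    omega
  · refine Finset.insert_subset heM (Finset.union_subset hQM ?_)
    exact hQ'.trans ((Finset.erase_subset _ _).trans Finset.sdiff_subset)
  · rw [bd_insert h henew, bd_union h hdis, hab, hQb, hQb', add_left_comm, endPair_trans,
      endPair_self, add_zero]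
  · have h1 := congrArg SimpleGraph.Walk.length (w.take_spec haS)
    rw [SimpleGraph.Walk.length_append] at h1
    rw [Finset.card_insert_of_notMem henew, Finset.card_union_of_disjoint hdis]
    simp only [SimpleGraph.Walk.length_append, SimpleGraph.Walk.length_cons]
    omega
  · have h1 : ∀ v ∈ w.support, v ∈ ((w.takeUntil z haS).append
        ((SimpleGraph.Walk.cons hadj w').append (w.dropUntil z haS))).support := by
      intro v hv
      rw [← w.take_spec haS] at hv
      simp only [SimpleGraph.Walk.mem_support_append_iff] at hv ⊢
      tauto
    have h2 : ∀ v, v = z ∨ v ∈ w'.support → v ∈ ((w.takeUntil z haS).append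
        ((SimpleGraph.Walk.cons hadj w').append (w.dropUntil z haS))).support := by
      intro v hv
      simp only [SimpleGraph.Walk.mem_support_append_iff, SimpleGraph.Walk.support_cons,
        List.mem_cons]
      tauto
    intro f hf
    rcases Finset.mem_insert.1 hf with rfl | hf
    · rcases hends with ⟨k1, k2⟩ | ⟨k1, k2⟩ <;> rw [k1, k2]
      · exact ⟨h1 _ haS, h2 _ (Or.inr w'.start_mem_support)⟩
      · exact ⟨h2 _ (Or.inr w'.start_mem_support), h1 _ haS⟩
    · rcases Finset.mem_union.1 hf with hf | hf
      · exact ⟨h1 _ (hsup f hf).1, h1 _ (hsup f hf).2⟩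
      · exact ⟨h2 _ (Or.inr (hsup' f hf).1), h2 _ (Or.inr (hsup' f hf).2)⟩

end Euler

section Circulation

variable {A N : Type*} [Fintype A] [DecidableEq N]

/-- Conservation of the flow `f` at every node. -/
def IsCirculation {R : Type*} [AddCommMonoid R] (tl hd : A → N) (f : A → R) : Prop :=
  ∀ v, ∑ a, (if hd a = v then f a else 0) = ∑ a, (if tl a = v then f a else 0)

lemma card_fractional_ends (tl hd : A → N) (f : A → ℝ) (hf : IsCirculation tl hd f) (F : Finset A)
    (hF : ∀ a, a ∈ F ↔ ∀ z : ℤ, f a ≠ z) (v : N)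
    (h1 : 1 ≤ (F.filter fun a => hd a = v).card + (F.filter fun a => tl a = v).card) :
    2 ≤ (F.filter fun a => hd a = v).card + (F.filter fun a => tl a = v).card := by
  by_contra hlt
  set I : AddSubgroup ℝ := (Int.castAddHom ℝ).range with hI
  set q : ℝ →+ ℝ ⧸ I := QuotientAddGroup.mk' I with hq
  have hq0 : ∀ a, q (f a) = 0 ↔ a ∉ F := by
    intro a
    rw [hq, QuotientAddGroup.mk'_apply, QuotientAddGroup.eq_zero_iff, hF]
    simp [hI, AddSubgroup.mem_zmultiples_iff, eq_comm]
  have key : ∀ p : A → N, ∑ a, q (if p a = v then f a else 0) =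
      ∑ a ∈ F.filter (fun a => p a = v), q (f a) := by
    intro p
    rw [Finset.sum_filter, ← Finset.sum_subset (Finset.subset_univ F)]
    · refine Finset.sum_congr rfl fun a _ => ?_
      split_ifs <;> simp
    · intro a _ ha
      split_ifs
      · exact (hq0 a).2 ha
      · simp
  have hsum := congrArg q (hf v)
  rw [map_sum, map_sum, key, key] at hsum
  have hcases : ((F.filter fun a => hd a = v).card = 1 ∧ (F.filter fun a => tl a = v).card = 0) ∨
      ((F.filter fun a => hd a = v).card = 0 ∧ (F.filter fun a => tl a = v).card = 1) := by omega
  rcases hcases with ⟨h2, h3⟩ | ⟨h3, h2⟩ <;> rw [Finset.card_eq_zero] at h3 <;>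
    obtain ⟨a, ha⟩ := Finset.card_eq_one.1 h2 <;> rw [h3, ha] at hsum <;>
    simp only [Finset.sum_singleton, Finset.sum_empty] at hsum
  · exact (hq0 a).1 hsum (Finset.mem_filter.1 (ha ▸ Finset.mem_singleton_self a)).1
  · exact (hq0 a).1 hsum.symm (Finset.mem_filter.1 (ha ▸ Finset.mem_singleton_self a)).1

lemma exists_fractional_direction (tl hd : A → N) (f : A → ℝ) (hf : IsCirculation tl hd f)
    (F : Finset A) (hF : ∀ a, a ∈ F ↔ ∀ z : ℤ, f a ≠ z) (hne : F.Nonempty) :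
    ∃ d : A → ℝ, d ≠ 0 ∧ (∀ a ∉ F, d a = 0) ∧ IsCirculation tl hd d := by
  set W : Finset N := F.image hd ∪ F.image tl with hW
  have hWF : W.card ≤ F.card := by
    have h1 : ∑ v ∈ W, (F.filter fun a => hd a = v).card = F.card :=
      (Finset.card_eq_sum_card_fiberwise fun a ha =>
        Finset.mem_union_left _ (Finset.mem_image_of_mem _ ha)).symm
    have h2 : ∑ v ∈ W, (F.filter fun a => tl a = v).card = F.card :=
      (Finset.card_eq_sum_card_fiberwise fun a ha =>
        Finset.mem_union_right _ (Finset.mem_image_of_mem _ ha)).symm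
    have h3 : ∑ v ∈ W, 2 ≤ ∑ v ∈ W, ((F.filter fun a => hd a = v).card +
        (F.filter fun a => tl a = v).card) := by
      refine Finset.sum_le_sum fun v hv => card_fractional_ends tl hd f hf F hF v ?_
      rcases Finset.mem_union.1 hv with hv | hv <;> obtain ⟨a, ha, rfl⟩ := Finset.mem_image.1 hv
      · have : 0 < (F.filter fun b => hd b = hd a).card :=
          Finset.card_pos.2 ⟨a, by simp [ha]⟩
        omega
      · have : 0 < (F.filter fun b => tl b = tl a).card :=
          Finset.card_pos.2 ⟨a, by simp [ha]⟩
        omega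
    rw [Finset.sum_add_distrib, h1, h2] at h3
    simp at h3
    omega
  let L : (F → ℝ) →ₗ[ℝ] (W → ℝ) :=
    { toFun := fun d v => ∑ a, d a * ((if hd a = v then 1 else 0) - (if tl a = v then 1 else 0))
      map_add' := fun d e => by
        ext v; simp [add_mul, Finset.sum_add_distrib]
      map_smul' := fun r d => by
        ext v; simp [mul_assoc, Finset.mul_sum] }
  have hLsum : ∀ d, ∑ v, L d v = 0 := by
    intro d
    change ∑ v, ∑ a, _ = _
    rw [Finset.sum_comm]
    refine Finset.sum_eq_zero fun a _ => ?_
    rw [← Finset.mul_sum]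
    have hh : ∀ p : A → N, p a ∈ W → ∑ v : W, (if p a = v then (1 : ℝ) else 0) = 1 := by
      intro p hp
      rw [Finset.sum_eq_single ⟨p a, hp⟩]
      · simp
      · intro b _ hb
        rw [if_neg]
        intro h; exact hb (Subtype.ext h.symm)
      · simp
    rw [Finset.sum_sub_distrib, hh hd (Finset.mem_union_left _ (Finset.mem_image_of_mem _ a.2)),
      hh tl (Finset.mem_union_right _ (Finset.mem_image_of_mem _ a.2))]
    simp
  have hninj : ¬ Function.Injective L := by
    intro hinj
    have hle := LinearMap.finrank_le_finrank_of_injective hinj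
    simp only [Module.finrank_fintype_fun_eq_card, Fintype.card_coe] at hle
    have hsurj := (LinearMap.injective_iff_surjective_of_finrank_eq_finrank (f := L) (by
      simp only [Module.finrank_fintype_fun_eq_card, Fintype.card_coe]; omega)).1 hinj
    obtain ⟨a, ha⟩ := hne
    obtain ⟨d, hd'⟩ := hsurj (Pi.single ⟨hd a, Finset.mem_union_left _ (Finset.mem_image_of_mem _ ha)⟩ 1)
    have := hLsum d
    rw [hd'] at this
    simp at this
  obtain ⟨d, hdL, hd0⟩ : ∃ d, L d = 0 ∧ d ≠ 0 := by
    by_contra! hcon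
    exact hninj ((injective_iff_map_eq_zero L).2 hcon)
  refine ⟨fun a => if ha : a ∈ F then d ⟨a, ha⟩ else 0, ?_, ?_, ?_⟩
  · intro h0
    apply hd0
    ext a
    have := congrFun h0 a
    simpa using this
  · intro a ha; simp [ha]
  · intro v
    rw [← sub_eq_zero, ← Finset.sum_sub_distrib]
    rw [← Finset.sum_subset (Finset.subset_univ F) (by intro a _ ha; simp [ha]),
      ← Finset.sum_coe_sort]
    by_cases hv : v ∈ W
    · have := congrFun hdL ⟨v, hv⟩
      change ∑ a, _ = _ at this
      refine Eq.trans ?_ this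
      refine Finset.sum_congr rfl fun a _ => ?_
      simp only [a.2, dif_pos]
      split_ifs <;> simp
    · refine Finset.sum_eq_zero fun a _ => ?_
      have h1 : hd a ≠ v := fun h => hv (h ▸ Finset.mem_union_left _ (Finset.mem_image_of_mem _ a.2))
      have h2 : tl a ≠ v := fun h => hv (h ▸ Finset.mem_union_right _ (Finset.mem_image_of_mem _ a.2))
      simp [h1, h2]

/-- Every real circulation can be rounded to an integral one without increasing a linear cost. -/
theorem exists_integral_circulation (tl hd : A → N) (c f : A → ℝ) (hf : IsCirculation tl hd f) :
    ∃ g : A → ℤ, IsCirculation tl hd g ∧ (∀ a, ⌊f a⌋ ≤ g a ∧ g a ≤ ⌈f a⌉) ∧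
      ∑ a, c a * g a ≤ ∑ a, c a * f a := by
  induction hn : (Finset.univ.filter fun a => ∀ z : ℤ, f a ≠ z).card using Nat.strong_induction_on
    generalizing f with
  | _ n ih =>
  by_cases hne : (Finset.univ.filter fun a => ∀ z : ℤ, f a ≠ z).Nonempty
  swap
  · have h_int : ∀ a, f a = ⌊f a⌋ := by
      intro a
      by_contra hcon
      refine hne ⟨a, ?_⟩
      simp only [Finset.mem_filter, Finset.mem_univ, true_and]
      intro z hz
      exact hcon (by rw [hz, Int.floor_intCast])
    refine ⟨fun a => ⌊f a⌋, ?_, fun a => ⟨le_rfl, Int.floor_le_ceil _⟩, ?_⟩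
    · intro v
      have := hf v
      have h2 : ∀ p : A → N, ∑ a, (if p a = v then f a else 0) =
          ((∑ a, (if p a = v then ⌊f a⌋ else 0) : ℤ) : ℝ) := by
        intro p
        push_cast
        refine Finset.sum_congr rfl fun a _ => ?_
        split_ifs
        exacts [h_int a, rfl]
      rw [h2, h2] at this
      exact_mod_cast this
    · exact (Finset.sum_congr rfl fun a _ => by rw [← h_int a]).le
  · obtain ⟨d, hd0, hdF, hdc, hcd⟩ : ∃ d : A → ℝ, d ≠ 0 ∧ (∀ a, d a ≠ 0 → ∀ z : ℤ, f a ≠ z) ∧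
        IsCirculation tl hd d ∧ ∑ a, c a * d a ≤ 0 := by
      obtain ⟨d, h1, h2, h3⟩ := exists_fractional_direction tl hd f hf _
        (fun a => by simp) hne
      have h4 : ∀ a, d a ≠ 0 → ∀ z : ℤ, f a ≠ z := by
        intro a ha
        by_contra hcon
        exact ha (h2 a (by simpa using hcon))
      rcases le_total (∑ a, c a * d a) 0 with h5 | h5
      · exact ⟨d, h1, h4, h3, h5⟩
      · refine ⟨-d, by simpa using h1, by simpa using h4, ?_, by simpa using h5⟩
        intro v
        have := congrArg Neg.neg (h3 v)
        rw [← Finset.sum_neg_distrib, ← Finset.sum_neg_distrib] at this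
        convert this using 2 with a _ a _ <;> split_ifs <;> simp
    set τ : A → ℝ := fun a => if 0 < d a then (⌈f a⌉ - f a) / d a else (f a - ⌊f a⌋) / (-d a) with hτ
    obtain ⟨a0, ha0⟩ := Function.ne_iff.1 hd0
    obtain ⟨b, hb, hbmin⟩ := (Finset.univ.filter fun a => d a ≠ 0).exists_min_image τ
      ⟨a0, by simpa using ha0⟩
    simp only [Finset.mem_filter, Finset.mem_univ, true_and] at hb hbmin
    have hτ0 : ∀ a, d a ≠ 0 → 0 ≤ τ a := by
      intro a ha
      simp only [hτ]
      split_ifs with h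
      · exact div_nonneg (by linarith [Int.le_ceil (f a)]) h.le
      · exact div_nonneg (by linarith [Int.floor_le (f a)]) (by linarith)
    have hcirc : IsCirculation tl hd (fun a => f a + τ b * d a) := by
      intro v
      have h1 := hf v
      have h2 := hdc v
      have h3 : ∀ p : A → N, ∑ a, (if p a = v then f a + τ b * d a else 0) =
          ∑ a, (if p a = v then f a else 0) + τ b * ∑ a, (if p a = v then d a else 0) := by
        intro p
        rw [Finset.mul_sum, ← Finset.sum_add_distrib]
        refine Finset.sum_congr rfl fun a _ => ?_
        split_ifs <;> ring
      rw [h3, h3, h1, h2]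
    have hbound : ∀ a, (⌊f a⌋ : ℝ) ≤ f a + τ b * d a ∧ f a + τ b * d a ≤ ⌈f a⌉ := by
      intro a
      have hl := Int.floor_le (f a)
      have hu := Int.le_ceil (f a)
      have hp := hτ0 b hb
      by_cases ha : d a = 0
      · simp [ha, hl, hu]
      · have hle := hbmin a ha
        simp only [hτ] at hle hp ⊢
        by_cases hpos : 0 < d a
        · rw [if_pos hpos] at hle
          have := mul_le_mul_of_nonneg_right hle hpos.le
          rw [div_mul_cancel₀ _ ha] at this
          exact ⟨by linarith [mul_nonneg hp hpos.le], by linarith⟩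
        · have hneg : d a < 0 := lt_of_le_of_ne (not_lt.1 hpos) ha
          rw [if_neg hpos] at hle
          have := mul_le_mul_of_nonneg_right hle (neg_pos.2 hneg).le
          rw [div_mul_cancel₀ _ (neg_ne_zero.2 ha)] at this
          have h5 := mul_nonneg hp (neg_pos.2 hneg).le
          exact ⟨by linarith, by linarith⟩
    have hbint : ∃ z : ℤ, f b + τ b * d b = z := by
      simp only [hτ]
      split_ifs with h
      · exact ⟨⌈f b⌉, by rw [div_mul_cancel₀ _ hb]; ring⟩
      · refine ⟨⌊f b⌋, ?_⟩
        have := div_mul_cancel₀ (f b - ⌊f b⌋) (neg_ne_zero.2 hb)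
        linarith
    have hlt : (Finset.univ.filter fun a => ∀ z : ℤ, f a + τ b * d a ≠ z).card < n := by
      rw [← hn]
      refine Finset.card_lt_card ((Finset.ssubset_iff_of_subset ?_).2 ⟨b, ?_, ?_⟩)
      · intro a
        simp only [Finset.mem_filter, Finset.mem_univ, true_and]
        intro h
        by_cases ha : d a = 0
        · simpa [ha] using h
        · exact hdF a ha
      · simpa using hdF b hb
      · simpa using hbint
    obtain ⟨g, hg, hgb, hgc⟩ := ih _ hlt (fun a => f a + τ b * d a) hcirc rfl
    refine ⟨g, hg, fun a => ⟨le_trans ?_ (hgb a).1, le_trans (hgb a).2 ?_⟩, hgc.trans ?_⟩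
    · exact Int.le_floor.2 (hbound a).1
    · exact Int.ceil_le.2 (hbound a).2
    · have h3 : ∑ a, c a * (f a + τ b * d a) = ∑ a, c a * f a + τ b * ∑ a, c a * d a := by
        rw [Finset.mul_sum, ← Finset.sum_add_distrib]
        exact Finset.sum_congr rfl fun a _ => by ring
      rw [h3]
      linarith [mul_nonpos_of_nonneg_of_nonpos (hτ0 b hb) hcd]

end Circulation

section DepthFirst

variable {V : Type*} [DecidableEq V]

/-- `π` and `D` are the parent map and the descendant sets of a depth-first search tree of the
graph `H` on the vertex set `S` with root `r`, in which the search always proceeds to a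
neighbour of largest weight `x` within the component it enters. -/
structure IsDFSTree (H : SimpleGraph V) (x : V → V → ℝ) (S : Finset V) (r : V) (π : V → V)
    (D : V → Finset V) : Prop where
  root : D r = S
  self_mem : ∀ u ∈ S, u ∈ D u
  subset : ∀ u ∈ S, D u ⊆ S
  parent_mem : ∀ u ∈ S, u ≠ r → π u ∈ S
  adj_parent : ∀ u ∈ S, u ≠ r → H.Adj u (π u)
  parent_notMem : ∀ u ∈ S, u ≠ r → π u ∉ D u
  subset_parent : ∀ u ∈ S, u ≠ r → D u ⊆ D (π u)
  exists_child : ∀ a ∈ S, ∀ u ∈ D a, u ≠ a → ∃ w ∈ S, w ≠ r ∧ π w = a ∧ u ∈ D w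
  trans : ∀ w ∈ S, ∀ u ∈ D w, D u ⊆ D w
  disjoint : ∀ u ∈ S, ∀ w ∈ S, u ≠ r → w ≠ r → u ≠ w → π u = π w → Disjoint (D u) (D w)
  comparable : ∀ u ∈ S, ∀ w ∈ S, H.Adj u w → u ∈ D w ∨ w ∈ D u
  weight_le : ∀ w ∈ S, w ≠ r → ∀ u ∈ D w, H.Adj u (π w) → x u (π w) ≤ x w (π w)

lemma IsDFSTree.glue {H : SimpleGraph V} {x : V → V → ℝ} {S C : Finset V} {r w : V}
    {π₁ π₂ : V → V} {D₁ D₂ : V → Finset V} (hr : r ∈ S) (hC : C ⊆ S.erase r)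
    (hclosed : ∀ a ∈ C, ∀ b ∈ S, b ≠ r → H.Adj a b → b ∈ C) (hwC : w ∈ C) (hwr : H.Adj w r)
    (hmax : ∀ u ∈ C, H.Adj u r → x u r ≤ x w r)
    (h₁ : IsDFSTree H x C w π₁ D₁) (h₂ : IsDFSTree H x (S \ C) r π₂ D₂) :
    IsDFSTree H x S r (fun u => if u = w then r else if u ∈ C then π₁ u else π₂ u)
      (fun u => if u = r then S else if u ∈ C then D₁ u else D₂ u) := by
  have hrC : r ∉ C := fun h => by simpa using hC h
  have hCS : ∀ a ∈ C, a ∈ S := fun a h => Finset.mem_of_mem_erase (hC h)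
  have hne : ∀ a ∈ C, a ≠ r := fun a h => Finset.ne_of_mem_erase (hC h)
  have hsd : ∀ a, a ∈ S \ C ↔ a ∈ S ∧ a ∉ C := fun a => Finset.mem_sdiff
  have e1 := h₁.root
  have e2 := h₂.root
  constructor
  · simp
  · intro u hu
    have := h₁.self_mem u; have := h₂.self_mem u
    grind
  · intro u hu
    have := h₁.subset u; have := h₂.subset u
    grind
  · intro u hu
    have := h₁.parent_mem u; have := h₂.parent_mem u
    grind
  · intro u hu
    have := h₁.adj_parent u; have := h₂.adj_parent u
    grind
  · intro u hu
    have := h₁.parent_notMem u; have := h₂.parent_notMem u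
    grind
  · intro u hu
    have := h₁.subset_parent u; have := h₂.subset_parent u
    have := h₁.parent_mem u; have := h₂.parent_mem u
    have := h₁.subset u; have := h₂.subset u
    grind
  · intro a ha u hu hua
    have k1 := h₁.exists_child a
    have k2 := h₂.exists_child a
    by_cases haC : a ∈ C
    · have har := hne a haC
      simp only [har, haC, if_true, if_false] at hu
      obtain ⟨b, hb, hbw, hba, hub⟩ := k1 haC u hu hua
      exact ⟨b, hCS b hb, hne b hb, by simp [hbw, hb, hba], by simp [hne b hb, hb, hub]⟩
    · have haS : a ∈ S \ C := (hsd a).2 ⟨ha, haC⟩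
      by_cases huw : a = r ∧ u ∈ C
      · obtain ⟨rfl, huC⟩ := huw
        exact ⟨w, hCS w hwC, hne w hwC, by simp, by simp [hne w hwC, hwC, e1, huC]⟩
      · have hu2 : u ∈ D₂ a := by grind
        obtain ⟨b, hb, hbw, hba, hub⟩ := k2 haS u hu2 hua
        have hb' := (hsd b).1 hb
        have : b ≠ w := fun h => hb'.2 (h ▸ hwC)
        exact ⟨b, hb'.1, hbw, by simp [this, hb'.2, hba], by simp [hbw, hb'.2, hub]⟩
  · intro a ha u hu
    have hroot : a ∈ S \ C → a ≠ r → r ∉ D₂ a := fun h1 h2 h3 =>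
      h₂.parent_notMem a h1 h2 (h₂.trans a h1 r h3 (e2.symm ▸ h₂.parent_mem a h1 h2))
    have := h₁.trans a; have := h₂.trans a
    have := h₁.subset u; have := h₂.subset u
    have := h₁.subset a; have := h₂.subset a
    grind
  · intro a ha b hb har hbr hab hpi
    have k1 := h₁.disjoint a; have k2 := h₂.disjoint a
    have k3 := h₁.parent_mem a; have k4 := h₂.parent_mem a
    have k5 := h₁.parent_mem b; have k6 := h₂.parent_mem b
    simp only [har, hbr, if_false]
    by_cases haC : a ∈ C <;> by_cases hbC : b ∈ C
    · simp only [haC, hbC, if_true] at hpi ⊢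
      have : a ≠ w := by grind
      have : b ≠ w := by grind
      grind
    · simp only [haC, hbC, if_true, if_false] at hpi ⊢
      have s1 := h₁.subset a haC
      have s2 := h₂.subset b ((hsd b).2 ⟨hb, hbC⟩)
      exact Finset.disjoint_of_subset_left s1 (Finset.disjoint_of_subset_right s2 Finset.disjoint_sdiff)
    · simp only [haC, hbC, if_true, if_false] at hpi ⊢
      have s1 := h₁.subset b hbC
      have s2 := h₂.subset a ((hsd a).2 ⟨ha, haC⟩)
      exact (Finset.disjoint_of_subset_left s1 (Finset.disjoint_of_subset_right s2 Finset.disjoint_sdiff)).symm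
    · have : a ≠ w := by grind
      have : b ≠ w := by grind
      simp only [haC, hbC, if_false] at hpi ⊢
      grind
  · intro a ha b hb hab
    have k1 := h₁.comparable a; have k2 := h₂.comparable a
    have k3 := hclosed a; have k4 := hclosed b
    have := hab.symm
    grind
  · intro a ha har u hu hadj
    have k1 := h₁.weight_le a; have k2 := h₂.weight_le a
    by_cases haw : a = w
    · subst haw
      simp only [hwC, har, e1, if_true, if_false] at hu hadj ⊢
      exact hmax u hu hadj
    · grind

lemma exists_dfsTree_aux (H : SimpleGraph V) (x : V → V → ℝ) (S : Finset V) :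
    ∀ r ∈ S, (∀ u ∈ S, Relation.ReflTransGen (fun a b => H.Adj a b ∧ b ∈ S) r u) →
      ∃ π D, IsDFSTree H x S r π D := by
  induction S using Finset.strongInduction with
  | H S ih =>
  intro r hr hconn
  by_cases hS : S = {r}
  · subst hS
    refine ⟨id, fun _ => {r}, ?_⟩
    constructor <;> simp
  · obtain ⟨p, hpS, hpr⟩ : ∃ p ∈ S, p ≠ r := by
      by_contra! hcon
      exact hS (Finset.eq_singleton_iff_unique_mem.2 ⟨hr, hcon⟩)
    set R : V → V → Prop := fun a b => H.Adj a b ∧ a ∈ S.erase r ∧ b ∈ S.erase r with hR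
    set C : Finset V := (S.erase r).filter fun u => Relation.ReflTransGen R p u with hCdef
    have hCS : C ⊆ S.erase r := Finset.filter_subset _ _
    have hpC : p ∈ C := by simp [hCdef, hpS, hpr, Relation.ReflTransGen.refl]
    have hrC : r ∉ C := fun h => by simpa using hCS h
    have hclosed : ∀ a ∈ C, ∀ b ∈ S, b ≠ r → H.Adj a b → b ∈ C := by
      intro a ha b hb hbr hab
      have h1 := (Finset.mem_filter.1 ha)
      refine Finset.mem_filter.2 ⟨Finset.mem_erase.2 ⟨hbr, hb⟩, h1.2.tail ⟨hab, h1.1, ?_⟩⟩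
      exact Finset.mem_erase.2 ⟨hbr, hb⟩
    have hRsymm : Std.Symm R := ⟨fun a b h => ⟨h.1.symm, h.2.2, h.2.1⟩⟩
    have hnb : (C.filter fun u => H.Adj u r).Nonempty := by
      by_contra hcon
      have hno : ∀ u ∈ C, ¬ H.Adj u r := by
        intro u hu hadj
        exact hcon ⟨u, Finset.mem_filter.2 ⟨hu, hadj⟩⟩
      have : ∀ u, Relation.ReflTransGen (fun a b => H.Adj a b ∧ b ∈ S) r u → u ∈ S ∧ u ∉ C := by
        intro u hu
        induction hu with
        | refl => exact ⟨hr, hrC⟩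
        | tail _ hab ihh =>
          refine ⟨hab.2, fun hC => ?_⟩
          rename_i b c _
          by_cases hbr : b = r
          · exact hno c hC (hbr ▸ hab.1.symm)
          · exact ihh.2 (hclosed c hC b ihh.1 hbr hab.1.symm)
      exact (this p (hconn p hpS)).2 hpC
    obtain ⟨w, hw, hwmax⟩ := (C.filter fun u => H.Adj u r).exists_max_image (fun u => x u r) hnb
    obtain ⟨hwC, hwr⟩ := Finset.mem_filter.1 hw
    have hCss : C ⊂ S := (Finset.ssubset_iff_of_subset
      (hCS.trans (Finset.erase_subset _ _))).2 ⟨r, hr, hrC⟩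
    have hSCss : S \ C ⊂ S := (Finset.ssubset_iff_of_subset Finset.sdiff_subset).2
      ⟨p, hpS, by simp [hpC]⟩
    obtain ⟨π₁, D₁, h₁⟩ := ih C hCss w hwC (by
      intro u hu
      have hsym : Relation.ReflTransGen R w p :=
        Relation.ReflTransGen.stdSymm.symm _ _ (Finset.mem_filter.1 hwC).2
      have hwu := hsym.trans (Finset.mem_filter.1 hu).2
      have : ∀ v, Relation.ReflTransGen R w v →
          v ∈ C ∧ Relation.ReflTransGen (fun a b => H.Adj a b ∧ b ∈ C) w v := by
        intro v hv
        induction hv with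
        | refl => exact ⟨hwC, Relation.ReflTransGen.refl⟩
        | tail _ hab ihh =>
          have := hclosed _ ihh.1 _ (Finset.mem_of_mem_erase hab.2.2)
            (Finset.ne_of_mem_erase hab.2.2) hab.1
          exact ⟨this, ihh.2.tail ⟨hab.1, this⟩⟩
      exact (this u hwu).2)
    obtain ⟨π₂, D₂, h₂⟩ := ih (S \ C) hSCss r (by simp [hr, hrC]) (by
      intro u hu
      have : ∀ v, Relation.ReflTransGen (fun a b => H.Adj a b ∧ b ∈ S) r v →
          v ∈ S ∧ (v ∈ C ∨ Relation.ReflTransGen (fun a b => H.Adj a b ∧ b ∈ S \ C) r v) := by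
        intro v hv
        induction hv with
        | refl => exact ⟨hr, Or.inr Relation.ReflTransGen.refl⟩
        | tail _ hab ihh =>
          rename_i b c _
          refine ⟨hab.2, ?_⟩
          by_cases hcC : c ∈ C
          · exact Or.inl hcC
          by_cases hcr : c = r
          · exact Or.inr (hcr ▸ Relation.ReflTransGen.refl)
          rcases ihh.2 with hb | hb
          · exact Or.inl (hclosed b hb c hab.2 hcr hab.1)
          · exact Or.inr (hb.tail ⟨hab.1, Finset.mem_sdiff.2 ⟨hab.2, hcC⟩⟩)
      obtain ⟨huS, huC⟩ := Finset.mem_sdiff.1 hu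
      exact (this u (hconn u huS)).2.resolve_left huC)
    exact ⟨_, _, IsDFSTree.glue hr hCS hclosed hwC hwr
      (fun u hu hadj => hwmax u (Finset.mem_filter.2 ⟨hu, hadj⟩)) h₁ h₂⟩

/-- Every finite connected graph has a depth-first search tree that prefers heavy edges. -/
theorem exists_dfsTree [Fintype V] (H : SimpleGraph V) (x : V → V → ℝ) (r : V)
    (hconn : ∀ S : Set V, r ∈ S → (∀ a ∈ S, ∀ b, H.Adj a b → b ∈ S) → ∀ v, v ∈ S) :
    ∃ π D, IsDFSTree H x Finset.univ r π D := by
  refine exists_dfsTree_aux H x Finset.univ r (Finset.mem_univ r) fun u _ => ?_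
  refine hconn {u | Relation.ReflTransGen (fun a b => H.Adj a b ∧ b ∈ Finset.univ) r u}
    Relation.ReflTransGen.refl ?_ u
  intro a ha b hab
  exact Relation.ReflTransGen.tail ha ⟨hab, Finset.mem_univ b⟩

end DepthFirst

section Laminar

variable {V : Type*} [DecidableEq V]

/-- A family of finite sets any two members of which are nested or disjoint. -/
def IsLaminar (L : Finset (Finset V)) : Prop :=
  ∀ A ∈ L, ∀ B ∈ L, A ⊆ B ∨ B ⊆ A ∨ Disjoint A B

lemma IsLaminar.card_le {L : Finset (Finset V)} (U : Finset V) (hL : IsLaminar L)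
    (hne : ∀ A ∈ L, A.Nonempty) (hU : ∀ A ∈ L, A ⊆ U) : L.card ≤ 2 * U.card := by
  induction U using Finset.induction_on generalizing L with
  | empty =>
    have : L = ∅ := by
      rw [Finset.eq_empty_iff_forall_notMem]
      intro A hA
      obtain ⟨a, ha⟩ := hne A hA
      simpa using hU A hA ha
    simp [this]
  | insert u U hu ih =>
    set A := L.filter fun S => u ∉ S with hA
    set B := (L.filter fun S => u ∈ S).erase {u} with hB
    set B' := B.image fun S => S.erase u with hB'
    have hAmem : ∀ S, S ∈ A ↔ S ∈ L ∧ u ∉ S := by intro S; simp [hA]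
    have hB'mem : ∀ S, S ∈ B' → u ∉ S ∧ S.Nonempty ∧ insert u S ∈ L := by
      intro S hS
      obtain ⟨T, hT, rfl⟩ := Finset.mem_image.1 hS
      simp only [hB, Finset.mem_erase, Finset.mem_filter] at hT
      refine ⟨by simp, ?_, by rw [Finset.insert_erase hT.2.2]; exact hT.2.1⟩
      rw [Finset.nonempty_iff_ne_empty]
      intro h0
      rcases (Finset.erase_eq_empty_iff _ _).1 h0 with h | h
      · rw [h] at hT; simp at hT
      · exact hT.1 h
    have hcardB : B'.card = B.card := by
      refine Finset.card_image_of_injOn fun S hS T hT hST => ?_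
      simp only [hB, Finset.coe_erase, Finset.coe_filter, Set.mem_sdiff, Set.mem_ofPred_eq] at hS hT
      rw [← Finset.insert_erase hS.1.2, ← Finset.insert_erase hT.1.2]
      exact congrArg _ hST
    have hcardL : L.card ≤ A.card + (B.card + 1) := by
      have h1 : (L.filter fun S => u ∈ S).card + A.card = L.card :=
        Finset.card_filter_add_card_filter_not _
      have h2 : (L.filter fun S => u ∈ S).card ≤ B.card + 1 := by
        rw [hB]; have := Finset.pred_card_le_card_erase (s := L.filter fun S => u ∈ S) (a := {u}); omega
      omega
    have hinter : (A ∩ B').card ≤ 1 := by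
      rw [Finset.card_le_one]
      intro S hS T hT
      obtain ⟨hSA, hSB⟩ := Finset.mem_inter.1 hS
      obtain ⟨hTA, hTB⟩ := Finset.mem_inter.1 hT
      have key : ∀ S T, S ∈ A → S ∈ B' → T ∈ A → T ∈ B' → S ⊆ T → S = T := by
        intro S T hSA hSB hTA hTB hST
        obtain ⟨huT, _, _⟩ := hB'mem T hTB
        obtain ⟨_, ⟨p, hp⟩, hSL⟩ := hB'mem S hSB
        rcases hL _ hSL _ ((hAmem T).1 hTA).1 with h | h | h
        · exact absurd (h (Finset.mem_insert_self u S)) huT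
        · refine hST.antisymm fun q hq => ?_
          exact (Finset.mem_insert.1 (h hq)).resolve_left (fun e => huT (e ▸ hq))
        · exact absurd (hST hp) (Finset.disjoint_left.1 h (Finset.mem_insert_of_mem hp))
      rcases hL _ (hB'mem S hSB).2.2 _ (hB'mem T hTB).2.2 with h | h | h
      · refine key S T hSA hSB hTA hTB fun q hq => ?_
        exact (Finset.mem_insert.1 (h (Finset.mem_insert_of_mem hq))).resolve_left
          (fun e => (hB'mem S hSB).1 (e ▸ hq))
      · refine (key T S hTA hTB hSA hSB fun q hq => ?_).symm
        exact (Finset.mem_insert.1 (h (Finset.mem_insert_of_mem hq))).resolve_left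
          (fun e => (hB'mem T hTB).1 (e ▸ hq))
      · exact absurd (Finset.mem_insert_self u T)
          (Finset.disjoint_left.1 h (Finset.mem_insert_self u S))
    have hunion : (A ∪ B').card ≤ 2 * U.card := by
      have hrep : ∀ S ∈ A ∪ B', S.Nonempty ∧ ∃ T ∈ L, S = T.erase u := by
        intro S hS
        rcases Finset.mem_union.1 hS with h | h
        · have := (hAmem S).1 h
          exact ⟨hne S this.1, S, this.1, (Finset.erase_eq_of_notMem this.2).symm⟩
        · have := hB'mem S h
          exact ⟨this.2.1, _, this.2.2, (Finset.erase_insert this.1).symm⟩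
      refine ih ?_ (fun S hS => (hrep S hS).1) ?_
      · intro S hS T hT
        obtain ⟨_, S', hS', rfl⟩ := hrep S hS
        obtain ⟨_, T', hT', rfl⟩ := hrep T hT
        rcases hL _ hS' _ hT' with h | h | h
        · exact Or.inl (Finset.erase_subset_erase _ h)
        · exact Or.inr (Or.inl (Finset.erase_subset_erase _ h))
        · exact Or.inr (Or.inr (Finset.disjoint_of_subset_left (Finset.erase_subset _ _)
            (Finset.disjoint_of_subset_right (Finset.erase_subset _ _) h)))
      · intro S hS
        obtain ⟨_, S', hS', rfl⟩ := hrep S hS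
        rw [← Finset.erase_insert hu]
        exact Finset.erase_subset_erase _ (hU _ hS')
    have := Finset.card_union_add_card_inter A B'
    rw [Finset.card_insert_of_notMem hu]
    omega

end Laminar

section ExtremePoint

variable {V ι : Type*} [DecidableEq V] [Fintype V] [Fintype ι] [DecidableEq ι]

/-- The total value of `y` across the cut of `S`. -/
noncomputable def cutSum (h : ι → V × V) (y : ι → ℝ) (S : Finset V) : ℝ :=
  ∑ e with Crosses h S e, y e

/-- The feasible points of the cut relaxation supported on `P`. -/
def IsCutFeasible (h : ι → V × V) (P : Finset ι) (y : ι → ℝ) : Prop :=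
  (∀ e, 0 ≤ y e) ∧ (∀ e ∉ P, y e = 0) ∧
    ∀ S : Finset V, S.Nonempty → S ≠ Finset.univ → 2 ≤ cutSum h y S

lemma cutSum_add_smul (h : ι → V × V) (y d : ι → ℝ) (τ : ℝ) (S : Finset V) :
    cutSum h (fun e => y e + τ * d e) S = cutSum h y S + τ * cutSum h d S := by
  simp only [cutSum, Finset.mul_sum, Finset.sum_add_distrib]

lemma cutSum_uncross (h : ι → V × V) (y : ι → ℝ) (S L : Finset V) :
    cutSum h y (S ∩ L) + cutSum h y (S ∪ L) +
      2 * ∑ e with (Crosses h (S \ L) e ∧ Crosses h (L \ S) e), y e =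
      cutSum h y S + cutSum h y L := by
  simp only [cutSum, Finset.sum_filter, Finset.mul_sum, ← Finset.sum_add_distrib]
  refine Finset.sum_congr rfl fun e _ => ?_
  simp only [Crosses, Finset.mem_inter, Finset.mem_union, Finset.mem_sdiff]
  by_cases h1 : (h e).1 ∈ S <;> by_cases h2 : (h e).1 ∈ L <;> by_cases h3 : (h e).2 ∈ S <;>
    by_cases h4 : (h e).2 ∈ L <;> simp [h1, h2, h3, h4] <;> ring

lemma isClosed_cutFeasible (h : ι → V × V) (P : Finset ι) : IsClosed {y | IsCutFeasible h P y} := by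
  have hc : ∀ S, Continuous fun y : ι → ℝ => cutSum h y S := fun S =>
    continuous_finsetSum _ fun e _ => continuous_apply e
  simp only [IsCutFeasible, Set.ofPred_and, Set.ofPred_forall]
  refine IsClosed.inter (isClosed_iInter fun e => isClosed_le continuous_const (continuous_apply e))
    (IsClosed.inter (isClosed_iInter fun e => isClosed_iInter fun _ =>
      isClosed_eq (continuous_apply e) continuous_const)
    (isClosed_iInter fun S => isClosed_iInter fun _ => isClosed_iInter fun _ =>
      isClosed_le continuous_const (hc S)))

lemma isCompact_cutFeasible (h : ι → V × V) (P : Finset ι) (m : ℝ) :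
    IsCompact {y | IsCutFeasible h P y ∧ ∑ e, y e ≤ m} := by
  refine IsCompact.of_isClosed_subset (isCompact_univ_pi fun _ : ι => isCompact_Icc (a := (0 : ℝ)) (b := m))
    ((isClosed_cutFeasible h P).inter (isClosed_le
      (continuous_finsetSum _ fun e _ => continuous_apply e) continuous_const)) ?_
  rintro y ⟨hy, hm⟩ e -
  exact ⟨hy.1 e, (Finset.single_le_sum (fun e _ => hy.1 e) (Finset.mem_univ e)).trans hm⟩

/-- An optimal point of the cut relaxation no support direction of which annihilates all tight
cuts. -/
lemma exists_extreme_cutFeasible (h : ι → V × V) (P : Finset ι) (hex : ∃ y, IsCutFeasible h P y) :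
    ∃ y, IsCutFeasible h P y ∧ (∀ y', IsCutFeasible h P y' → ∑ e, y e ≤ ∑ e, y' e) ∧
      ∀ d : ι → ℝ, (∀ e, y e = 0 → d e = 0) →
        (∀ S : Finset V, S.Nonempty → S ≠ Finset.univ → cutSum h y S = 2 → cutSum h d S = 0) →
        d = 0 := by
  obtain ⟨y0, hy0⟩ := hex
  obtain ⟨y1, hy1, hmin⟩ := (isCompact_cutFeasible h P (∑ e, y0 e)).exists_isMinOn ⟨y0, hy0, le_rfl⟩
    (continuous_finsetSum Finset.univ fun e _ => continuous_apply e).continuousOn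
  have hopt : ∀ y', IsCutFeasible h P y' → ∑ e, y1 e ≤ ∑ e, y' e := by
    intro y' hy'
    by_cases hle : ∑ e, y' e ≤ ∑ e, y0 e
    · exact hmin ⟨hy', hle⟩
    · exact hy1.2.trans (not_le.1 hle).le
  obtain ⟨y, hyext⟩ := (isCompact_cutFeasible h P (∑ e, y1 e)).extremePoints_nonempty
    ⟨y1, hy1.1, le_rfl⟩
  rw [mem_extremePoints] at hyext
  obtain ⟨⟨hyF, hym⟩, hyext⟩ := hyext
  have hyopt : ∀ y', IsCutFeasible h P y' → ∑ e, y e ≤ ∑ e, y' e := fun y' hy' =>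
    hym.trans (hopt y' hy')
  refine ⟨y, hyF, hyopt, fun d hd hdt => ?_⟩
  have hsmall : ∃ τ : ℝ, 0 < τ ∧ ∀ σ : ℝ, |σ| ≤ τ → IsCutFeasible h P (fun e => y e + σ * d e) := by
    have hev : ∀ᶠ σ : ℝ in nhds 0, IsCutFeasible h P (fun e => y e + σ * d e) := by
      simp only [IsCutFeasible, Filter.eventually_and, Filter.eventually_all]
      refine ⟨fun e => ?_, fun e he => ?_, fun S hS hS' => ?_⟩
      · by_cases hye : y e = 0
        · simp [hye, hd e hye]
        · have hpos : 0 < y e + 0 * d e := by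
            simpa using lt_of_le_of_ne (hyF.1 e) (Ne.symm hye)
          have hcont : Continuous fun σ : ℝ => y e + σ * d e := by fun_prop
          exact (hcont.tendsto 0).eventually (lt_mem_nhds hpos) |>.mono fun _ h => h.le
      · have hye := hyF.2.1 e he
        simp [hye, hd e hye]
      · by_cases hyS : cutSum h y S = 2
        · refine Filter.Eventually.of_forall fun σ => ?_
          rw [cutSum_add_smul, hyS, hdt S hS hS' hyS]; simp
        · have hpos : 2 < cutSum h y S + 0 * cutSum h d S := by
            simpa using lt_of_le_of_ne (hyF.2.2 S hS hS') (Ne.symm hyS)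
          have hcont : Continuous fun σ : ℝ => cutSum h y S + σ * cutSum h d S := by fun_prop
          refine (hcont.tendsto 0).eventually (lt_mem_nhds hpos) |>.mono fun σ h => ?_
          rw [cutSum_add_smul]; exact h.le
    obtain ⟨ε, hε, hball⟩ := Metric.eventually_nhds_iff.1 hev
    refine ⟨ε / 2, by linarith, fun σ hσ => hball ?_⟩
    rw [Real.dist_eq, sub_zero]; linarith
  obtain ⟨τ, hτ, hfe⟩ := hsmall
  have hp := hfe τ (by rw [abs_of_pos hτ])
  have hm := hfe (-τ) (by rw [abs_neg, abs_of_pos hτ])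
  have hsum : ∀ σ : ℝ, ∑ e, (y e + σ * d e) = ∑ e, y e + σ * ∑ e, d e := fun σ => by
    rw [Finset.sum_add_distrib, Finset.mul_sum]
  have h1 := hyopt _ hp
  have h2 := hyopt _ hm
  rw [hsum] at h1 h2
  have hd0 : τ * ∑ e, d e = 0 := by linarith
  have h3 := hyext (fun e => y e + τ * d e) ⟨hp, by rw [hsum, hd0]; simpa using hym⟩
    (fun e => y e + -τ * d e) ⟨hm, by rw [hsum, neg_mul, hd0]; simpa using hym⟩
    ⟨1 / 2, 1 / 2, by norm_num, by norm_num, by norm_num, by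
      ext e; simp only [Pi.add_apply, Pi.smul_apply, smul_eq_mul]; ring⟩
  ext e
  have h4 := congrFun h3.1 e
  have : τ * d e = 0 := by linarith
  simpa [hτ.ne'] using this

/-- The cut relaxation has an optimal point with at most `2 (|V| - 1)` positive coordinates. -/
theorem exists_sparse_cutFeasible (h : ι → V × V) (P : Finset ι) (r : V)
    (hex : ∃ y, IsCutFeasible h P y) :
    ∃ y, IsCutFeasible h P y ∧ (∀ y', IsCutFeasible h P y' → ∑ e, y e ≤ ∑ e, y' e) ∧
      (Finset.univ.filter fun e => y e ≠ 0).card ≤ 2 * (Fintype.card V - 1) := by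
  obtain ⟨y, hyF, hyopt, hyd⟩ := exists_extreme_cutFeasible h P hex
  refine ⟨y, hyF, hyopt, ?_⟩
  set T : Finset (Finset V) := Finset.univ.filter fun S => S.Nonempty ∧ r ∉ S ∧ cutSum h y S = 2 with hT
  have hTmem : ∀ S, S ∈ T ↔ S.Nonempty ∧ r ∉ S ∧ cutSum h y S = 2 := by intro S; simp [hT]
  obtain ⟨L, hL, hLmax⟩ := (T.powerset.filter IsLaminar).exists_max_image Finset.card
    ⟨∅, by simp [IsLaminar]⟩
  simp only [Finset.mem_filter, Finset.mem_powerset] at hL hLmax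
  obtain ⟨hLT, hLlam⟩ := hL
  have hLcard : L.card ≤ 2 * (Fintype.card V - 1) := by
    have := hLlam.card_le (Finset.univ.erase r) (fun A hA => ((hTmem A).1 (hLT hA)).1)
      (fun A hA q hq => by
        simp only [Finset.mem_erase, Finset.mem_univ, and_true]
        exact fun e => ((hTmem A).1 (hLT hA)).2.1 (e ▸ hq))
    rwa [Finset.card_erase_of_mem (Finset.mem_univ r), Finset.card_univ] at this
  have hspan : ∀ d : ι → ℝ, (∀ e, y e = 0 → d e = 0) → (∀ A ∈ L, cutSum h d A = 0) →
      ∀ S ∈ T, cutSum h d S = 0 := by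
    intro d hd hdL
    by_contra! hcon
    set cr : Finset V → Finset (Finset V) := fun S =>
      L.filter fun A => ¬ (A ⊆ S ∨ S ⊆ A ∨ Disjoint A S) with hcr
    obtain ⟨S, hS, hSmin⟩ := (T.filter fun S => cutSum h d S ≠ 0).exists_min_image
      (fun S => (cr S).card) (by obtain ⟨S, h1, h2⟩ := hcon; exact ⟨S, by simp [h1, h2]⟩)
    simp only [Finset.mem_filter] at hS hSmin
    obtain ⟨hST, hSd⟩ := hS
    by_cases hcrS : cr S = ∅
    · have hSL : S ∉ L := fun hSL => hSd (hdL S hSL)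
      have hlam : IsLaminar (insert S L) := by
        have hno : ∀ A ∈ L, A ⊆ S ∨ S ⊆ A ∨ Disjoint A S := by
          intro A hA
          by_contra hc
          have : A ∈ cr S := Finset.mem_filter.2 ⟨hA, hc⟩
          simp [hcrS] at this
        intro A hA B hB
        rcases Finset.mem_insert.1 hA with rfl | hA' <;> rcases Finset.mem_insert.1 hB with rfl | hB'
        · exact Or.inl subset_rfl
        · rcases hno B hB' with h | h | h
          exacts [Or.inr (Or.inl h), Or.inl h, Or.inr (Or.inr h.symm)]
        · exact hno A hA'
        · exact hLlam A hA' B hB'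
      have := hLmax (insert S L) ⟨Finset.insert_subset hST hLT, hlam⟩
      rw [Finset.card_insert_of_notMem hSL] at this
      omega
    · obtain ⟨A, hA⟩ := Finset.nonempty_iff_ne_empty.2 hcrS
      have hA' := hA
      simp only [hcr, Finset.mem_filter, not_or] at hA
      obtain ⟨hAL, hAS, hSA, hdis⟩ := hA
      obtain ⟨hAne, hrA, hyA⟩ := (hTmem A).1 (hLT hAL)
      obtain ⟨hSne, hrS, hyS⟩ := (hTmem S).1 hST
      have hine : (S ∩ A).Nonempty := by
        rw [Finset.not_disjoint_iff] at hdis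
        obtain ⟨q, h1, h2⟩ := hdis
        exact ⟨q, by simp [h1, h2]⟩
      have hri : r ∉ S ∩ A := by simp [hrS]
      have hru : r ∉ S ∪ A := by simp [hrS, hrA]
      have hnu : ∀ X : Finset V, r ∉ X → X ≠ Finset.univ := fun X hX e => hX (e ▸ Finset.mem_univ r)
      have k1 := hyF.2.2 (S ∩ A) hine (hnu _ hri)
      have k2 := hyF.2.2 (S ∪ A) (hSne.mono Finset.subset_union_left) (hnu _ hru)
      have k3 := cutSum_uncross h y S A
      have k4 : 0 ≤ ∑ e with (Crosses h (S \ A) e ∧ Crosses h (A \ S) e), y e :=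
        Finset.sum_nonneg fun e _ => hyF.1 e
      have k5 : ∑ e with (Crosses h (S \ A) e ∧ Crosses h (A \ S) e), y e = 0 := by linarith
      have k6 : ∑ e with (Crosses h (S \ A) e ∧ Crosses h (A \ S) e), d e = 0 :=
        Finset.sum_eq_zero fun e he =>
          hd e ((Finset.sum_eq_zero_iff_of_nonneg fun e _ => hyF.1 e).1 k5 e he)
      have k7 := cutSum_uncross h d S A
      have hTi : S ∩ A ∈ T := (hTmem _).2 ⟨hine, hri, by linarith⟩
      have hTu : S ∪ A ∈ T := (hTmem _).2 ⟨hSne.mono Finset.subset_union_left, hru, by linarith⟩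
      have hless : ∀ X : Finset V, A ∉ cr X → (∀ B ∈ L, ¬ (B ⊆ X ∨ X ⊆ B ∨ Disjoint B X) →
          ¬ (B ⊆ S ∨ S ⊆ B ∨ Disjoint B S)) → (cr X).card < (cr S).card := by
        intro X hAX hX
        refine Finset.card_lt_card ((Finset.ssubset_iff_of_subset fun B hB => ?_).2 ⟨A, hA', hAX⟩)
        obtain ⟨h1, h2⟩ := Finset.mem_filter.1 hB
        exact Finset.mem_filter.2 ⟨h1, hX B h1 h2⟩
      have l1 : (cr (S ∩ A)).card < (cr S).card := by
        refine hless _ (by simp [hcr]) fun B hB hX => ?_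
        have hlam := hLlam A hAL B hB
        simp only [Finset.disjoint_left, Finset.subset_iff, Finset.mem_inter] at *
        grind
      have l2 : (cr (S ∪ A)).card < (cr S).card := by
        refine hless _ (by simp [hcr]) fun B hB hX => ?_
        have hlam := hLlam A hAL B hB
        simp only [Finset.disjoint_left, Finset.subset_iff, Finset.mem_union] at *
        grind
      have hor : cutSum h d (S ∩ A) ≠ 0 ∨ cutSum h d (S ∪ A) ≠ 0 := by
        by_contra! hz
        rw [hz.1, hz.2, k6, hdL A hAL] at k7
        exact hSd (by linarith)
      rcases hor with ho | ho
      · have := hSmin _ ⟨hTi, ho⟩; omega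
      · have := hSmin _ ⟨hTu, ho⟩; omega
  refine le_trans ?_ hLcard
  set Z := Finset.univ.filter fun e => y e ≠ 0 with hZ
  let Φ : (Z → ℝ) →ₗ[ℝ] (L → ℝ) :=
    { toFun := fun d A => ∑ e : Z, if Crosses h A.1 e then d e else 0
      map_add' := fun d e => by
        ext A; simp only [Pi.add_apply, ← Finset.sum_add_distrib]
        refine Finset.sum_congr rfl fun _ _ => ?_
        split_ifs <;> simp
      map_smul' := fun c d => by
        ext A; simp only [Pi.smul_apply, smul_eq_mul, Finset.mul_sum, RingHom.id_apply]
        refine Finset.sum_congr rfl fun _ _ => ?_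
        split_ifs <;> simp }
  have hinj : Function.Injective Φ := by
    rw [injective_iff_map_eq_zero]
    intro d hd
    set D : ι → ℝ := fun e => if he : e ∈ Z then d ⟨e, he⟩ else 0 with hD
    have hDcut : ∀ A ∈ L, cutSum h D A = 0 := by
      intro A hA
      refine Eq.trans ?_ (congrFun hd ⟨A, hA⟩)
      change _ = ∑ e : Z, if Crosses h A e then d e else 0
      rw [cutSum, Finset.sum_filter, ← Finset.sum_subset (Finset.subset_univ Z)
        (by intro e _ he; simp [hD, he]), ← Finset.sum_coe_sort]
      refine Finset.sum_congr rfl fun e _ => ?_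
      simp [hD]
    have hDy : ∀ e, y e = 0 → D e = 0 := by
      intro e he; simp [hD, hZ, he]
    have hD0 := hyd D hDy fun S hS hS' hyS => by
      by_cases hrS : r ∈ S
      · have hcompl : ∀ y : ι → ℝ, cutSum h y Sᶜ = cutSum h y S := by
          intro y
          unfold cutSum
          refine Finset.sum_congr (Finset.filter_congr fun e _ => ?_) fun _ _ => rfl
          simp only [Crosses, Finset.mem_compl, not_iff_not]
        rw [← hcompl]
        refine hspan D hDy hDcut _ ((hTmem _).2 ⟨?_, by simpa using hrS, by rw [hcompl, hyS]⟩)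
        rw [Finset.nonempty_iff_ne_empty]
        intro h0; exact hS' (Finset.compl_eq_empty_iff S |>.1 h0)
      · exact hspan D hDy hDcut _ ((hTmem _).2 ⟨hS, hrS, hyS⟩)
    ext e
    have := congrFun hD0 e
    simpa [hD] using this
  have := LinearMap.finrank_le_finrank_of_injective hinj
  simpa only [Module.finrank_fintype_fun_eq_card, Fintype.card_coe] using this

end ExtremePoint

section Transfer

variable {V : Type*}

/-- A choice of ordered endpoints for an unordered pair. -/
noncomputable def symEnds (e : Sym2 V) : V × V := Quot.out e

lemma mk_symEnds (e : Sym2 V) : s((symEnds e).1, (symEnds e).2) = e := Quot.out_eq e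

lemma crosses_symEnds (S : Finset V) (a b : V) :
    Crosses symEnds S s(a, b) ↔ ¬(a ∈ S ↔ b ∈ S) := by
  have h := mk_symEnds s(a, b)
  rw [Sym2.eq_iff] at h
  unfold Crosses
  rcases h with ⟨h1, h2⟩ | ⟨h1, h2⟩ <;> rw [h1, h2]
  tauto

variable [Fintype V]

lemma sum_crossing_eq_cutSum (Y : Sym2 V → ℝ) (S : Finset V) :
    ∑ a ∈ S, ∑ b ∈ Sᶜ, Y s(a, b) = cutSum symEnds Y S := by
  rw [← Finset.sum_product', cutSum]
  refine Finset.sum_bij (fun p _ => s(p.1, p.2)) ?_ ?_ ?_ (fun _ _ => rfl)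
  · rintro ⟨a, b⟩ hp
    simp only [Finset.mem_product, Finset.mem_compl] at hp
    simp [crosses_symEnds, hp]
  · rintro ⟨a, b⟩ hp ⟨c, d⟩ hq h
    simp only [Finset.mem_product, Finset.mem_compl] at hp hq
    simp only [Sym2.eq_iff] at h
    rcases h with ⟨h1, h2⟩ | ⟨h1, h2⟩
    · simp [h1, h2]
    · subst h1; exact absurd hp.1 hq.2
  · intro e he
    induction e using Sym2.ind with
    | _ a b =>
      simp only [Finset.mem_filter, crosses_symEnds] at he
      by_cases ha : a ∈ S
      · exact ⟨(a, b), by simp only [Finset.mem_product, Finset.mem_compl]; tauto, rfl⟩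
      · exact ⟨(b, a), by simp only [Finset.mem_product, Finset.mem_compl]; tauto, Sym2.eq_swap⟩

lemma sum_sum_sym2 (Y : Sym2 V → ℝ) (hY : ∀ a, Y s(a, a) = 0) :
    ∑ a, ∑ b, Y s(a, b) = 2 * ∑ e, Y e := by
  have h1 : ∀ a, ∑ b, Y s(a, b) = cutSum symEnds Y {a} := by
    intro a
    rw [← sum_crossing_eq_cutSum, Finset.sum_singleton,
      ← Finset.sum_compl_add_sum {a}, Finset.sum_singleton, hY, add_zero]
  simp only [h1, cutSum, Finset.sum_filter]
  rw [Finset.sum_comm, Finset.mul_sum]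
  refine Finset.sum_congr rfl fun e _ => ?_
  induction e using Sym2.ind with
  | _ a b =>
    simp only [crosses_symEnds, Finset.mem_singleton]
    by_cases hab : a = b
    · subst hab; simp [hY]
    · have : ∀ v, (if ¬(a = v ↔ b = v) then Y s(a, b) else 0) =
          (if a = v then Y s(a, b) else 0) + (if b = v then Y s(a, b) else 0) := by
        intro v
        by_cases h1 : a = v <;> by_cases h2 : b = v <;> simp [h1, h2]
        exact absurd (h1.trans h2.symm) hab
      simp only [this, Finset.sum_add_distrib, Finset.sum_ite_eq, Finset.mem_univ, if_true]
      ring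

lemma card_filter_sym2_le (p : Sym2 V → Prop) [DecidablePred p]
    [DecidablePred fun q : V × V => p s(q.1, q.2)] :
    (Finset.univ.filter fun q : V × V => p s(q.1, q.2)).card ≤
      2 * (Finset.univ.filter p).card := by
  refine (Finset.card_le_mul_card_image (f := fun q : V × V => s(q.1, q.2)) _ 2 ?_).trans
    (Nat.mul_le_mul_left 2 (Finset.card_le_card ?_))
  · intro e _
    induction e using Sym2.ind with
    | _ a b =>
      refine (Finset.card_le_card (t := {(a, b), (b, a)}) ?_).trans Finset.card_le_two
      rintro ⟨c, d⟩ hq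
      simp only [Finset.mem_filter, Sym2.eq_iff] at hq
      simp only [Finset.mem_insert, Finset.mem_singleton, Prod.mk.injEq]
      exact hq.2
  · intro e he
    obtain ⟨q, hq, rfl⟩ := Finset.mem_image.1 he
    simpa using hq

/-- Moving the value of the separated pair `st` onto an edge `ab` across the same cut. -/
lemma two_le_cutSum_reroute (Y : Sym2 V → ℝ) (z : ℝ) (s t a b : V) (S : Finset V)
    (hY0 : ∀ e, 0 ≤ Y e) (hz : 2 ≤ z) (hSY : ∀ e, Crosses symEnds S e → Y e = 0)
    (hsep : ¬(s ∈ S ↔ t ∈ S)) (ha : a ∈ S) (hb : b ∉ S)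
    (hF : ∀ Q : Finset V, Q.Nonempty → Q ≠ Finset.univ →
      2 ≤ cutSum symEnds Y Q + if (s ∈ Q ↔ t ∈ Q) then 0 else z)
    (Q : Finset V) (hQ : Q.Nonempty) (hQ' : Q ≠ Finset.univ) :
    2 ≤ cutSum symEnds (fun e => Y e + if e = s(a, b) then z else 0) Q := by
  obtain ⟨Y', hY', hY'f⟩ : ∃ Y' : Sym2 V → ℝ, (∀ e, Y' e = Y e + if e = s(a, b) then z else 0) ∧
      Y' = fun e => Y e + if e = s(a, b) then z else 0 := ⟨_, fun _ => rfl, rfl⟩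
  rw [← hY'f]
  have hY'0 : ∀ e, Y e ≤ Y' e := fun e => by
    simp only [hY']; split_ifs <;> linarith
  by_cases habQ : ¬(a ∈ Q ↔ b ∈ Q)
  · have he : s(a, b) ∈ Finset.univ.filter (Crosses symEnds Q) := by
      simpa [crosses_symEnds] using habQ
    refine le_trans ?_ (Finset.single_le_sum (fun e _ => (hY0 e).trans (hY'0 e)) he)
    have := hY0 s(a, b)
    simp only [hY', if_true]; linarith
  rw [not_not] at habQ
  refine le_trans ?_ (Finset.sum_le_sum fun e _ => hY'0 e)
  by_cases hQs : s ∈ Q ↔ t ∈ Q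
  · have := hF Q hQ hQ'
    rwa [if_pos hQs, add_zero] at this
  obtain ⟨p, hp, hpQ⟩ : ∃ p, (p = s ∨ p = t) ∧ ¬(p ∈ Q ↔ a ∈ Q) := by
    by_cases h : s ∈ Q ↔ a ∈ Q
    · exact ⟨t, Or.inr rfl, by tauto⟩
    · exact ⟨s, Or.inl rfl, h⟩
  set R : Finset V := Finset.univ.filter fun v => (v ∈ S ↔ p ∈ S) ∧ (v ∈ Q ↔ a ∈ Q) with hR
  have hRm : ∀ v, v ∈ R ↔ (v ∈ S ↔ p ∈ S) ∧ (v ∈ Q ↔ a ∈ Q) := by intro v; simp [hR]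
  have hRne : R.Nonempty := by
    by_cases h : p ∈ S
    · exact ⟨a, (hRm a).2 ⟨by tauto, Iff.rfl⟩⟩
    · exact ⟨b, (hRm b).2 ⟨by tauto, habQ.symm⟩⟩
  have hpR : p ∉ R := fun h => hpQ ((hRm p).1 h).2
  have hsR : s ∉ R ∧ t ∉ R := by
    simp only [hRm]
    rcases hp with rfl | rfl <;> tauto
  have h2 := hF R hRne (fun h => hpR (h ▸ Finset.mem_univ p))
  rw [if_pos (iff_of_false hsR.1 hsR.2), add_zero] at h2
  refine h2.trans ?_
  unfold cutSum
  simp only [Finset.sum_filter]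
  refine Finset.sum_le_sum fun e _ => ?_
  by_cases hye : Y e = 0
  · simp [hye]
  have hnS : ¬ Crosses symEnds S e := fun h => hye (hSY e h)
  by_cases hRe : Crosses symEnds R e
  · have hQe : Crosses symEnds Q e := by
      simp only [Crosses, hRm, not_not] at hRe hnS ⊢
      exact fun hq => hRe (by rw [hnS, hq])
    simp [hRe, hQe]
  · rw [if_neg hRe]; split_ifs; exacts [hY0 e, le_rfl]

/-- An LP point in which the edge `st` outside of `G`, of value `z`, is kept only as long as the
support in `G` is connected. -/
lemma exists_sparse_sym2 (G : SimpleGraph V) (s t : V)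
    (hconn : ∀ S : Finset V, S.Nonempty → S ≠ Finset.univ → ∃ a b, G.Adj a b ∧ a ∈ S ∧ b ∉ S)
    (P : Finset (Sym2 V)) (hGP : ∀ e ∈ G.edgeSet, e ∈ P)
    (hP : ∀ e ∈ P, e ∈ G.edgeSet ∨ (e = s(s, t) ∧ s ≠ t)) :
    ∃ (Y : Sym2 V → ℝ) (z : ℝ), (∀ e, 0 ≤ Y e) ∧ 0 ≤ z ∧ (∀ e, Y e ≠ 0 → e ∈ G.edgeSet) ∧
      (∀ S : Finset V, S.Nonempty → S ≠ Finset.univ → ∃ e, Crosses symEnds S e ∧ Y e ≠ 0) ∧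
      (∀ S : Finset V, S.Nonempty → S ≠ Finset.univ →
        2 ≤ cutSum symEnds Y S + if (s ∈ S ↔ t ∈ S) then 0 else z) ∧
      (Finset.univ.filter fun e => Y e ≠ 0).card ≤ 2 * (Fintype.card V - 1) ∧
      ∀ y', IsCutFeasible symEnds P y' → ∑ e, Y e + z ≤ ∑ e, y' e := by
  have hex : ∃ y, IsCutFeasible symEnds P y := by
    refine ⟨fun e => if e ∈ P then 2 else 0, fun e => by dsimp only; split_ifs <;> norm_num,
      fun e he => by simp [he], fun S hS hS' => ?_⟩
    obtain ⟨a, b, hab, ha, hb⟩ := hconn S hS hS'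
    have he : s(a, b) ∈ Finset.univ.filter (Crosses symEnds S) := by
      simp [crosses_symEnds, ha, hb]
    refine le_trans ?_ (Finset.single_le_sum (fun e _ => ?_) he)
    · simp [hGP _ ((SimpleGraph.mem_edgeSet G).2 hab)]
    · split_ifs <;> norm_num
  obtain ⟨y, hyF, hyopt, hycard⟩ := exists_sparse_cutFeasible symEnds P s hex
  have hposcut : ∀ (Y : Sym2 V → ℝ) (S : Finset V), (∀ e, Crosses symEnds S e → Y e = 0) →
      cutSum symEnds Y S = 0 := fun Y S h =>
    Finset.sum_eq_zero fun e he => h e (Finset.mem_filter.1 he).2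
  by_cases hst : ∀ e ∈ P, e ∈ G.edgeSet
  · refine ⟨y, 0, hyF.1, le_rfl, fun e he => hst e (by by_contra h; exact he (hyF.2.1 e h)),
      fun S hS hS' => ?_, fun S hS hS' => ?_, hycard, fun y' hy' => by simpa using hyopt y' hy'⟩
    · by_contra! h
      have := hyF.2.2 S hS hS'
      rw [hposcut y S h] at this
      norm_num at this
    · simpa using hyF.2.2 S hS hS'
  push Not at hst
  obtain ⟨e0, he0P, he0G⟩ := hst
  obtain ⟨rfl, hne⟩ := (hP e0 he0P).resolve_left he0G
  obtain ⟨Y, hY⟩ : ∃ Y : Sym2 V → ℝ, ∀ e, Y e = if e = s(s, t) then 0 else y e := ⟨_, fun _ => rfl⟩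
  obtain ⟨z, hz⟩ : ∃ z, z = y s(s, t) := ⟨_, rfl⟩
  have hz0 : 0 ≤ z := hz ▸ hyF.1 _
  have hY0 : ∀ e, 0 ≤ Y e := fun e => by simp only [hY]; split_ifs; exacts [le_rfl, hyF.1 e]
  have hYG : ∀ e, Y e ≠ 0 → e ∈ G.edgeSet := by
    intro e he
    simp only [hY] at he
    split_ifs at he with h
    · exact absurd rfl he
    · have : e ∈ P := by by_contra h; exact he (hyF.2.1 e h)
      exact (hP e this).resolve_right fun h' => h h'.1
  have hyY : ∀ e, y e = Y e + if e = s(s, t) then z else 0 := by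
    intro e; simp only [hY]; split_ifs with h
    · simp [hz, h]
    · simp
  have hsum : ∑ e, Y e + z = ∑ e, y e := by
    rw [Finset.sum_congr rfl fun e _ => hyY e, Finset.sum_add_distrib, Finset.sum_ite_eq',
      if_pos (Finset.mem_univ _)]
  have hcut : ∀ S : Finset V, cutSum symEnds y S =
      cutSum symEnds Y S + if (s ∈ S ↔ t ∈ S) then 0 else z := by
    intro S
    unfold cutSum
    simp only [hyY, Finset.sum_add_distrib, Finset.sum_ite_eq', Finset.mem_filter,
      Finset.mem_univ, true_and, crosses_symEnds]
    by_cases h : s ∈ S ↔ t ∈ S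
    · rw [if_neg (not_not.2 h), if_pos h]
    · rw [if_pos h, if_neg h]
  by_cases hc : ∀ S : Finset V, S.Nonempty → S ≠ Finset.univ → ∃ e, Crosses symEnds S e ∧ Y e ≠ 0
  · refine ⟨Y, z, hY0, hz0, hYG, hc, fun S hS hS' => (hcut S) ▸ hyF.2.2 S hS hS', ?_,
      fun y' hy' => hsum ▸ hyopt y' hy'⟩
    refine (Finset.card_le_card fun e he => ?_).trans hycard
    simp only [Finset.mem_filter, Finset.mem_univ, true_and, hY] at he ⊢
    split_ifs at he
    · exact absurd rfl he
    · exact he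
  push Not at hc
  obtain ⟨S, hS, hS', hSY⟩ := hc
  have hcS := hyF.2.2 S hS hS'
  rw [hcut, hposcut Y S hSY, zero_add] at hcS
  have hsep : ¬(s ∈ S ↔ t ∈ S) := by
    intro h; rw [if_pos h] at hcS; norm_num at hcS
  rw [if_neg hsep] at hcS
  obtain ⟨a, b, hab, ha, hb⟩ := hconn S hS hS'
  obtain ⟨Y', hY', hY'f⟩ : ∃ Y' : Sym2 V → ℝ, (∀ e, Y' e = Y e + if e = s(a, b) then z else 0) ∧
      Y' = fun e => Y e + if e = s(a, b) then z else 0 := ⟨_, fun _ => rfl, rfl⟩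
  have hY'0 : ∀ e, Y e ≤ Y' e := fun e => by
    simp only [hY']; split_ifs <;> linarith
  have hcross : ∀ Q : Finset V, Q.Nonempty → Q ≠ Finset.univ → 2 ≤ cutSum symEnds Y' Q :=
    hY'f ▸ two_le_cutSum_reroute Y z s t a b S hY0 hcS hSY hsep ha hb fun Q hQ hQ' =>
      (hcut Q) ▸ hyF.2.2 Q hQ hQ'
  refine ⟨Y', 0, fun e => (hY0 e).trans (hY'0 e), le_rfl, fun e he => ?_, fun Q hQ hQ' => ?_,
    fun Q hQ hQ' => by simpa using hcross Q hQ hQ', ?_, fun y' hy' => ?_⟩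
  · by_cases h : e = s(a, b)
    · rw [h]; exact (SimpleGraph.mem_edgeSet G).2 hab
    · exact hYG e (by simpa [hY', h] using he)
  · by_contra! h
    have := hcross Q hQ hQ'
    rw [hposcut Y' Q h] at this
    norm_num at this
  · refine le_trans ?_ hycard
    have hmem : s(s, t) ∈ Finset.univ.filter fun e => y e ≠ 0 := by
      simp only [Finset.mem_filter, Finset.mem_univ, true_and]
      rw [← hz]
      linarith
    rw [← Finset.card_erase_add_one hmem]
    refine le_trans (Finset.card_le_card (t := insert s(a, b)
      ((Finset.univ.filter fun e => y e ≠ 0).erase s(s, t))) fun e he => ?_)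
      (Finset.card_insert_le _ _)
    simp only [Finset.mem_filter, Finset.mem_univ, true_and, hY', hY] at he
    simp only [Finset.mem_insert, Finset.mem_erase, Finset.mem_filter, Finset.mem_univ, true_and]
    by_cases h1 : e = s(a, b)
    · exact Or.inl h1
    · by_cases h2 : e = s(s, t)
      · rw [if_pos h2, if_neg h1, add_zero] at he; exact absurd rfl he
      · rw [if_neg h2, if_neg h1, add_zero] at he; exact Or.inr ⟨h2, he⟩
  · have : ∑ e, Y' e = ∑ e, Y e + z := by
      rw [Finset.sum_congr rfl fun e _ => hY' e, Finset.sum_add_distrib, Finset.sum_ite_eq',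
        if_pos (Finset.mem_univ _)]
    rw [this, add_zero, hsum]
    exact hyopt y' hy'

end Transfer

section LPPoint

variable {V : Type*} [Fintype V]

/-- A symmetric edge weighting `x` with connected support which, together with an additional edge
`st` of weight `z`, has value at least `2` on every cut. -/
structure IsLPPoint (s t : V) (x : V → V → ℝ) (z : ℝ) : Prop where
  symm : ∀ a b, x a b = x b a
  nonneg : ∀ a b, 0 ≤ x a b
  diag : ∀ a, x a a = 0
  z_nonneg : 0 ≤ z
  connected : ∀ S : Set V, s ∈ S → (∀ a ∈ S, ∀ b, x a b ≠ 0 → b ∈ S) → ∀ v, v ∈ S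
  cut : ∀ S : Finset V, S.Nonempty → S ≠ Finset.univ →
    2 ≤ ∑ a ∈ S, ∑ b ∈ Sᶜ, x a b + if (s ∈ S ↔ t ∈ S) then 0 else z

lemma IsTwoVertexConnected.exists_adj_cut {G : SimpleGraph V} (h : IsTwoVertexConnected G)
    (S : Finset V) (hS : S.Nonempty) (hS' : S ≠ Finset.univ) :
    ∃ a b, G.Adj a b ∧ a ∈ S ∧ b ∉ S := by
  obtain ⟨p, hp⟩ := hS
  obtain ⟨q, hq⟩ : ∃ q, q ∉ S := by
    by_contra! hc; exact hS' (Finset.eq_univ_iff_forall.2 hc)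
  obtain ⟨v, hv⟩ : ∃ v, v ∉ ({p, q} : Finset V) := by
    by_contra! hc
    have h1 := Finset.eq_univ_iff_forall.2 hc
    have h2 := Finset.card_le_two (a := p) (b := q)
    rw [h1, Finset.card_univ] at h2
    have := h.1
    omega
  simp only [Finset.mem_insert, Finset.mem_singleton, not_or] at hv
  obtain ⟨w⟩ := (h.2 v).preconnected ⟨p, fun e => hv.1 e.symm⟩ ⟨q, fun e => hv.2 e.symm⟩
  obtain ⟨d, -, hd1, hd2⟩ := w.exists_boundary_dart {a | a.1 ∈ S} hp hq
  exact ⟨d.fst.1, d.snd.1, d.adj, hd1, hd2⟩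

lemma lpValue_eq_sum (G : SimpleGraph V) (x : Sym2 V → ℝ) :
    lpValue G x = ∑ e, if e ∈ G.edgeSet then x e else 0 := by
  rw [lpValue, Finset.sum_filter]

lemma cutValue_eq_cutSum (G : SimpleGraph V) (x : Sym2 V → ℝ) (S : Finset V) :
    cutValue G x (S : Set V) = cutSum symEnds (fun e => if e ∈ G.edgeSet then x e else 0) S := by
  rw [cutValue, cutSum, Finset.sum_filter, Finset.sum_filter]
  refine Finset.sum_congr rfl fun e _ => ?_
  have : (∃ a b, e = s(a, b) ∧ a ∈ (S : Set V) ∧ b ∉ (S : Set V)) ↔ Crosses symEnds S e := by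
    constructor
    · rintro ⟨a, b, rfl, ha, hb⟩
      rw [crosses_symEnds]
      simp only [Finset.mem_coe] at ha hb
      tauto
    · intro h
      rw [Crosses] at h
      by_cases h1 : (symEnds e).1 ∈ S
      · exact ⟨_, _, (mk_symEnds e).symm, h1, fun h2 => h (iff_of_true h1 h2)⟩
      · refine ⟨_, _, (mk_symEnds e).symm.trans Sym2.eq_swap, ?_, h1⟩
        by_contra h2
        exact h (iff_of_false h1 h2)
  simp only [this]
  split_ifs <;> tauto

lemma le_cutValue_const (G : SimpleGraph V) {c : ℝ} (hc : 0 ≤ c) {S : Set V} {a b : V}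
    (hab : s(a, b) ∈ G.edgeSet) (ha : a ∈ S) (hb : b ∉ S) : c ≤ cutValue G (fun _ => c) S :=
  Finset.single_le_sum (f := fun _ : Sym2 V => c) (a := s(a, b)) (fun _ _ => hc)
    (Finset.mem_filter.2 ⟨Finset.mem_univ _, hab, a, b, rfl, ha, hb⟩)

theorem IsTwoVertexConnected.exists_lpPoint {G : SimpleGraph V} (h2c : IsTwoVertexConnected G)
    (s t : V) :
    ∃ (x : V → V → ℝ) (z : ℝ), IsLPPoint s t x z ∧ (∀ a b, x a b ≠ 0 → G.Adj a b) ∧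
      (Finset.univ.filter fun p : V × V => x p.1 p.2 ≠ 0).card + 4 ≤ 4 * Fintype.card V ∧
      ∑ a, ∑ b, x a b + 2 * z ≤
        2 * optLP (SimpleGraph.fromEdgeSet (insert s(s, t) G.edgeSet)) := by
  set G' := SimpleGraph.fromEdgeSet (insert s(s, t) G.edgeSet) with hG'
  set P : Finset (Sym2 V) := Finset.univ.filter fun e => e ∈ G'.edgeSet with hP
  have hPG : ∀ e, e ∈ P ↔ e ∈ G'.edgeSet := by intro e; simp [hP]
  have hmem : ∀ e ∈ G.edgeSet, e ∈ G'.edgeSet := by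
    intro e he
    rw [hG', SimpleGraph.edgeSet_fromEdgeSet]
    exact ⟨Set.mem_insert_of_mem _ he, G.not_isDiag_of_mem_edgeSet he⟩
  have hmem' : ∀ e ∈ G'.edgeSet, e ∈ G.edgeSet ∨ (e = s(s, t) ∧ s ≠ t) := by
    intro e he
    rw [hG', SimpleGraph.edgeSet_fromEdgeSet] at he
    rcases Set.mem_insert_iff.1 he.1 with h | h
    · refine Or.inr ⟨h, fun hst => he.2 ?_⟩
      rw [h, hst]; exact Sym2.mk_isDiag_iff.2 rfl
    · exact Or.inl h
  obtain ⟨Y, z, hY0, hz0, hYG, hYc, hYcut, hYcard, hYopt⟩ := exists_sparse_sym2 G s t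
    h2c.exists_adj_cut P (fun e he => (hPG e).2 (hmem e he)) (fun e he => hmem' e ((hPG e).1 he))
  have hadj : ∀ a b, Y s(a, b) ≠ 0 → G.Adj a b := fun a b h =>
    (SimpleGraph.mem_edgeSet G).1 (hYG _ h)
  have hdiag : ∀ a, Y s(a, a) = 0 := fun a => by
    by_contra h; exact (hadj a a h).ne rfl
  refine ⟨fun a b => Y s(a, b), z, ⟨fun a b => by rw [Sym2.eq_swap], fun a b => hY0 _, hdiag, hz0,
    ?_, ?_⟩, hadj, ?_, ?_⟩
  · intro S hs hS v
    by_contra hv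
    obtain ⟨e, he, hYe⟩ := hYc (Finset.univ.filter (· ∈ S)) ⟨s, by simp [hs]⟩
      (fun h => hv (by simpa using Finset.eq_univ_iff_forall.1 h v))
    induction e using Sym2.ind with
    | _ a b =>
      rw [crosses_symEnds] at he
      simp only [Finset.mem_filter, Finset.mem_univ, true_and] at he
      refine he ⟨fun ha => hS a ha b hYe, fun hb => hS b hb a ?_⟩
      rwa [Sym2.eq_swap]
  · intro S hS hS'
    rw [sum_crossing_eq_cutSum]
    exact hYcut S hS hS'
  · have h1 := card_filter_sym2_le (V := V) fun e => Y e ≠ 0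
    have h2 := h2c.1
    have h3 := h1.trans (Nat.mul_le_mul_left 2 hYcard)
    dsimp only
    omega
  · rw [sum_sum_sym2 Y hdiag]
    have hle : ∑ e, Y e + z ≤ optLP G' := by
      refine le_csInf ⟨_, fun _ => 2, ⟨fun _ _ => by norm_num, fun S hS hS' => ?_⟩, rfl⟩ ?_
      · obtain ⟨a, b, hab, ha, hb⟩ := h2c.exists_adj_cut S.toFinset (by simpa using hS)
          (fun h => hS' (by simpa using h))
        exact le_cutValue_const G' (by norm_num) (hmem _ hab) (by simpa using ha) (by simpa using hb)
      · rintro _ ⟨x, hx, rfl⟩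
        rw [lpValue_eq_sum]
        refine hYopt _ ⟨fun e => ?_, fun e he => ?_, fun S hS hS' => ?_⟩
        · dsimp only
          split_ifs with h
          exacts [hx.1 e h, le_rfl]
        · exact if_neg fun h => he ((hPG e).2 h)
        · rw [← cutValue_eq_cutSum]
          exact hx.2 _ (by simpa using hS) (by simpa using hS')
    linarith

end LPPoint

section DFSTree

variable {V : Type*} [Fintype V] {H : SimpleGraph V} {x : V → V → ℝ} {s : V} {π : V → V}
  {D : V → Finset V}

namespace IsDFSTree

lemma parent_mem_of_mem (hT : IsDFSTree H x Finset.univ s π D) {u a : V} (hu : u ∈ D a)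
    (hua : u ≠ a) : u ≠ s ∧ π u ∈ D a := by
  induction hm : (D a).card using Nat.strong_induction_on generalizing a with
  | _ m ih =>
    obtain ⟨w, -, hws, hwa, huw⟩ := hT.exists_child a (Finset.mem_univ a) u hu hua
    subst hwa
    have hsub := hT.subset_parent w (Finset.mem_univ w) hws
    by_cases h : u = w
    · subst h
      exact ⟨hws, hT.self_mem _ (Finset.mem_univ _)⟩
    · have hlt : (D w).card < (D (π w)).card :=
        Finset.card_lt_card ((Finset.ssubset_iff_of_subset hsub).2
          ⟨π w, hT.self_mem _ (Finset.mem_univ _), hT.parent_notMem w (Finset.mem_univ w) hws⟩)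
      obtain ⟨h1, h2⟩ := ih _ (hm ▸ hlt) huw h rfl
      exact ⟨h1, hsub h2⟩

lemma antisymm (hT : IsDFSTree H x Finset.univ s π D) {u w : V} (huw : u ∈ D w) (hwu : w ∈ D u) :
    u = w := by
  by_contra h
  obtain ⟨h1, h2⟩ := hT.parent_mem_of_mem huw h
  exact hT.parent_notMem u (Finset.mem_univ u) h1
    (hT.trans u (Finset.mem_univ u) w hwu h2)

lemma root_notMem (hT : IsDFSTree H x Finset.univ s π D) {w : V} (hw : w ≠ s) : s ∉ D w :=
  fun h => (hw (hT.antisymm h (hT.root ▸ Finset.mem_univ w)).symm).elim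

lemma eq_of_parent_eq (hT : IsDFSTree H x Finset.univ s π D) {u w w' : V} (hw : w ≠ s)
    (hw' : w' ≠ s) (hp : π w = π w') (h : u ∈ D w) (h' : u ∈ D w') : w = w' := by
  by_contra hne
  exact Finset.disjoint_left.1
    (hT.disjoint w (Finset.mem_univ _) w' (Finset.mem_univ _) hw hw' hne hp) h h'

lemma nested (hT : IsDFSTree H x Finset.univ s π D) {u a b : V} (ha : u ∈ D a) (hb : u ∈ D b) :
    a ∈ D b ∨ b ∈ D a := by
  induction hm : (D a).card using Nat.strong_induction_on generalizing a with
  | _ m ih =>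
    by_cases hua : u = a
    · exact Or.inl (hua ▸ hb)
    obtain ⟨w, -, hws, hwa, huw⟩ := hT.exists_child a (Finset.mem_univ a) u ha hua
    subst hwa
    have hsub := hT.subset_parent w (Finset.mem_univ w) hws
    have hlt : (D w).card < (D (π w)).card :=
      Finset.card_lt_card ((Finset.ssubset_iff_of_subset hsub).2
        ⟨π w, hT.self_mem _ (Finset.mem_univ _), hT.parent_notMem w (Finset.mem_univ w) hws⟩)
    rcases ih _ (hm ▸ hlt) huw rfl with h | h
    · by_cases hwb : w = b
      · subst hwb; exact Or.inr (hsub h)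
      · exact Or.inl (hT.parent_mem_of_mem h hwb).2
    · exact Or.inr (hsub h)

/-- The end outside of `D w` of an edge leaving `D w` is an ancestor. -/
lemma mem_of_adj_of_notMem (hT : IsDFSTree H x Finset.univ s π D) {u v w : V} (hu : u ∈ D w)
    (hv : v ∉ D w) (huv : H.Adj u v) : π w ∈ D v := by
  have h1 : u ∈ D v := (hT.comparable u (Finset.mem_univ u) v (Finset.mem_univ v) huv).resolve_right
    (fun h => hv (hT.trans w (Finset.mem_univ w) u hu h))
  have h2 : w ∈ D v := (hT.nested hu h1).resolve_right hv
  exact (hT.parent_mem_of_mem h2 (fun h => hv (h ▸ hT.self_mem w (Finset.mem_univ w)))).2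

end IsDFSTree

end DFSTree

section BackEdges

lemma excess_sub_le {I J y : ℝ} (k : ℕ) (hIJ : I ≤ J) (hIk : I ≤ k)
    (hIy : I ≤ k * y) : max (I - 1) 0 - k / 6 ≤ 5 / 6 * max (y + J - 2) 0 := by
  have hk0 : (0 : ℝ) ≤ k := Nat.cast_nonneg k
  by_cases htriv : I ≤ 1 + k / 6
  · have h1 : max (I - 1) 0 ≤ k / 6 := max_le (by linarith) (by positivity)
    have h2 : 0 ≤ max (y + J - 2) 0 := le_max_right _ _
    linarith
  push Not at htriv
  have hk : (2 : ℝ) ≤ k := by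
    have : (1 : ℝ) < k := by nlinarith
    exact_mod_cast this
  have hmax : max (I - 1) 0 = I - 1 := max_eq_left (by nlinarith)
  rw [hmax]
  have key : (k : ℝ) * (I - 1 - k / 6) ≤ k * (5 / 6 * (y + J - 2)) := by
    suffices I * (k - 5) ≤ k * (k - 4) by nlinarith
    have h_int : (0 : ℝ) ≤ (k - 2) * (k - 3) := by
      have : (0 : ℤ) ≤ ((k : ℤ) - 2) * ((k : ℤ) - 3) := by
        rcases lt_or_ge (k : ℤ) 3 with h | h
        · have : (2 : ℤ) ≤ k := by exact_mod_cast hk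
          have : (k : ℤ) = 2 := by omega
          simp [this]
        · exact mul_nonneg (by omega) (by omega)
      exact_mod_cast this
    rcases le_or_gt (5 : ℝ) k with h | h
    · nlinarith
    · nlinarith
  have h1 := le_of_mul_le_mul_left key (by linarith)
  exact h1.trans (mul_le_mul_of_nonneg_left (le_max_left _ _) (by norm_num))

variable {V : Type*} [Fintype V]

/-- The value of `g` on the edges from `D w` to the parent of `w`, apart from the tree edge. -/
noncomputable def backIn (π : V → V) (D : V → Finset V) (g : V → V → ℝ) (w : V) : ℝ :=
  ∑ u ∈ (D w).erase w, g u (π w)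

/-- The value of `g` on the edges from `D w` jumping over the parent of `w`. -/
noncomputable def backOver (π : V → V) (D : V → Finset V) (g : V → V → ℝ) (w : V) : ℝ :=
  ∑ u ∈ D w, ∑ v ∈ (D w)ᶜ.erase (π w), g u v

variable {H : SimpleGraph V} {x : V → V → ℝ} {z : ℝ} {s t : V} {π : V → V} {D : V → Finset V}

lemma backOver_nonneg {g : V → V → ℝ} (hg : ∀ u v, 0 ≤ g u v) (w : V) : 0 ≤ backOver π D g w :=
  Finset.sum_nonneg fun _ _ => Finset.sum_nonneg fun _ _ => hg _ _

/-- The value of `x` on all edges from `D w` to the parent of `w`. -/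
noncomputable def branchWt (π : V → V) (D : V → Finset V) (x : V → V → ℝ) (w : V) : ℝ :=
  ∑ u ∈ D w, x u (π w)

lemma branchWt_nonneg {g : V → V → ℝ} (hg : ∀ u v, 0 ≤ g u v) (w : V) : 0 ≤ branchWt π D g w :=
  Finset.sum_nonneg fun _ _ => hg _ _

lemma branchWt_eq (hT : IsDFSTree H x Finset.univ s π D) (w : V) :
    branchWt π D x w = x w (π w) + backIn π D x w :=
  (Finset.add_sum_erase _ _ (hT.self_mem w (Finset.mem_univ w))).symm

/-- The shortfall of `w`: how much the edges over the parent of `w` miss to value `1`; it is only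
charged if there are such edges and `t ∉ D w`. -/
noncomputable def shortfall (t : V) (π : V → V) (D : V → Finset V) (x : V → V → ℝ) (w : V) : ℝ :=
  if t ∈ D w ∨ backOver π D x w = 0 then 0 else max (1 - backOver π D x w) 0

/-- The amount charged to `w` in the analysis of the rounded circulation. -/
noncomputable def branchCost (t : V) (π : V → V) (D : V → Finset V) (x : V → V → ℝ) (w : V) : ℝ :=
  max (backIn π D (fun u v => min (x u v) 1) w - 1) 0 + shortfall t π D x w +
    (if t ∉ D w ∧ backOver π D x w = 0 then 1 else 0) -
    ((((D w).erase w).filter fun u => x u (π w) ≠ 0).card : ℝ) / 6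

/-- The part of the degree of the parent of `w` which pays for `w`. -/
noncomputable def branchPay (t : V) (π : V → V) (D : V → Finset V) (x : V → V → ℝ) (w : V) : ℝ :=
  if t ∉ D w ∧ (backOver π D x w = 0 ∨ backOver π D x w < 1) then
    branchWt π D x w - backOver π D x w else max (branchWt π D x w - 2) 0

lemma two_le_branch (hx : IsLPPoint s t x z) (hT : IsDFSTree H x Finset.univ s π D) {w : V}
    (hw : w ≠ s) :
    2 ≤ branchWt π D x w + backOver π D x w + if t ∈ D w then z else 0 := by
  have hs := hT.root_notMem hw
  have h := hx.cut (D w) ⟨w, hT.self_mem w (Finset.mem_univ w)⟩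
    (fun e => hs (e ▸ Finset.mem_univ s))
  have h1 : ∑ a ∈ D w, ∑ b ∈ (D w)ᶜ, x a b = branchWt π D x w + backOver π D x w := by
    rw [branchWt, backOver, ← Finset.sum_add_distrib]
    refine Finset.sum_congr rfl fun u _ => (Finset.add_sum_erase _ _ ?_).symm
    exact Finset.mem_compl.2 (hT.parent_notMem w (Finset.mem_univ w) hw)
  rw [h1] at h
  convert h using 2
  by_cases ht : t ∈ D w <;> simp [hs, ht]

lemma excess_branch_le (hT : IsDFSTree H x Finset.univ s π D)
    (hH : ∀ a b, H.Adj a b ↔ x a b ≠ 0) {w : V} (hw : w ≠ s) :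
    max (backIn π D (fun u v => min (x u v) 1) w - 1) 0 -
      ((((D w).erase w).filter fun u => x u (π w) ≠ 0).card : ℝ) / 6 ≤
      5 / 6 * max (branchWt π D x w - 2) 0 := by
  have hIJ : backIn π D (fun u v => min (x u v) 1) w ≤ backIn π D x w :=
    Finset.sum_le_sum fun _ _ => min_le_left _ _
  have hfil : backIn π D (fun u v => min (x u v) 1) w =
      ∑ u ∈ ((D w).erase w).filter fun u => x u (π w) ≠ 0, min (x u (π w)) 1 := by
    rw [backIn, Finset.sum_filter]
    refine Finset.sum_congr rfl fun u _ => ?_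
    split_ifs with h
    · rfl
    · rw [not_not.1 h]; simp
  have hIk : backIn π D (fun u v => min (x u v) 1) w ≤
      (((D w).erase w).filter fun u => x u (π w) ≠ 0).card := by
    rw [hfil]
    refine (Finset.sum_le_sum fun u _ => min_le_right _ _).trans ?_
    simp
  have hIy : backIn π D (fun u v => min (x u v) 1) w ≤
      (((D w).erase w).filter fun u => x u (π w) ≠ 0).card * x w (π w) := by
    rw [hfil, ← nsmul_eq_mul, ← Finset.sum_const]
    refine Finset.sum_le_sum fun u hu => (min_le_left _ _).trans ?_
    simp only [Finset.mem_filter, Finset.mem_erase] at hu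
    exact hT.weight_le w (Finset.mem_univ w) hw u hu.1.2 ((hH _ _).2 hu.2)
  have := excess_sub_le _ hIJ hIk hIy
  rwa [← branchWt_eq hT] at this

lemma branchCost_le (hx : IsLPPoint s t x z) (hT : IsDFSTree H x Finset.univ s π D)
    (hH : ∀ a b, H.Adj a b ↔ x a b ≠ 0) {w : V} (hw : w ≠ s) :
    branchCost t π D x w ≤ 5 / 6 * branchPay t π D x w := by
  have h1 := excess_branch_le hT hH hw
  have h2 := two_le_branch hx hT hw
  have h3 := backOver_nonneg (π := π) (D := D) hx.nonneg w
  unfold branchCost branchPay shortfall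
  by_cases ht : t ∈ D w
  · simp only [ht, true_or, if_true, not_true_eq_false, false_and, if_false]
    linarith
  rw [if_neg ht, add_zero] at h2
  by_cases h0 : backOver π D x w = 0
  · simp only [ht, h0, or_true, true_or, not_false_eq_true, true_and, if_true] at h2 ⊢
    rw [max_eq_left (by linarith : (0 : ℝ) ≤ branchWt π D x w - 2)] at h1
    linarith
  by_cases hs : backOver π D x w < 1
  · simp only [ht, h0, hs, or_false, or_true, not_false_eq_true, and_true, and_false, if_true,
      if_false]
    rw [max_eq_left (by linarith : (0 : ℝ) ≤ 1 - backOver π D x w)]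
    rcases le_total 0 (branchWt π D x w - 2) with h | h
    · rw [max_eq_left h] at h1; linarith
    · rw [max_eq_right h] at h1; linarith
  · simp only [ht, h0, hs, or_false, not_false_eq_true, and_false, if_false]
    rw [max_eq_right (by linarith : 1 - backOver π D x w ≤ 0)]
    linarith

end BackEdges

section BranchSums

variable {V : Type*} [Fintype V] {H : SimpleGraph V} {x : V → V → ℝ} {z : ℝ} {s t : V}
  {π : V → V} {D : V → Finset V}

lemma sum_branchWt_eq (hT : IsDFSTree H x Finset.univ s π D) {v : V} {X : Finset V}
    (hX : ∀ w ∈ X, w ≠ s ∧ π w = v) :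
    ∑ w ∈ X, branchWt π D x w = ∑ u ∈ X.biUnion D, x u v := by
  rw [Finset.sum_biUnion]
  · refine Finset.sum_congr rfl fun w hw => ?_
    rw [branchWt, (hX w hw).2]
  · intro w hw w' hw' hne
    exact hT.disjoint w (Finset.mem_univ _) w' (Finset.mem_univ _) (hX w hw).1 (hX w' hw').1 hne
      ((hX w hw).2.trans (hX w' hw').2.symm)

lemma sum_branchWt_le (hx : IsLPPoint s t x z) (hT : IsDFSTree H x Finset.univ s π D) {v : V}
    {X : Finset V} (hX : ∀ w ∈ X, w ≠ s ∧ π w = v) :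
    ∑ w ∈ X, branchWt π D x w ≤ ∑ b, x v b := by
  rw [sum_branchWt_eq hT hX]
  refine (Finset.sum_le_sum_of_subset_of_nonneg (Finset.subset_univ _) fun u _ _ =>
    hx.nonneg u v).trans_eq (Finset.sum_congr rfl fun u _ => hx.symm u v)

/-- The cut formed by `v` and some branches below `v` none of which contains `t`. -/
lemma two_le_sub_branches (hx : IsLPPoint s t x z) (hT : IsDFSTree H x Finset.univ s π D) {v : V}
    (hv : v ≠ s) {X : Finset V} (hX : ∀ w ∈ X, w ≠ s ∧ π w = v) (ht : ∀ w ∈ X, t ∉ D w) :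
    ∑ w ∈ X, (branchWt π D x w - backOver π D x w) ≤
      ∑ b, x v b + (if t = v then z else 0) - 2 := by
  set B := X.biUnion D with hB
  have hvB : v ∉ B := by
    intro h
    obtain ⟨w, hw, hvw⟩ := Finset.mem_biUnion.1 h
    exact hT.parent_notMem w (Finset.mem_univ w) (hX w hw).1 ((hX w hw).2.symm ▸ hvw)
  have hsU : s ∉ insert v B := by
    intro h
    rcases Finset.mem_insert.1 h with h | h
    · exact hv h.symm
    · obtain ⟨w, hw, hvw⟩ := Finset.mem_biUnion.1 h
      exact hT.root_notMem (hX w hw).1 hvw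
  have htU : t ∈ insert v B ↔ t = v := by
    refine ⟨fun h => (Finset.mem_insert.1 h).resolve_right fun h => ?_,
      fun h => Finset.mem_insert.2 (Or.inl h)⟩
    obtain ⟨w, hw, htw⟩ := Finset.mem_biUnion.1 h
    exact ht w hw htw
  have hcut := hx.cut (insert v B) ⟨v, Finset.mem_insert_self v B⟩
    (fun e => hsU (e ▸ Finset.mem_univ s))
  have hz : (if (s ∈ insert v B ↔ t ∈ insert v B) then 0 else z) = if t = v then z else 0 := by
    by_cases h : t = v <;> simp only [hsU, htU, h] <;> simp
  rw [hz, Finset.sum_insert hvB] at hcut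
  have h1 : ∑ b ∈ (insert v B)ᶜ, x v b = ∑ b, x v b - ∑ w ∈ X, branchWt π D x w := by
    have h2 := Finset.sum_add_sum_compl (insert v B) fun b => x v b
    rw [Finset.sum_insert hvB, hx.diag, zero_add] at h2
    rw [sum_branchWt_eq hT hX, ← h2, Finset.sum_congr rfl fun u _ => hx.symm u v]
    ring
  have h3 : ∑ u ∈ B, ∑ b ∈ (insert v B)ᶜ, x u b ≤ ∑ w ∈ X, backOver π D x w := by
    rw [hB, Finset.sum_biUnion]
    · refine Finset.sum_le_sum fun w hw => Finset.sum_le_sum fun u _ =>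
        Finset.sum_le_sum_of_subset_of_nonneg (fun b hb => ?_) fun _ _ _ => hx.nonneg _ _
      simp only [Finset.mem_compl, Finset.mem_insert, not_or, Finset.mem_biUnion, not_exists,
        not_and] at hb
      rw [Finset.mem_erase, Finset.mem_compl, (hX w hw).2]
      exact ⟨hb.1, hb.2 w hw⟩
    · intro w hw w' hw' hne
      exact hT.disjoint w (Finset.mem_univ _) w' (Finset.mem_univ _) (hX w hw).1 (hX w' hw').1 hne
        ((hX w hw).2.trans (hX w' hw').2.symm)
  rw [Finset.sum_sub_distrib]
  linarith

lemma sum_branchPay_le (hx : IsLPPoint s t x z) (hT : IsDFSTree H x Finset.univ s π D) {v : V}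
    (hv : v ≠ s) :
    ∑ w with (w ≠ s ∧ π w = v), branchPay t π D x w ≤
      ∑ b, x v b + (if t = v then z else 0) - 2 := by
  set C := Finset.univ.filter fun w => w ≠ s ∧ π w = v with hC
  have hCm : ∀ w ∈ C, w ≠ s ∧ π w = v := fun w hw => (Finset.mem_filter.1 hw).2
  set p : V → Prop := fun w => t ∉ D w ∧ (backOver π D x w = 0 ∨ backOver π D x w < 1) with hp
  have ha := fun w => branchWt_nonneg (π := π) (D := D) hx.nonneg w
  have ho := fun w => backOver_nonneg (π := π) (D := D) hx.nonneg w
  have hpay : ∀ w, branchPay t π D x w ≤ branchWt π D x w := by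
    intro w
    unfold branchPay
    split_ifs
    · linarith [ho w]
    · exact max_le (by linarith) (ha w)
  by_cases hbig : ∃ w ∈ C, ¬ p w ∧ 2 < branchWt π D x w
  · obtain ⟨w, hw, hpw, hlt⟩ := hbig
    have h1 : branchPay t π D x w = branchWt π D x w - 2 := by
      rw [branchPay, if_neg hpw, max_eq_left (by linarith)]
    have h2 : ∑ w ∈ C.erase w, branchPay t π D x w ≤ ∑ w ∈ C.erase w, branchWt π D x w :=
      Finset.sum_le_sum fun w _ => hpay w
    have h3 := sum_branchWt_le hx hT hCm
    rw [← Finset.add_sum_erase _ _ hw] at h3 ⊢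
    have h4 : 0 ≤ if t = v then z else 0 := by split_ifs; exacts [hx.z_nonneg, le_rfl]
    linarith
  · push Not at hbig
    have h1 := two_le_sub_branches hx hT hv (X := C.filter p)
      (fun w hw => hCm w (Finset.mem_filter.1 hw).1) (fun w hw => (Finset.mem_filter.1 hw).2.1)
    refine le_trans (le_of_eq ?_) h1
    refine Eq.trans ?_ (Finset.sum_filter p _).symm
    refine Finset.sum_congr rfl fun w hw => ?_
    unfold branchPay
    by_cases h : p w
    · rw [if_pos h, if_pos h]
    · rw [if_neg h, if_neg h, max_eq_right (by linarith [hbig w hw h])]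

lemma backOver_eq_zero_of_parent_eq_root (hT : IsDFSTree H x Finset.univ s π D)
    (hH : ∀ a b, H.Adj a b ↔ x a b ≠ 0) {w : V} (hws : π w = s) :
    backOver π D x w = 0 := by
  refine Finset.sum_eq_zero fun u hu => Finset.sum_eq_zero fun v hv => ?_
  by_contra h
  rw [Finset.mem_erase, Finset.mem_compl, hws] at hv
  have := hT.mem_of_adj_of_notMem hu hv.2 ((hH u v).2 h)
  rw [hws] at this
  exact hT.root_notMem hv.1 this

lemma sum_branchCost_root_le (hx : IsLPPoint s t x z) (hT : IsDFSTree H x Finset.univ s π D)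
    (hH : ∀ a b, H.Adj a b ↔ x a b ≠ 0) (hn : ∃ v, v ≠ s) :
    ∑ w with (w ≠ s ∧ π w = s), branchCost t π D x w ≤
      5 / 6 * (∑ b, x s b + z - 2) + 1 := by
  set C := Finset.univ.filter fun w => w ≠ s ∧ π w = s with hC
  have hCm : ∀ w ∈ C, w ≠ s ∧ π w = s := fun w hw => (Finset.mem_filter.1 hw).2
  have hCne : 1 ≤ C.card := by
    obtain ⟨v, hv⟩ := hn
    obtain ⟨w, -, h1, h2, -⟩ := hT.exists_child s (Finset.mem_univ s) v
      (hT.root ▸ Finset.mem_univ v) hv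
    exact Finset.card_pos.2 ⟨w, by simp [hC, h1, h2]⟩
  have hcost : ∀ w ∈ C, branchCost t π D x w ≤
      5 / 6 * (branchWt π D x w + if t ∈ D w then z else 0) - 2 / 3 := by
    intro w hw
    have h0 := backOver_eq_zero_of_parent_eq_root hT hH (hCm w hw).2
    have h1 := excess_branch_le hT hH (hCm w hw).1
    have h2 := two_le_branch hx hT (hCm w hw).1
    have hz := hx.z_nonneg
    unfold branchCost shortfall
    rw [h0] at h2 ⊢
    by_cases ht : t ∈ D w
    · simp only [ht, true_or, if_true, not_true_eq_false, false_and, if_false] at h2 ⊢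
      rcases le_total 0 (branchWt π D x w - 2) with h | h
      · rw [max_eq_left h] at h1; linarith
      · rw [max_eq_right h] at h1; linarith
    · simp only [ht, or_true, if_true, not_false_eq_true, true_and, if_false] at h2 ⊢
      rw [max_eq_left (by linarith : (0 : ℝ) ≤ branchWt π D x w - 2)] at h1
      linarith
  refine (Finset.sum_le_sum hcost).trans ?_
  have hzs : ∑ w ∈ C, (if t ∈ D w then z else 0) ≤ z := by
    rw [← Finset.sum_filter, Finset.sum_const, nsmul_eq_mul]
    have : (C.filter fun w => t ∈ D w).card ≤ 1 := by
      rw [Finset.card_le_one]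
      intro w hw w' hw'
      rw [Finset.mem_filter] at hw hw'
      exact hT.eq_of_parent_eq (hCm w hw.1).1 (hCm w' hw'.1).1
        ((hCm w hw.1).2.trans (hCm w' hw'.1).2.symm) hw.2 hw'.2
    have h1 : ((C.filter fun w => t ∈ D w).card : ℝ) ≤ 1 := by exact_mod_cast this
    exact (mul_le_mul_of_nonneg_right h1 hx.z_nonneg).trans_eq (one_mul z)
  have h3 := sum_branchWt_le hx hT hCm
  have h4 : (1 : ℝ) ≤ C.card := by exact_mod_cast hCne
  rw [Finset.sum_sub_distrib, ← Finset.mul_sum, Finset.sum_add_distrib, Finset.sum_const,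
    nsmul_eq_mul]
  linarith

lemma sum_branchCost_le (hx : IsLPPoint s t x z) (hT : IsDFSTree H x Finset.univ s π D)
    (hH : ∀ a b, H.Adj a b ↔ x a b ≠ 0) (hn : ∃ v, v ≠ s) :
    ∑ w with w ≠ s, branchCost t π D x w ≤
      5 / 6 * (∑ a, ∑ b, x a b + 2 * z - 2 * Fintype.card V) + 1 := by
  have hfib : ∑ w with w ≠ s, branchCost t π D x w =
      ∑ v, ∑ w with (w ≠ s ∧ π w = v), branchCost t π D x w := by
    rw [← Finset.sum_fiberwise _ π]
    simp only [Finset.filter_filter]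
  have hv : ∀ v, ∑ w with (w ≠ s ∧ π w = v), branchCost t π D x w ≤
      5 / 6 * (∑ b, x v b + (if t = v then z else 0) - 2) +
        if s = v then 5 / 6 * z + 1 else 0 := by
    intro v
    by_cases h : s = v
    · subst h
      have h1 := sum_branchCost_root_le hx hT hH hn
      have h4 : 0 ≤ if t = s then z else 0 := by split_ifs; exacts [hx.z_nonneg, le_rfl]
      rw [if_pos rfl]
      linarith
    · have h1 := sum_branchPay_le hx hT (Ne.symm h)
      have h2 : ∑ w with (w ≠ s ∧ π w = v), branchCost t π D x w ≤
          ∑ w with (w ≠ s ∧ π w = v), 5 / 6 * branchPay t π D x w :=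
        Finset.sum_le_sum fun w hw => branchCost_le hx hT hH (Finset.mem_filter.1 hw).2.1
      rw [← Finset.mul_sum] at h2
      rw [if_neg h]
      linarith
  rw [hfib]
  refine (Finset.sum_le_sum fun v _ => hv v).trans (le_of_eq ?_)
  simp only [Finset.sum_add_distrib, ← Finset.mul_sum, Finset.sum_sub_distrib, Finset.sum_ite_eq,
    Finset.mem_univ, if_true, Finset.sum_const, Finset.card_univ, nsmul_eq_mul]
  ring

lemma sum_card_back_le (hx : IsLPPoint s t x z) (hT : IsDFSTree H x Finset.univ s π D)
    (hH : ∀ a b, H.Adj a b ↔ x a b ≠ 0)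
    (hcard : (Finset.univ.filter fun p : V × V => x p.1 p.2 ≠ 0).card + 4 ≤ 4 * Fintype.card V) :
    ∑ w with w ≠ s, (((D w).erase w).filter fun u => x u (π w) ≠ 0).card + 1 ≤
      Fintype.card V := by
  set W := Finset.univ.filter fun w => w ≠ s with hW
  set K : Finset (Σ _ : V, V) := W.sigma fun w => (D w).filter fun u => x u (π w) ≠ 0 with hK
  have hKm : ∀ p, p ∈ K ↔ p.1 ≠ s ∧ p.2 ∈ D p.1 ∧ x p.2 (π p.1) ≠ 0 := by
    intro p; simp [hK, hW]
  have hKcard : K.card = ∑ w ∈ W, (((D w).erase w).filter fun u => x u (π w) ≠ 0).card +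
      W.card := by
    rw [hK, Finset.card_sigma, Finset.card_eq_sum_ones W, ← Finset.sum_add_distrib]
    refine Finset.sum_congr rfl fun w hw => ?_
    have hmem : w ∈ (D w).filter fun u => x u (π w) ≠ 0 :=
      Finset.mem_filter.2 ⟨hT.self_mem w (Finset.mem_univ w),
        (hH _ _).1 (hT.adj_parent w (Finset.mem_univ w) (Finset.mem_filter.1 hw).2)⟩
    rw [← Finset.card_erase_add_one hmem, Finset.filter_erase]
  have hWcard : W.card + 1 = Fintype.card V := by
    have : W = Finset.univ.erase s := by ext w; simp [hW]
    rw [this, Finset.card_erase_add_one (Finset.mem_univ s), Finset.card_univ]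
  have hle : (K.disjSum K).card ≤ (Finset.univ.filter fun p : V × V => x p.1 p.2 ≠ 0).card := by
    refine Finset.card_le_card_of_injOn
      (Sum.elim (fun p => (p.2, π p.1)) (fun p => (π p.1, p.2))) ?_ ?_
    · intro p hp
      rw [Finset.mem_coe, Finset.mem_disjSum] at hp
      rw [Finset.mem_coe, Finset.mem_filter]
      refine ⟨Finset.mem_univ _, ?_⟩
      rcases hp with ⟨q, hq, rfl⟩ | ⟨q, hq, rfl⟩
      · exact ((hKm q).1 hq).2.2
      · change x (π q.1) q.2 ≠ 0
        rw [hx.symm]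
        exact ((hKm q).1 hq).2.2
    · have hsame : ∀ q ∈ K, ∀ q' ∈ K, q.2 = q'.2 → π q.1 = π q'.1 → q = q' := by
        rintro ⟨w, u⟩ hq ⟨w', u'⟩ hq' h1 h2
        rw [hKm] at hq hq'
        dsimp only at h1 h2 hq hq'
        subst h1
        rw [hT.eq_of_parent_eq hq.1 hq'.1 h2 hq.2.1 hq'.2.1]
      have hdiff : ∀ q ∈ K, ∀ q' ∈ K, q.2 = π q'.1 → π q.1 = q'.2 → False := by
        rintro ⟨w, u⟩ hq ⟨w', u'⟩ hq' h1 h2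
        rw [hKm] at hq hq'
        dsimp only at h1 h2 hq hq'
        subst h1 h2
        have h3 := hT.antisymm (hT.subset_parent w (Finset.mem_univ _) hq.1 hq.2.1)
          (hT.subset_parent w' (Finset.mem_univ _) hq'.1 hq'.2.1)
        exact hT.parent_notMem w (Finset.mem_univ _) hq.1 (h3 ▸ hq.2.1)
      intro p hp p' hp' h
      rw [Finset.mem_coe, Finset.mem_disjSum] at hp hp'
      rcases hp with ⟨q, hq, rfl⟩ | ⟨q, hq, rfl⟩ <;> rcases hp' with ⟨q', hq', rfl⟩ | ⟨q', hq', rfl⟩ <;>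
        simp only [Sum.elim_inl, Sum.elim_inr, Prod.mk.injEq] at h
      · rw [hsame q hq q' hq' h.1 h.2]
      · exact (hdiff q hq q' hq' h.1 h.2).elim
      · exact (hdiff q' hq' q hq h.1.symm h.2.symm).elim
      · rw [hsame q hq q' hq' h.2 h.1]
  rw [Finset.card_disjSum] at hle
  omega

end BranchSums

section BackFlow

lemma min_one_sum_le {ι : Type*} (S : Finset ι) (g : ι → ℝ) (hg : ∀ i ∈ S, 0 ≤ g i) :
    min 1 (∑ i ∈ S, g i) ≤ ∑ i ∈ S, min 1 (g i) := by
  by_cases h : ∃ i ∈ S, 1 ≤ g i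
  · obtain ⟨i, hi, h1⟩ := h
    refine (min_le_left _ _).trans ?_
    exact (min_eq_left h1).symm.le.trans (Finset.single_le_sum (f := fun i => min 1 (g i))
      (fun i hi => le_min zero_le_one (hg i hi)) hi)
  · push Not at h
    exact (min_le_right _ _).trans_eq
      (Finset.sum_congr rfl fun i hi => (min_eq_right (h i hi).le).symm)

variable {V : Type*} [Fintype V] {H : SimpleGraph V} {x : V → V → ℝ} {z : ℝ} {s t : V}
  {π : V → V} {D : V → Finset V}

/-- `uv` jumps from the branch below some child of `v` to `v` and is not a tree edge. -/
def IsBack (s : V) (π : V → V) (D : V → Finset V) (u v : V) : Prop :=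
  ∃ w, w ≠ s ∧ π w = v ∧ u ∈ D w ∧ u ≠ w

lemma isBack_of_over (hT : IsDFSTree H x Finset.univ s π D) {u v w : V} (hu : u ∈ D w)
    (hv : v ∉ D w) (hvw : v ≠ π w) (huv : H.Adj u v) : IsBack s π D u v := by
  have h1 : u ∈ D v := (hT.comparable u (Finset.mem_univ u) v (Finset.mem_univ v) huv).resolve_right
    (fun h => hv (hT.trans w (Finset.mem_univ w) u hu h))
  obtain ⟨c, -, hcs, hcv, huc⟩ := hT.exists_child v (Finset.mem_univ v) u h1 huv.ne
  refine ⟨c, hcs, hcv, huc, ?_⟩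
  rintro rfl
  by_cases huw : u = w
  · exact hvw (huw ▸ hcv.symm)
  · exact hv (hcv ▸ (hT.parent_mem_of_mem hu huw).2)

lemma shortfall_nonneg (w : V) : 0 ≤ shortfall t π D x w := by
  unfold shortfall
  split_ifs
  exacts [le_rfl, le_max_right _ _]

lemma shortfall_root (hT : IsDFSTree H x Finset.univ s π D) : shortfall t π D x s = 0 := by
  rw [shortfall, if_pos]
  rw [hT.root]
  exact Or.inl (Finset.mem_univ t)

/-- The extra value put on edges, `β w` receiving the shortfall of `w`, has total value at most
the total shortfall. -/
lemma sum_extra_le (hT : IsDFSTree H x Finset.univ s π D) (β : V → V × V) :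
    ∑ w with w ≠ s, ∑ u ∈ (D w).erase w, ∑ w' with β w' = (u, π w), shortfall t π D x w' ≤
      ∑ w with w ≠ s, shortfall t π D x w := by
  have hroot : ∑ w with w ≠ s, shortfall t π D x w = ∑ w, shortfall t π D x w := by
    rw [Finset.sum_filter]
    refine Finset.sum_congr rfl fun w _ => ?_
    split_ifs with h
    · rfl
    · rw [not_not.1 h, shortfall_root hT]
  rw [hroot, Finset.sum_sigma']
  simp only [Finset.sum_filter (fun w' => β w' = _)]
  rw [Finset.sum_comm]
  refine Finset.sum_le_sum fun w' _ => ?_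
  rw [← Finset.sum_filter, Finset.sum_const, nsmul_eq_mul]
  refine (mul_le_mul_of_nonneg_right ?_ (shortfall_nonneg w')).trans_eq (one_mul _)
  rw [Nat.cast_le_one, Finset.card_le_one]
  rintro ⟨w, u⟩ hp ⟨w₂, u₂⟩ hp₂
  simp only [Finset.mem_filter, Finset.mem_sigma, Finset.mem_univ, true_and, Finset.mem_erase]
    at hp hp₂
  obtain ⟨rfl, h2⟩ := Prod.mk.inj (hp.2.symm.trans hp₂.2)
  rw [hT.eq_of_parent_eq hp.1.1 hp₂.1.1 h2 hp.1.2.2 hp₂.1.2.2]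

theorem exists_backFlow (hx : IsLPPoint s t x z) (hT : IsDFSTree H x Finset.univ s π D)
    (hH : ∀ a b, H.Adj a b ↔ x a b ≠ 0) (hn : ∃ v, v ≠ s)
    (hcard : (Finset.univ.filter fun p : V × V => x p.1 p.2 ≠ 0).card + 4 ≤ 4 * Fintype.card V) :
    ∃ f : V → V → ℝ, (∀ u v, 0 ≤ f u v) ∧ (∀ u v, f u v ≤ 1) ∧
      (∀ u v, f u v ≠ 0 → x u v ≠ 0 ∧ IsBack s π D u v) ∧
      (∀ w, 1 ≤ backOver π D f w + (if t ∈ D w then 1 else 0) ∨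
        backOver π D f w + (if t ∈ D w then 1 else 0) = 0) ∧
      ∑ w with w ≠ s, (max (backIn π D f w - 1) 0 +
        if backOver π D f w + (if t ∈ D w then 1 else 0) = 0 then 1 else 0) ≤
        5 / 6 * (∑ a, ∑ b, x a b + 2 * z) - 3 / 2 * Fintype.card V + 1 := by
  have hβ : ∃ β : V → V × V, ∀ w, backOver π D x w ≠ 0 → (β w).1 ∈ D w ∧
      (β w).2 ∈ (D w)ᶜ.erase (π w) ∧ x (β w).1 (β w).2 ≠ 0 := by
    refine ⟨fun w => if h : ∃ p : V × V, p.1 ∈ D w ∧ p.2 ∈ (D w)ᶜ.erase (π w) ∧ x p.1 p.2 ≠ 0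
      then h.choose else (w, w), fun w hw => ?_⟩
    obtain ⟨u, hu, h1⟩ := Finset.exists_ne_zero_of_sum_ne_zero hw
    obtain ⟨v, hv, h2⟩ := Finset.exists_ne_zero_of_sum_ne_zero h1
    have h : ∃ p : V × V, p.1 ∈ D w ∧ p.2 ∈ (D w)ᶜ.erase (π w) ∧ x p.1 p.2 ≠ 0 :=
      ⟨(u, v), hu, hv, h2⟩
    dsimp only
    rw [dif_pos h]
    exact h.choose_spec
  obtain ⟨β, hβ⟩ := hβ
  have hsn := fun w => shortfall_nonneg (t := t) (π := π) (D := D) (x := x) w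
  obtain ⟨ex, hex⟩ : ∃ ex : V → V → ℝ, ∀ u v, ex u v =
      ∑ w' with β w' = (u, v), shortfall t π D x w' := ⟨_, fun _ _ => rfl⟩
  have hexn : ∀ u v, 0 ≤ ex u v := fun u v => by
    rw [hex]; exact Finset.sum_nonneg fun w _ => hsn w
  obtain ⟨f, hf⟩ : ∃ f : V → V → ℝ, ∀ u v, f u v =
      if x u v ≠ 0 ∧ IsBack s π D u v then min 1 (x u v + ex u v) else 0 := ⟨_, fun _ _ => rfl⟩
  have hf0 : ∀ u v, 0 ≤ f u v := by
    intro u v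
    rw [hf]
    split_ifs
    · exact le_min zero_le_one (add_nonneg (hx.nonneg u v) (hexn u v))
    · exact le_rfl
  have hf1 : ∀ u v, f u v ≤ 1 := by
    intro u v
    rw [hf]
    split_ifs
    exacts [min_le_left _ _, zero_le_one]
  have hfx : ∀ u v, f u v ≠ 0 → x u v ≠ 0 ∧ IsBack s π D u v := by
    intro u v h
    by_contra hc
    rw [hf, if_neg hc] at h
    exact h rfl
  have hfle : ∀ u v, f u v ≤ min (x u v) 1 + ex u v := by
    intro u v
    rw [hf]
    split_ifs
    · have := hexn u v
      rcases le_total (x u v) 1 with h | h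
      · rw [min_eq_left h]; exact min_le_right _ _
      · rw [min_eq_right h]; exact (min_le_left _ _).trans (by linarith)
    · exact add_nonneg (le_min (hx.nonneg u v) zero_le_one) (hexn u v)
  have hover : ∀ w, t ∉ D w → backOver π D x w ≠ 0 → 1 ≤ backOver π D f w := by
    intro w ht hw
    obtain ⟨hb1, hb2, hb3⟩ := hβ w hw
    set P := (D w) ×ˢ ((D w)ᶜ.erase (π w)) with hP
    set g : V × V → ℝ := fun p => x p.1 p.2 + if p = β w then shortfall t π D x w else 0 with hg
    have hg0 : ∀ p ∈ P, 0 ≤ g p := fun p _ => add_nonneg (hx.nonneg _ _) (by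
      split_ifs; exacts [hsn w, le_rfl])
    have h1 : backOver π D f w = ∑ p ∈ P, f p.1 p.2 := by rw [hP, Finset.sum_product]; rfl
    have h2 : backOver π D x w = ∑ p ∈ P, x p.1 p.2 := by rw [hP, Finset.sum_product]; rfl
    have h3 : ∑ p ∈ P, g p = backOver π D x w + shortfall t π D x w := by
      rw [Finset.sum_add_distrib, Finset.sum_ite_eq', ← h2,
        if_pos (Finset.mem_product.2 ⟨hb1, hb2⟩)]
    have h4 : 1 ≤ ∑ p ∈ P, g p := by
      rw [h3, shortfall, if_neg (by tauto)]
      linarith [le_max_left (1 - backOver π D x w) 0]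
    rw [h1]
    refine (min_eq_left h4).symm.le.trans ?_
    refine (min_one_sum_le P g hg0).trans (Finset.sum_le_sum fun p hp => ?_)
    rw [hP, Finset.mem_product, Finset.mem_erase, Finset.mem_compl] at hp
    by_cases hxp : x p.1 p.2 = 0
    · have : p ≠ β w := fun h => hb3 (h ▸ hxp)
      rw [hg]
      dsimp only
      rw [hxp, if_neg this, add_zero]
      exact (min_le_right _ _).trans (hf0 _ _)
    · rw [hf, if_pos ⟨hxp, isBack_of_over hT hp.1 hp.2.2 hp.2.1 ((hH _ _).2 hxp)⟩]
      refine min_le_min le_rfl (add_le_add le_rfl ?_)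
      split_ifs with h
      · rw [hex]
        exact Finset.single_le_sum (fun w _ => hsn w)
          (Finset.mem_filter.2 ⟨Finset.mem_univ w, h.symm⟩)
      · exact hexn _ _
  have hover0 : ∀ w, backOver π D x w = 0 → backOver π D f w = 0 := by
    intro w hw
    refine Finset.sum_eq_zero fun u hu => Finset.sum_eq_zero fun v hv => ?_
    by_contra h
    refine (hfx u v h).1 ?_
    have h1 := (Finset.sum_eq_zero_iff_of_nonneg fun u _ =>
      Finset.sum_nonneg fun v _ => hx.nonneg u v).1 hw u hu
    exact (Finset.sum_eq_zero_iff_of_nonneg fun v _ => hx.nonneg u v).1 h1 v hv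
  have hfo := fun w => backOver_nonneg (π := π) (D := D) hf0 w
  refine ⟨f, hf0, hf1, hfx, fun w => ?_, ?_⟩
  · by_cases ht : t ∈ D w
    · rw [if_pos ht]; exact Or.inl (by linarith [hfo w])
    · rw [if_neg ht, add_zero]
      by_cases hw : backOver π D x w = 0
      · exact Or.inr (hover0 w hw)
      · exact Or.inl (hover w ht hw)
  have hterm : ∀ w, max (backIn π D f w - 1) 0 +
      (if backOver π D f w + (if t ∈ D w then 1 else 0) = 0 then 1 else 0) ≤
      branchCost t π D x w + ((((D w).erase w).filter fun u => x u (π w) ≠ 0).card : ℝ) / 6 +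
        (∑ u ∈ (D w).erase w, ∑ w' with β w' = (u, π w), shortfall t π D x w' -
          shortfall t π D x w) := by
    intro w
    have h1 : backIn π D f w ≤ backIn π D (fun u v => min (x u v) 1) w +
        ∑ u ∈ (D w).erase w, ∑ w' with β w' = (u, π w), shortfall t π D x w' := by
      rw [backIn, backIn, ← Finset.sum_add_distrib]
      exact Finset.sum_le_sum fun u _ => by rw [← hex]; exact hfle _ _
    have h2 : 0 ≤ ∑ u ∈ (D w).erase w, ∑ w' with β w' = (u, π w), shortfall t π D x w' :=
      Finset.sum_nonneg fun u _ => Finset.sum_nonneg fun w' _ => hsn w'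
    have h3 : max (backIn π D f w - 1) 0 ≤ max (backIn π D (fun u v => min (x u v) 1) w - 1) 0 +
        ∑ u ∈ (D w).erase w, ∑ w' with β w' = (u, π w), shortfall t π D x w' :=
      max_le (by linarith [le_max_left (backIn π D (fun u v => min (x u v) 1) w - 1) 0])
        (add_nonneg (le_max_right _ _) h2)
    have h4 : (if backOver π D f w + (if t ∈ D w then 1 else 0) = 0 then (1 : ℝ) else 0) ≤
        if t ∉ D w ∧ backOver π D x w = 0 then 1 else 0 := by
      by_cases h : t ∉ D w ∧ backOver π D x w = 0
      · rw [if_pos h]; split_ifs <;> norm_num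
      · rw [if_neg h, if_neg]
        intro h0
        by_cases ht : t ∈ D w
        · rw [if_pos ht] at h0; linarith [hfo w]
        · rw [if_neg ht] at h0
          linarith [hover w ht fun h' => h ⟨ht, h'⟩]
    unfold branchCost
    linarith
  refine (Finset.sum_le_sum fun w _ => hterm w).trans ?_
  rw [Finset.sum_add_distrib, Finset.sum_add_distrib, Finset.sum_sub_distrib, ← Finset.sum_div]
  have h1 := sum_branchCost_le hx hT hH hn
  have h2 := sum_extra_le (t := t) hT β
  have h3 := sum_card_back_le hx hT hH hcard
  have h4 : (∑ w with w ≠ s, ((((D w).erase w).filter fun u => x u (π w) ≠ 0).card : ℝ)) + 1 ≤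
      Fintype.card V := by exact_mod_cast h3
  linarith

end BackFlow

section BackFlowConservation

variable {V : Type*} [Fintype V] {H : SimpleGraph V} {x : V → V → ℝ} {s t : V}
  {π : V → V} {D : V → Finset V}

lemma IsDFSTree.sum_descendants {M : Type*} [AddCommMonoid M]
    (hT : IsDFSTree H x Finset.univ s π D) (v : V) (g : V → M) :
    ∑ u ∈ D v, g u = g v + ∑ w with w ≠ s ∧ π w = v, ∑ u ∈ D w, g u := by
  have h1 : (D v).erase v = (Finset.univ.filter fun w => w ≠ s ∧ π w = v).biUnion D := by
    ext u
    simp only [Finset.mem_erase, Finset.mem_biUnion, Finset.mem_filter, Finset.mem_univ, true_and]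
    constructor
    · rintro ⟨huv, hu⟩
      obtain ⟨w, -, h1, h2, h3⟩ := hT.exists_child v (Finset.mem_univ v) u hu huv
      exact ⟨w, ⟨h1, h2⟩, h3⟩
    · rintro ⟨w, ⟨h1, rfl⟩, h3⟩
      refine ⟨?_, hT.subset_parent w (Finset.mem_univ w) h1 h3⟩
      rintro rfl
      exact hT.parent_notMem w (Finset.mem_univ w) h1 h3
  rw [← Finset.add_sum_erase _ _ (hT.self_mem v (Finset.mem_univ v)), h1, Finset.sum_biUnion]
  intro w hw w' hw' hne
  rw [Finset.mem_coe, Finset.mem_filter] at hw hw'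
  exact hT.disjoint w (Finset.mem_univ _) w' (Finset.mem_univ _) hw.2.1 hw'.2.1 hne
    (hw.2.2.trans hw'.2.2.symm)

lemma IsBack.mem (hT : IsDFSTree H x Finset.univ s π D) {u v : V} (h : IsBack s π D u v) :
    u ∈ D v := by
  obtain ⟨w, hw, rfl, hu, -⟩ := h
  exact hT.subset_parent w (Finset.mem_univ w) hw hu

lemma IsBack.ne (hT : IsDFSTree H x Finset.univ s π D) {u v : V} (h : IsBack s π D u v) :
    u ≠ v := by
  obtain ⟨w, hw, rfl, hu, -⟩ := h
  rintro rfl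
  exact hT.parent_notMem w (Finset.mem_univ w) hw hu

lemma not_isBack_parent (hT : IsDFSTree H x Finset.univ s π D) {w : V} (hw : w ≠ s) :
    ¬ IsBack s π D w (π w) := by
  rintro ⟨w', hw', hp, hu, hne⟩
  exact hne (hT.eq_of_parent_eq hw hw' hp.symm (hT.self_mem w (Finset.mem_univ w)) hu)

lemma backIn_add_backOver (hT : IsDFSTree H x Finset.univ s π D) {f : V → V → ℝ}
    (hf : ∀ u v, f u v ≠ 0 → IsBack s π D u v) {v : V} (hv : v ≠ s) :
    backIn π D f v + backOver π D f v = ∑ u ∈ D v, ∑ b ∈ (D v)ᶜ, f u b := by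
  have hp : π v ∈ (D v)ᶜ :=
    Finset.mem_compl.2 (hT.parent_notMem v (Finset.mem_univ v) hv)
  have h0 : f v (π v) = 0 := by
    by_contra h
    exact not_isBack_parent hT hv (hf _ _ h)
  have h1 : backIn π D f v = ∑ u ∈ D v, f u (π v) := by
    rw [← Finset.add_sum_erase _ _ (hT.self_mem v (Finset.mem_univ v)), h0, zero_add]
    rfl
  rw [h1, backOver, ← Finset.sum_add_distrib]
  exact Finset.sum_congr rfl fun u _ => Finset.add_sum_erase _ _ hp

/-- Sending the value of every back edge down the tree gives a circulation. -/
lemma backFlow_conservation (hT : IsDFSTree H x Finset.univ s π D) {f : V → V → ℝ}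
    (hf : ∀ u v, f u v ≠ 0 → IsBack s π D u v) (v : V) :
    (if v = s then 1 else backIn π D f v + (backOver π D f v + if t ∈ D v then 1 else 0)) =
      ∑ b, f v b + ∑ w with w ≠ s ∧ π w = v, (backOver π D f w + if t ∈ D w then 1 else 0) +
        if v = t then 1 else 0 := by
  have hl : (if v = s then 1 else backIn π D f v + (backOver π D f v + if t ∈ D v then 1 else 0)) =
      ∑ u ∈ D v, ∑ b ∈ (D v)ᶜ, f u b + if t ∈ D v then (1 : ℝ) else 0 := by
    split_ifs with h1 h2 h2
    · rw [h1, hT.root]; simp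
    · rw [h1, hT.root] at h2; simp at h2
    · rw [← backIn_add_backOver hT hf h1]; ring
    · rw [← backIn_add_backOver hT hf h1]; ring
  have ht : (if t ∈ D v then (1 : ℝ) else 0) = (if v = t then 1 else 0) +
      ∑ w with w ≠ s ∧ π w = v, if t ∈ D w then (1 : ℝ) else 0 := by
    have h := hT.sum_descendants v fun u => if u = t then (1 : ℝ) else 0
    simpa only [Finset.sum_ite_eq'] using h
  have hout : ∑ b ∈ (D v)ᶜ, f v b = ∑ b, f v b := by
    refine Finset.sum_subset (Finset.subset_univ _) fun b _ hb => ?_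
    by_contra h
    have h1 := hf _ _ h
    exact h1.ne hT (hT.antisymm (h1.mem hT) (by simpa using hb))
  have hchild : ∀ w ∈ Finset.univ.filter fun w => w ≠ s ∧ π w = v,
      ∑ u ∈ D w, ∑ b ∈ (D v)ᶜ, f u b = backOver π D f w := by
    intro w hw
    rw [Finset.mem_filter] at hw
    obtain ⟨-, hws, rfl⟩ := hw
    refine Finset.sum_congr rfl fun u hu => ?_
    have hsub := hT.subset_parent w (Finset.mem_univ w) hws
    refine Finset.sum_subset (fun b hb => ?_) fun b hb hb' => ?_
    · rw [Finset.mem_compl] at hb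
      exact Finset.mem_erase.2 ⟨fun h => hb (h ▸ hT.self_mem _ (Finset.mem_univ _)),
        Finset.mem_compl.2 fun h => hb (hsub h)⟩
    · by_contra h
      have h1 := (hf _ _ h).mem hT
      rw [Finset.mem_erase, Finset.mem_compl] at hb
      rw [Finset.mem_compl, not_not] at hb'
      obtain ⟨c, -, hcs, hc, hbc⟩ := hT.exists_child _ (Finset.mem_univ _) b hb' hb.1
      have : c = w := hT.eq_of_parent_eq hcs hws hc (hT.trans c (Finset.mem_univ c) b hbc h1) hu
      exact hb.2 (this ▸ hbc)
  rw [hl, hT.sum_descendants v, hout, Finset.sum_congr rfl hchild, ht, Finset.sum_add_distrib]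
  ring

end BackFlowConservation

section BackNetwork

variable {V : Type*} [Fintype V] {s t : V} {π : V → V}

/-- The tails of the arcs of the network: back edges, entrance arcs, passing arcs and tree arcs,
between the vertices, the entrances and the meeting points. -/
noncomputable def netTail (s t : V) (π : V → V) : (V × V) ⊕ V ⊕ V ⊕ V → V ⊕ V ⊕ V :=
  Sum.elim (fun p => .inl p.1) (Sum.elim (fun w => .inr (.inl w))
    (Sum.elim (fun w => .inl (π w)) fun w => if w = s then .inl t else .inr (.inr w)))

/-- The heads of the arcs of the network. -/
def netHead (ch : V × V → V) : (V × V) ⊕ V ⊕ V ⊕ V → V ⊕ V ⊕ V :=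
  Sum.elim (fun p => .inr (.inl (ch p))) (Sum.elim (fun w => .inr (.inr w))
    (Sum.elim (fun w => .inr (.inr w)) fun w => .inl w))

lemma isCirculation_net_iff {R : Type*} [AddCommMonoid R] (ch : V × V → V)
    (F : (V × V) ⊕ V ⊕ V ⊕ V → R) :
    IsCirculation (netTail s t π) (netHead ch) F ↔
      (∀ v, F (.inr (.inr (.inr v))) = ∑ b, F (.inl (v, b)) +
        ∑ w with π w = v, F (.inr (.inr (.inl w))) +
          if v = t then F (.inr (.inr (.inr s))) else 0) ∧
      (∀ w, ∑ p with ch p = w, F (.inl p) = F (.inr (.inl w))) ∧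
      ∀ w, F (.inr (.inl w)) + F (.inr (.inr (.inl w))) =
        if w = s then 0 else F (.inr (.inr (.inr w))) := by
  have h1 : ∀ v : V, ∑ w, (if (if w = s then (Sum.inl t : V ⊕ V ⊕ V) else .inr (.inr w)) = .inl v
      then F (.inr (.inr (.inr w))) else 0) = if v = t then F (.inr (.inr (.inr s))) else 0 := by
    intro v
    rw [Finset.sum_eq_single s]
    · simp [eq_comm]
    · intro w _ hw; simp [hw]
    · simp
  have h2 : ∀ v : V, ∑ w, (if (if w = s then (Sum.inl t : V ⊕ V ⊕ V) else .inr (.inr w)) =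
      .inr (.inr v) then F (.inr (.inr (.inr w))) else 0) =
        if v = s then 0 else F (.inr (.inr (.inr v))) := by
    intro v
    rw [Finset.sum_eq_single v]
    · by_cases h : v = s <;> simp [h]
    · intro w _ hw
      by_cases h : w = s
      · simp [h]
      · simp [h, hw]
    · simp
  have h3 : ∀ v w : V, ¬ ((if w = s then (Sum.inl t : V ⊕ V ⊕ V) else .inr (.inr w)) =
      .inr (.inl v)) := by
    intro v w; split_ifs <;> simp
  have h4 : ∀ v : V, ∑ a, ∑ b, (if a = v then F (.inl (a, b)) else 0) = ∑ b, F (.inl (v, b)) := by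
    intro v
    rw [Finset.sum_comm]
    simp
  simp only [IsCirculation, Sum.forall, Fintype.sum_sum_type, netTail, netHead, Sum.elim_inl,
    Sum.elim_inr, Sum.inl.injEq, Sum.inr.injEq, reduceCtorEq, if_false, Finset.sum_const_zero,
    zero_add, add_zero, Finset.sum_ite_eq', Finset.mem_univ, if_true, h3,
    Finset.sum_filter]
  simp only [Fintype.sum_prod_type, h4, add_assoc, ← h1, ← h2]
  refine Iff.of_eq ?_
  congr!

end BackNetwork

section BackEdges

variable {V : Type*} [Fintype V] {H : SimpleGraph V} {x : V → V → ℝ} {s t : V}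
  {π : V → V} {D : V → Finset V}

/-- The starting vertices of the edges of `P` from `D w` to the parent of `w`, apart from `w`. -/
noncomputable def backStarts (π : V → V) (D : V → Finset V) (P : Finset (V × V)) (w : V) :
    Finset V :=
  ((D w).erase w).filter fun u => (u, π w) ∈ P

lemma exists_child_of_isBack (hT : IsDFSTree H x Finset.univ s π D) :
    ∃ ch : V × V → V, ∀ u v, IsBack s π D u v → ∀ w,
      ch (u, v) = w ↔ w ≠ s ∧ π w = v ∧ u ∈ D w ∧ u ≠ w := by
  refine ⟨fun p => if h : IsBack s π D p.1 p.2 then h.choose else p.1, fun u v h w => ?_⟩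
  dsimp only
  rw [dif_pos h]
  have hc := h.choose_spec
  constructor
  · rintro rfl; exact hc
  · intro hw
    exact hT.eq_of_parent_eq hc.1 hw.1 (hc.2.1.trans hw.2.1.symm) hc.2.2.1 hw.2.2.1

lemma sum_child_eq {R : Type*} [AddCommMonoid R] {ch : V × V → V}
    (hch : ∀ u v, IsBack s π D u v → ∀ w, ch (u, v) = w ↔ w ≠ s ∧ π w = v ∧ u ∈ D w ∧ u ≠ w)
    {g : V × V → R} (hg : ∀ p, g p ≠ 0 → IsBack s π D p.1 p.2) (w : V) :
    ∑ p with ch p = w, g p = if w = s then 0 else ∑ u ∈ (D w).erase w, g (u, π w) := by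
  split_ifs with hw
  · refine Finset.sum_eq_zero fun p hp => ?_
    by_contra h
    exact ((hch _ _ (hg p h) w).1 (Finset.mem_filter.1 hp).2).1 hw
  · rw [← Finset.sum_image (f := g) (g := fun u => (u, π w))
      (fun u _ u' _ h => (Prod.mk.inj h).1)]
    refine Finset.sum_congr_of_eq_on_inter ?_ ?_ fun _ _ _ => rfl
    · intro p hp hp'
      by_contra h
      have h1 := (hch _ _ (hg p h) w).1 (Finset.mem_filter.1 hp).2
      exact hp' (Finset.mem_image.2 ⟨p.1, Finset.mem_erase.2 ⟨h1.2.2.2, h1.2.2.1⟩,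
        Prod.ext rfl h1.2.1⟩)
    · intro p hp hp'
      by_contra h
      obtain ⟨u, hu, rfl⟩ := Finset.mem_image.1 hp
      rw [Finset.mem_erase] at hu
      exact hp' (Finset.mem_filter.2 ⟨Finset.mem_univ _,
        (hch _ _ (hg _ h) w).2 ⟨hw, rfl, hu.2, hu.1⟩⟩)

theorem exists_backEdges (hT : IsDFSTree H x Finset.univ s π D) {f : V → V → ℝ}
    (hf0 : ∀ u v, 0 ≤ f u v) (hf1 : ∀ u v, f u v ≤ 1)
    (hfb : ∀ u v, f u v ≠ 0 → IsBack s π D u v)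
    (hfL : ∀ w, 1 ≤ backOver π D f w + (if t ∈ D w then 1 else 0) ∨
        backOver π D f w + (if t ∈ D w then 1 else 0) = 0) :
    ∃ (P : Finset (V × V)) (L : V → ℕ), (∀ p ∈ P, f p.1 p.2 ≠ 0) ∧
      (∀ v, (if v = s then 1 else (backStarts π D P v).card + L v) =
        (Finset.univ.filter fun b => (v, b) ∈ P).card + ∑ w with w ≠ s ∧ π w = v, L w +
          if v = t then 1 else 0) ∧
      ∑ w with w ≠ s, ((((backStarts π D P w).card - 1 : ℕ) : ℝ) + if L w = 0 then 1 else 0) ≤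
        ∑ w with w ≠ s, (max (backIn π D f w - 1) 0 +
          if backOver π D f w + (if t ∈ D w then 1 else 0) = 0 then 1 else 0) := by
  obtain ⟨ch, hch⟩ := exists_child_of_isBack hT
  obtain ⟨Λ, hΛ⟩ : ∃ Λ : V → ℝ, ∀ w, Λ w = backOver π D f w + if t ∈ D w then 1 else 0 :=
    ⟨_, fun _ => rfl⟩
  simp only [← hΛ] at hfL ⊢
  have hΛ0 : ∀ w, 0 ≤ Λ w := fun w => (hfL w).elim (zero_le_one.trans) ge_of_eq
  obtain ⟨F, hF⟩ : ∃ F : (V × V) ⊕ V ⊕ V ⊕ V → ℝ, F = Sum.elim (fun p => f p.1 p.2)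
    (Sum.elim (fun w => if w = s then 0 else backIn π D f w)
      (Sum.elim (fun w => if w = s then 0 else Λ w)
        (fun w => if w = s then 1 else backIn π D f w + Λ w))) := ⟨_, rfl⟩
  have hcirc : IsCirculation (netTail s t π) (netHead ch) F := by
    rw [isCirculation_net_iff]
    refine ⟨fun v => ?_, fun w => ?_, fun w => ?_⟩
    · have h := backFlow_conservation (t := t) hT hfb v
      simp only [← hΛ] at h
      simp only [hF, Sum.elim_inl, Sum.elim_inr, if_true]
      rw [h, Finset.sum_filter, Finset.sum_filter]
      congr 2
      refine Finset.sum_congr rfl fun w _ => ?_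
      by_cases hw : w = s <;> simp [hw]
    · simp only [hF, Sum.elim_inl, Sum.elim_inr]
      exact sum_child_eq hch (fun p hp => hfb _ _ hp) w
    · simp only [hF, Sum.elim_inl, Sum.elim_inr]
      split_ifs <;> simp
  obtain ⟨g, hg, hgF, hcost⟩ := exists_integral_circulation (netTail s t π) (netHead ch)
    (Sum.elim (fun _ => 0) (Sum.elim (fun w => if w ≠ s ∧ 1 ≤ backIn π D f w then 1 else 0)
      fun _ => 0)) F hcirc
  rw [isCirculation_net_iff] at hg
  obtain ⟨hg1, hg2, hg3⟩ := hg
  have h_int : ∀ a, ∀ m : ℤ, F a = m → g a = m := fun a m h => by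
    have := hgF a
    rw [h, Int.floor_intCast, Int.ceil_intCast] at this
    omega
  have hge : ∀ a, ∀ m : ℤ, (m : ℝ) ≤ F a → m ≤ g a := fun a m h =>
    (Int.le_floor.2 h).trans (hgF a).1
  have hle : ∀ a, ∀ m : ℤ, F a ≤ m → g a ≤ m := fun a m h =>
    (hgF a).2.trans (Int.ceil_le.2 h)
  have hb01 : ∀ p : V × V, g (.inl p) = 0 ∨ g (.inl p) = 1 := by
    intro p
    have h1 := hge (.inl p) 0 (by simpa [hF] using hf0 _ _)
    have h2 := hle (.inl p) 1 (by simpa [hF] using hf1 _ _)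
    omega
  obtain ⟨P, hP⟩ : ∃ P : Finset (V × V), ∀ p, p ∈ P ↔ g (.inl p) = 1 :=
    ⟨Finset.univ.filter fun p => g (.inl p) = 1, fun p => by simp⟩
  have hgP : ∀ p, g (.inl p) = if p ∈ P then 1 else 0 := by
    intro p
    rcases hb01 p with h | h <;> simp [hP, h]
  have hPf : ∀ p ∈ P, f p.1 p.2 ≠ 0 := by
    intro p hp h
    have := h_int (.inl p) 0 (by simp [hF, h])
    rw [hP] at hp
    omega
  have hI : ∀ w, w ≠ s → g (.inr (.inl w)) = (backStarts π D P w).card := by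
    intro w hw
    rw [← hg2, sum_child_eq hch (g := fun p => g (.inl p)) (fun p hp => hfb _ _ (hPf p ?_)) w,
      if_neg hw]
    · simp only [hgP]
      rw [Finset.sum_boole]
      rfl
    · have h1 := hgP p
      by_contra h
      rw [if_neg h] at h1
      exact hp h1
  have hLs : g (.inr (.inr (.inl s))) = 0 := h_int _ 0 (by simp [hF])
  have hTs : g (.inr (.inr (.inr s))) = 1 := h_int _ 1 (by simp [hF])
  have hL0 : ∀ w, 0 ≤ g (.inr (.inr (.inl w))) := fun w => hge _ 0 (by
    simp only [hF, Sum.elim_inr, Sum.elim_inl]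
    split_ifs
    · simp
    · simpa using hΛ0 w)
  have hLΛ : ∀ w, w ≠ s → ((g (.inr (.inr (.inl w)))).toNat = 0 ↔ Λ w = 0) := by
    intro w hw
    rw [Int.toNat_eq_zero]
    constructor
    · intro h
      refine (hfL w).resolve_left fun h1 => ?_
      have := hge (.inr (.inr (.inl w))) 1 (by simpa [hF, hw] using h1)
      omega
    · intro h
      exact (h_int _ 0 (by simp [hF, h])).le
  refine ⟨P, fun w => (g (.inr (.inr (.inl w)))).toNat, hPf, fun v => ?_, ?_⟩
  · have h1 := hg1 v
    have h2 : g (.inr (.inr (.inr v))) =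
        ((if v = s then 1 else (backStarts π D P v).card + (g (.inr (.inr (.inl v)))).toNat : ℕ) : ℤ) := by
      split_ifs with h
      · rw [h, hTs]; rfl
      · have := hg3 v
        rw [if_neg h, hI v h] at this
        rw [← this]; push_cast; rw [Int.toNat_of_nonneg (hL0 v)]
    have h3 : ∑ w with π w = v, g (.inr (.inr (.inl w))) =
        ((∑ w with w ≠ s ∧ π w = v, (g (.inr (.inr (.inl w)))).toNat : ℕ) : ℤ) := by
      rw [Nat.cast_sum, Finset.sum_filter, Finset.sum_filter]
      refine Finset.sum_congr rfl fun w _ => ?_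
      rw [Int.toNat_of_nonneg (hL0 w)]
      by_cases hw : w = s
      · subst hw; simp [hLs]
      · simp [hw]
    have h4 : ∑ b, g (.inl (v, b)) =
        ((Finset.univ.filter fun b => (v, b) ∈ P).card : ℤ) := by
      simp only [hgP]
      rw [Finset.sum_boole]
    rw [h2, h3, h4, hTs] at h1
    have h5 : (if v = t then (1 : ℤ) else 0) = ((if v = t then 1 else 0 : ℕ) : ℤ) := by
      split_ifs <;> rfl
    rw [h5] at h1
    exact_mod_cast h1
  · rw [Finset.sum_add_distrib, Finset.sum_add_distrib]
    refine add_le_add ?_ (Finset.sum_le_sum fun w hw => ?_)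
    · simp only [Fintype.sum_sum_type, Sum.elim_inl, Sum.elim_inr, zero_mul,
        Finset.sum_const_zero, zero_add, add_zero, hF, ite_mul, one_mul] at hcost
      have h1 : ∀ w, w ≠ s → (((backStarts π D P w).card - 1 : ℕ) : ℝ) =
          if 1 ≤ backIn π D f w then (g (.inr (.inl w)) : ℝ) - 1 else 0 := by
        intro w hw
        have h2 := hI w hw
        split_ifs with h
        · have := hge (.inr (.inl w)) 1 (by simpa [hF, hw] using h)
          rw [h2, Nat.cast_sub (by omega)]
          simp
        · have := hle (.inr (.inl w)) 1 (by simpa [hF, hw] using (not_le.1 h).le)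
          have h3 : (backStarts π D P w).card - 1 = 0 := by omega
          rw [h3, Nat.cast_zero]
      have h2 : ∀ w, max (backIn π D f w - 1) 0 =
          if 1 ≤ backIn π D f w then backIn π D f w - 1 else 0 := by
        intro w
        split_ifs with h
        · exact max_eq_left (by linarith)
        · exact max_eq_right (by linarith)
      rw [Finset.sum_congr rfl fun w hw => h1 w (Finset.mem_filter.1 hw).2,
        Finset.sum_congr rfl fun w _ => h2 w, ← Finset.sum_filter, ← Finset.sum_filter,
        Finset.sum_sub_distrib, Finset.sum_sub_distrib, Finset.filter_filter]
      refine sub_le_sub_right ?_ _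
      rw [← Finset.sum_filter, ← Finset.sum_filter] at hcost
      refine hcost.trans_eq (Finset.sum_congr rfl fun w hw => ?_)
      rw [if_neg (Finset.mem_filter.1 hw).2.1]
    · dsimp only
      simp only [hLΛ w (Finset.mem_filter.1 hw).2, le_refl]

end BackEdges

section CirculationCuts

variable {N E : Type*} [DecidableEq N] [Fintype E] [DecidableEq E]

/-- A cut containing an edge of positive flow contains another such edge. -/
lemma IsCirculation.exists_crosses_ne {h : E → N × N} {F : E → ℕ}
    (hF : IsCirculation (fun e => (h e).1) (fun e => (h e).2) F) {S : Finset N} {e₀ : E}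
    (he₀ : Crosses h S e₀) (hpos : F e₀ ≠ 0) : ∃ e, e ≠ e₀ ∧ Crosses h S e ∧ F e ≠ 0 := by
  by_contra! hc
  have hsum : ∀ k : E → N, ∑ v ∈ S, ∑ e, (if k e = v then F e else 0) =
      ∑ e, if k e ∈ S then F e else 0 := by
    intro k
    rw [Finset.sum_comm]
    exact Finset.sum_congr rfl fun e _ => Finset.sum_ite_eq _ _ _
  have h1 : ∑ e, (if (h e).2 ∈ S then F e else 0) = ∑ e, if (h e).1 ∈ S then F e else 0 := by
    rw [← hsum fun e => (h e).2, ← hsum fun e => (h e).1]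
    exact Finset.sum_congr rfl fun v _ => hF v
  rw [← Finset.add_sum_erase _ _ (Finset.mem_univ e₀),
    ← Finset.add_sum_erase _ _ (Finset.mem_univ e₀)] at h1
  have h2 : ∑ e ∈ Finset.univ.erase e₀, (if (h e).2 ∈ S then F e else 0) =
      ∑ e ∈ Finset.univ.erase e₀, if (h e).1 ∈ S then F e else 0 := by
    refine Finset.sum_congr rfl fun e he => ?_
    have h3 := hc e (Finset.ne_of_mem_erase he)
    by_cases h4 : Crosses h S e
    · rw [h3 h4]; simp
    · rw [Crosses, not_not] at h4
      simp only [h4]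
  rw [h2, Nat.add_right_cancel_iff] at h1
  rw [Crosses] at he₀
  by_cases h5 : (h e₀).1 ∈ S <;> by_cases h6 : (h e₀).2 ∈ S <;> simp_all

lemma sum_bd_eq_card (h : E → N × N) (P : Finset E) (S : Finset N) :
    ∑ v ∈ S, bd h P v = ((P.filter (Crosses h S)).card : ZMod 2) := by
  simp only [bd, Finset.sum_apply]
  rw [Finset.sum_comm, Finset.card_filter, Nat.cast_sum]
  refine Finset.sum_congr rfl fun e _ => ?_
  simp only [endPair_apply, Finset.sum_add_distrib, Finset.sum_ite_eq', Crosses]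
  by_cases h5 : (h e).1 ∈ S <;> by_cases h6 : (h e).2 ∈ S <;> simp [h5, h6]
  exact CharTwo.two_eq_zero

/-- The fractional join supported by a circulation: edges of `J₀` get value `1/3`, or `1` if they
carry no flow, all other edges carrying flow get `2/3`. -/
lemma IsCirculation.one_le_sum_crosses {h : E → N × N} {F : E → ℕ}
    (hF : IsCirculation (fun e => (h e).1) (fun e => (h e).2) F) {J₀ : Finset E} {y : E → ℝ}
    (hy : ∀ e, 0 ≤ y e) (hy₁ : ∀ e ∈ J₀, 1 / 3 ≤ y e)
    (hy₂ : ∀ e ∈ J₀, (h e).1 ≠ (h e).2 → F e = 0 → 1 ≤ y e)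
    (hy₃ : ∀ e ∉ J₀, F e ≠ 0 → 2 / 3 ≤ y e) {S : Finset N} (hS : ∑ v ∈ S, bd h J₀ v = 1) :
    1 ≤ ∑ e with Crosses h S e, y e := by
  rw [sum_bd_eq_card] at hS
  set C := J₀.filter (Crosses h S) with hC
  have hsub : C ⊆ Finset.univ.filter fun e => Crosses h S e := fun e he =>
    Finset.mem_filter.2 ⟨Finset.mem_univ e, (Finset.mem_filter.1 he).2⟩
  have hodd : Odd C.card := (ZMod.natCast_eq_one_iff_odd).1 hS
  by_cases h3 : 3 ≤ C.card
  · have h4 : (3 : ℝ) ≤ C.card := by exact_mod_cast h3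
    calc (1 : ℝ) ≤ C.card • (1 / 3 : ℝ) := by rw [nsmul_eq_mul]; linarith
      _ ≤ ∑ e ∈ C, y e := Finset.card_nsmul_le_sum _ _ _ fun e he =>
          hy₁ e (Finset.mem_filter.1 he).1
      _ ≤ _ := Finset.sum_le_sum_of_subset_of_nonneg hsub fun e _ _ => hy e
  · have h1 : C.card = 1 := by
      rcases hodd with ⟨k, hk⟩; omega
    obtain ⟨e₀, he₀⟩ := Finset.card_eq_one.1 h1
    have hm : e₀ ∈ C := he₀ ▸ Finset.mem_singleton_self e₀
    have hm' := Finset.mem_filter.1 hm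
    by_cases hz : F e₀ = 0
    · refine (hy₂ e₀ hm'.1 (fun h => hm'.2 (by rw [h])) hz).trans ?_
      exact Finset.single_le_sum (fun e _ => hy e) (hsub hm)
    · obtain ⟨e, hne, hcr, hpos⟩ := hF.exists_crosses_ne hm'.2 hz
      have heJ : e ∉ J₀ := fun h => hne (by
        have : e ∈ C := Finset.mem_filter.2 ⟨h, hcr⟩
        rwa [he₀, Finset.mem_singleton] at this)
      have h5 : ({e₀, e} : Finset E) ⊆ Finset.univ.filter fun e => Crosses h S e := by
        intro a ha
        rcases Finset.mem_insert.1 ha with rfl | ha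
        · exact hsub hm
        · rw [Finset.mem_singleton.1 ha]
          exact Finset.mem_filter.2 ⟨Finset.mem_univ e, hcr⟩
      have h6 := Finset.sum_le_sum_of_subset_of_nonneg (f := y) h5 fun e _ _ => hy e
      rw [Finset.sum_pair hne.symm] at h6
      linarith [hy₁ e₀ hm'.1, hy₃ e heJ hpos]

end CirculationCuts

section JoinGraph

variable {V : Type*} [Fintype V]

/-- The number of back edges of `P` assigned to `w`. -/
noncomputable def backCount (P : Finset (V × V)) (ch : V × V → V) (w : V) : ℕ :=
  (P.filter fun p => ch p = w).card

/-- The back edges other than the selected edges `b w` of the paired vertices `w`. -/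
noncomputable def extraEdges (P : Finset (V × V)) (ch : V × V → V) (Q : V → Prop) (b : V → V × V) :
    Finset (V × V) :=
  P.filter fun p => ¬(Q (ch p) ∧ p = b (ch p))

/-- A set `P` of back edges of a tree, each assigned to the child `ch p` of its upper end, together
with numbers `L` of units passing the parents, such that the induced flow is conserved. The
vertices satisfying `Q` are the paired ones, which have a selected back edge. -/
structure IsBackSystem (s t : V) (π : V → V) (D : V → Finset V) (P : Finset (V × V))
    (ch : V × V → V) (L : V → ℕ) (Q : V → Prop) (b : V → V × V) : Prop where
  child : ∀ p ∈ P, ch p ≠ s ∧ π (ch p) = p.2 ∧ p.1 ∈ D (ch p)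
  conservation : ∀ v, (if v = s then 1 else backCount P ch v + L v) =
    (P.filter fun p => p.1 = v).card + ∑ w with w ≠ s ∧ π w = v, L w + if v = t then 1 else 0
  paired_iff : ∀ w, Q w ↔ w ≠ s ∧ 1 ≤ L w ∧ 1 ≤ backCount P ch w
  selected : ∀ w, Q w → b w ∈ P ∧ ch (b w) = w

variable {s t : V} {π : V → V} {D : V → Finset V} {P : Finset (V × V)} {ch : V × V → V}
  {L : V → ℕ} {Q : V → Prop} {b : V → V × V}

namespace IsBackSystem

lemma card_extra_fiber (hB : IsBackSystem s t π D P ch L Q b) (w : V) :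
    ((extraEdges P ch Q b).filter fun p => ch p = w).card + (if Q w then 1 else 0) =
      backCount P ch w := by
  split_ifs with hw
  · obtain ⟨h1, h2⟩ := hB.selected w hw
    have h3 : b w ∈ P.filter fun p => ch p = w := Finset.mem_filter.2 ⟨h1, h2⟩
    rw [backCount, ← Finset.card_erase_add_one h3]
    congr 2
    ext p
    simp only [extraEdges, Finset.mem_filter, Finset.mem_erase]
    constructor
    · rintro ⟨⟨h4, h5⟩, rfl⟩
      exact ⟨fun h => h5 ⟨hw, h⟩, h4, rfl⟩
    · rintro ⟨h4, h5, rfl⟩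
      exact ⟨⟨h5, fun h => h4 h.2⟩, rfl⟩
  · rw [backCount, add_zero]
    congr 1
    ext p
    simp only [extraEdges, Finset.mem_filter]
    constructor
    · rintro ⟨⟨h4, h5⟩, rfl⟩
      exact ⟨h4, rfl⟩
    · rintro ⟨h4, rfl⟩
      exact ⟨⟨h4, fun h => hw h.1⟩, rfl⟩

lemma card_extra_fst (hB : IsBackSystem s t π D P ch L Q b) (v : V) :
    (P.filter fun p => p.1 = v).card = (Finset.univ.filter fun w => Q w ∧ (b w).1 = v).card +
      ((extraEdges P ch Q b).filter fun p => p.1 = v).card := by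
  have h1 : (Finset.univ.filter fun w => Q w ∧ (b w).1 = v).card =
      ((Finset.univ.filter fun w => Q w ∧ (b w).1 = v).image b).card := by
    refine (Finset.card_image_of_injOn fun w hw w' hw' h => ?_).symm
    rw [Finset.mem_coe, Finset.mem_filter] at hw hw'
    rw [← (hB.selected w hw.2.1).2, ← (hB.selected w' hw'.2.1).2, h]
  rw [h1, ← Finset.card_union_of_disjoint]
  · congr 1
    ext p
    simp only [extraEdges, Finset.mem_filter, Finset.mem_union, Finset.mem_image, Finset.mem_univ,
      true_and]
    constructor
    · rintro ⟨h2, rfl⟩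
      by_cases h3 : Q (ch p) ∧ p = b (ch p)
      · exact Or.inl ⟨ch p, ⟨h3.1, by rw [← h3.2]⟩, h3.2.symm⟩
      · exact Or.inr ⟨⟨h2, h3⟩, rfl⟩
    · rintro (⟨w, ⟨h2, h3⟩, rfl⟩ | ⟨⟨h2, -⟩, h3⟩)
      · exact ⟨(hB.selected w h2).1, h3⟩
      · exact ⟨h2, h3⟩
  · rw [Finset.disjoint_left]
    rintro p hp hp'
    obtain ⟨w, hw, rfl⟩ := Finset.mem_image.1 hp
    have h2 := (Finset.mem_filter.1 hw).2.1
    refine (Finset.mem_filter.1 (Finset.mem_filter.1 hp').1).2 ?_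
    rw [(hB.selected w h2).2]
    exact ⟨h2, rfl⟩

lemma card_extra_snd (hB : IsBackSystem s t π D P ch L Q b) (v : V) :
    ((extraEdges P ch Q b).filter fun p => p.2 = v).card =
      ∑ w with w ≠ s ∧ π w = v, ((extraEdges P ch Q b).filter fun p => ch p = w).card := by
  rw [Finset.card_eq_sum_card_fiberwise (f := ch)
    (t := Finset.univ.filter fun w => w ≠ s ∧ π w = v)]
  · refine Finset.sum_congr rfl fun w hw => ?_
    congr 1
    ext p
    simp only [Finset.mem_filter, and_assoc]
    refine and_congr_right fun hp => and_iff_right_of_imp ?_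
    rintro rfl
    have := hB.child p (Finset.mem_filter.1 hp).1
    rw [← this.2.1, (Finset.mem_filter.1 hw).2.2]
  · intro p hp
    rw [Finset.mem_coe, Finset.mem_filter] at hp
    have := hB.child p (Finset.mem_filter.1 hp.1).1
    exact Finset.mem_coe.2 (Finset.mem_filter.2 ⟨Finset.mem_univ _, this.1, this.2.1.trans hp.2⟩)

lemma card_extra (hB : IsBackSystem s t π D P ch L Q b) :
    (extraEdges P ch Q b).card =
      ∑ w with w ≠ s, ((extraEdges P ch Q b).filter fun p => ch p = w).card := by
  refine Finset.card_eq_sum_card_fiberwise fun p hp => ?_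
  exact Finset.mem_coe.2 (Finset.mem_filter.2 ⟨Finset.mem_univ _,
    (hB.child p (Finset.mem_filter.1 hp).1).1⟩)

end IsBackSystem

/-- The auxiliary graph for the join: tree edges, passing edges, selected back edges and extra back
edges, on the vertices and one meeting point for each paired vertex. Unused edges are loops. -/
noncomputable def joinEnds (s t : V) (π : V → V) (Q : V → Prop) (b : V → V × V)
    (R : Finset (V × V)) : V ⊕ V ⊕ V ⊕ V × V → (V ⊕ V) × (V ⊕ V)
  | .inl w => if w = s then (.inl t, .inl s) else if Q w then (.inr w, .inl w)
      else (.inl (π w), .inl w)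
  | .inr (.inl w) => if Q w then (.inl (π w), .inr w) else (.inr w, .inr w)
  | .inr (.inr (.inl w)) => if Q w then (.inl (b w).1, .inr w) else (.inr w, .inr w)
  | .inr (.inr (.inr p)) => if p ∈ R then (.inl p.1, .inl p.2) else (.inl p.1, .inl p.1)

/-- The circulation on the auxiliary graph. -/
noncomputable def joinFlow (s : V) (I L : V → ℕ) (Q : V → Prop) (R : Finset (V × V)) :
    V ⊕ V ⊕ V ⊕ V × V → ℕ
  | .inl w => if w = s then 1 else I w + L w
  | .inr (.inl w) => if Q w then I w + L w - 1 else 0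
  | .inr (.inr (.inl w)) => if Q w then 1 else 0
  | .inr (.inr (.inr p)) => if p ∈ R then 1 else 0

theorem IsBackSystem.isCirculation (hB : IsBackSystem s t π D P ch L Q b) :
    IsCirculation (fun e => (joinEnds s t π Q b (extraEdges P ch Q b) e).1)
      (fun e => (joinEnds s t π Q b (extraEdges P ch Q b) e).2)
      (joinFlow s (backCount P ch) L Q (extraEdges P ch Q b)) := by
  have hQs : ∀ w, Q w → w ≠ s := fun w hw => ((hB.paired_iff w).1 hw).1
  obtain ⟨R, hR⟩ : ∃ R, R = extraEdges P ch Q b := ⟨_, rfl⟩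
  rw [← hR]
  rintro (v | w)
  · simp only [Fintype.sum_sum_type]
    have i1 : ∑ w, (if (joinEnds s t π Q b R (.inl w)).2 = .inl v then
        joinFlow s (backCount P ch) L Q R (.inl w) else 0) =
        if v = s then 1 else backCount P ch v + L v := by
      rw [Finset.sum_eq_single v]
      · simp only [joinEnds, joinFlow]; split_ifs <;> simp_all
      · intro w _ hw; simp only [joinEnds]; split_ifs <;> simp_all
      · simp
    have i2 : ∑ w, (if (joinEnds s t π Q b R (.inr (.inl w))).2 = .inl v then
        joinFlow s (backCount P ch) L Q R (.inr (.inl w)) else 0) = 0 :=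
      Finset.sum_eq_zero fun w _ => by simp only [joinEnds]; split_ifs <;> simp_all
    have i3 : ∑ w, (if (joinEnds s t π Q b R (.inr (.inr (.inl w)))).2 = .inl v then
        joinFlow s (backCount P ch) L Q R (.inr (.inr (.inl w))) else 0) = 0 :=
      Finset.sum_eq_zero fun w _ => by simp only [joinEnds]; split_ifs <;> simp_all
    have i4 : ∑ p, (if (joinEnds s t π Q b R (.inr (.inr (.inr p)))).2 = .inl v then
        joinFlow s (backCount P ch) L Q R (.inr (.inr (.inr p))) else 0) =
        (R.filter fun p => p.2 = v).card := by
      rw [Finset.card_filter, ← Finset.sum_filter_add_sum_filter_not Finset.univ (· ∈ R)]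
      rw [Finset.filter_mem_eq_inter, Finset.univ_inter, Finset.sum_eq_zero (s := Finset.filter _ _),
        add_zero]
      · exact Finset.sum_congr rfl fun p hp => by simp [joinEnds, joinFlow, hp]
      · intro p hp; simp [joinFlow, (Finset.mem_filter.1 hp).2]
    have o1 : ∑ w, (if (joinEnds s t π Q b R (.inl w)).1 = .inl v then
        joinFlow s (backCount P ch) L Q R (.inl w) else 0) =
        (if v = t then 1 else 0) + ∑ w with w ≠ s ∧ π w = v, if Q w then 0 else
          backCount P ch w + L w := by
      rw [← Finset.add_sum_erase _ _ (Finset.mem_univ s), Finset.sum_filter,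
        ← Finset.add_sum_erase Finset.univ (fun a => if a ≠ s ∧ π a = v then _ else _)
          (Finset.mem_univ s)]
      congr 1
      · simp [joinEnds, joinFlow, eq_comm]
      · rw [if_neg (by simp), zero_add]
        refine Finset.sum_congr rfl fun w hw => ?_
        have := Finset.ne_of_mem_erase hw
        by_cases h : Q w <;> simp [joinEnds, joinFlow, this, h]
    have o2 : ∑ w, (if (joinEnds s t π Q b R (.inr (.inl w))).1 = .inl v then
        joinFlow s (backCount P ch) L Q R (.inr (.inl w)) else 0) =
        ∑ w with w ≠ s ∧ π w = v, if Q w then backCount P ch w + L w - 1 else 0 := by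
      rw [Finset.sum_filter]
      refine Finset.sum_congr rfl fun w _ => ?_
      by_cases h : Q w
      · simp [joinEnds, joinFlow, h, hQs w h]
      · simp [joinFlow, h]
    have o3 : ∑ w, (if (joinEnds s t π Q b R (.inr (.inr (.inl w)))).1 = .inl v then
        joinFlow s (backCount P ch) L Q R (.inr (.inr (.inl w))) else 0) =
        (Finset.univ.filter fun w => Q w ∧ (b w).1 = v).card := by
      rw [Finset.card_filter]
      refine Finset.sum_congr rfl fun w _ => ?_
      by_cases h : Q w <;> simp [joinEnds, joinFlow, h]
    have o4 : ∑ p, (if (joinEnds s t π Q b R (.inr (.inr (.inr p)))).1 = .inl v then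
        joinFlow s (backCount P ch) L Q R (.inr (.inr (.inr p))) else 0) =
        (R.filter fun p => p.1 = v).card := by
      rw [Finset.card_filter, ← Finset.sum_filter_add_sum_filter_not Finset.univ (· ∈ R)]
      rw [Finset.filter_mem_eq_inter, Finset.univ_inter, Finset.sum_eq_zero (s := Finset.filter _ _),
        add_zero]
      · exact Finset.sum_congr rfl fun p hp => by simp [joinEnds, joinFlow, hp]
      · intro p hp; simp [joinFlow, (Finset.mem_filter.1 hp).2]
    rw [i1, i2, i3, i4, o1, o2, o3, o4, hB.conservation, hB.card_extra_fst, hR, hB.card_extra_snd]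
    have h1 : ∑ w with w ≠ s ∧ π w = v, ((extraEdges P ch Q b).filter fun p => ch p = w).card +
        ∑ w with w ≠ s ∧ π w = v, L w =
        (∑ w with w ≠ s ∧ π w = v, if Q w then 0 else backCount P ch w + L w) +
        ∑ w with w ≠ s ∧ π w = v, if Q w then backCount P ch w + L w - 1 else 0 := by
      rw [← Finset.sum_add_distrib, ← Finset.sum_add_distrib]
      refine Finset.sum_congr rfl fun w _ => ?_
      have h2 := hB.card_extra_fiber w
      by_cases h : Q w
      · rw [if_pos h] at h2; rw [if_pos h, if_pos h]; omega
      · rw [if_neg h] at h2; rw [if_neg h, if_neg h]; omega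
    omega
  · simp only [Fintype.sum_sum_type]
    have i1 : ∀ (g : V → ℕ), ∑ w', (if (joinEnds s t π Q b R (.inl w')).2 = .inr w then
        g w' else 0) = 0 := fun g =>
      Finset.sum_eq_zero fun w' _ => by simp only [joinEnds]; split_ifs <;> simp_all
    have i4 : ∀ (g : V × V → ℕ), ∑ p, (if (joinEnds s t π Q b R (.inr (.inr (.inr p)))).2 = .inr w
        then g p else 0) = 0 := fun g =>
      Finset.sum_eq_zero fun w' _ => by simp only [joinEnds]; split_ifs <;> simp_all
    have o4 : ∀ (g : V × V → ℕ), ∑ p, (if (joinEnds s t π Q b R (.inr (.inr (.inr p)))).1 = .inr w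
        then g p else 0) = 0 := fun g =>
      Finset.sum_eq_zero fun w' _ => by simp only [joinEnds]; split_ifs <;> simp_all
    have i2 : ∑ w', (if (joinEnds s t π Q b R (.inr (.inl w'))).2 = .inr w then
        joinFlow s (backCount P ch) L Q R (.inr (.inl w')) else 0) =
        if Q w then backCount P ch w + L w - 1 else 0 := by
      rw [Finset.sum_eq_single w]
      · by_cases h : Q w <;> simp [joinEnds, joinFlow, h]
      · intro w' _ hw; simp only [joinEnds]; split_ifs <;> simp_all
      · simp
    have i3 : ∑ w', (if (joinEnds s t π Q b R (.inr (.inr (.inl w')))).2 = .inr w then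
        joinFlow s (backCount P ch) L Q R (.inr (.inr (.inl w'))) else 0) =
        if Q w then 1 else 0 := by
      rw [Finset.sum_eq_single w]
      · by_cases h : Q w <;> simp [joinEnds, joinFlow, h]
      · intro w' _ hw; simp only [joinEnds]; split_ifs <;> simp_all
      · simp
    have o1 : ∑ w', (if (joinEnds s t π Q b R (.inl w')).1 = .inr w then
        joinFlow s (backCount P ch) L Q R (.inl w') else 0) =
        if Q w then backCount P ch w + L w else 0 := by
      rw [Finset.sum_eq_single w]
      · by_cases h : Q w
        · simp [joinEnds, joinFlow, h, hQs w h]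
        · simp only [joinEnds]; split_ifs <;> simp_all
      · intro w' _ hw; simp only [joinEnds]; split_ifs <;> simp_all
      · simp
    have o2 : ∑ w', (if (joinEnds s t π Q b R (.inr (.inl w'))).1 = .inr w then
        joinFlow s (backCount P ch) L Q R (.inr (.inl w')) else 0) = 0 :=
      Finset.sum_eq_zero fun w' _ => by by_cases h : Q w' <;> simp [joinEnds, joinFlow, h]
    have o3 : ∑ w', (if (joinEnds s t π Q b R (.inr (.inr (.inl w')))).1 = .inr w then
        joinFlow s (backCount P ch) L Q R (.inr (.inr (.inl w'))) else 0) = 0 :=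
      Finset.sum_eq_zero fun w' _ => by by_cases h : Q w' <;> simp [joinEnds, joinFlow, h]
    rw [i1, i2, i3, i4, o1, o2, o3, o4]
    by_cases h : Q w
    · have := (hB.paired_iff w).1 h
      rw [if_pos h, if_pos h, if_pos h]
      omega
    · rw [if_neg h, if_neg h, if_neg h]

end JoinGraph

section JoinCost

variable {V : Type*} [Fintype V] {s t : V} {π : V → V} {D : V → Finset V} {P : Finset (V × V)}
  {ch : V × V → V} {L : V → ℕ} {Q : V → Prop} {b : V → V × V}

/-- All edges of the auxiliary graph except the back edges in the last component. -/
noncomputable def joinBase (V : Type*) [Fintype V] : Finset (V ⊕ V ⊕ V ⊕ V × V) :=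
  Finset.univ.filter fun e => ∀ p, e ≠ .inr (.inr (.inr p))

/-- The costs in the auxiliary graph. -/
noncomputable def joinCost (d : ℕ) (s : V) (Q : V → Prop) (R : Finset (V × V)) :
    V ⊕ V ⊕ V ⊕ V × V → ℕ
  | .inl w => if w = s then d else if Q w then 0 else 1
  | .inr (.inl w) => if Q w then 1 else 0
  | .inr (.inr (.inl _)) => 0
  | .inr (.inr (.inr p)) => if p ∈ R then 1 else 0

/-- The fractional join of the auxiliary graph. -/
noncomputable def joinVal (s : V) (I L : V → ℕ) (R : Finset (V × V)) : V ⊕ V ⊕ V ⊕ V × V → ℝ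
  | .inl w => if w ≠ s ∧ I w + L w = 0 then 1 else 1 / 3
  | .inr (.inl _) => 1 / 3
  | .inr (.inr (.inl _)) => 1 / 3
  | .inr (.inr (.inr p)) => if p ∈ R then 2 / 3 else 0

theorem IsBackSystem.sum_joinCost_le (hB : IsBackSystem s t π D P ch L Q b) (d : ℕ) :
    ∑ e, (joinCost d s Q (extraEdges P ch Q b) e : ℝ) *
      joinVal s (backCount P ch) L (extraEdges P ch Q b) e ≤
      d / 3 + (Fintype.card V - 1) / 3 + 2 / 3 *
        ∑ w with w ≠ s, (((backCount P ch w - 1 : ℕ) : ℝ) + if L w = 0 then 1 else 0) := by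
  obtain ⟨R, hR⟩ : ∃ R, R = extraEdges P ch Q b := ⟨_, rfl⟩
  have hQs : ∀ w, Q w → w ≠ s := fun w hw => ((hB.paired_iff w).1 hw).1
  have hcard : ∑ p, ((if p ∈ R then 1 else 0 : ℕ) : ℝ) * (if p ∈ R then (2 / 3 : ℝ) else 0) =
      ∑ w with w ≠ s, 2 / 3 * ((R.filter fun p => ch p = w).card : ℝ) := by
    rw [← Finset.mul_sum, ← Nat.cast_sum, hR, ← hB.card_extra, ← hR]
    have : ∀ p, ((if p ∈ R then 1 else 0 : ℕ) : ℝ) * (if p ∈ R then (2 / 3 : ℝ) else 0) =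
        if p ∈ R then 2 / 3 else 0 := fun p => by split_ifs <;> simp
    simp only [this]
    rw [← Finset.sum_filter, Finset.filter_mem_eq_inter, Finset.univ_inter, Finset.sum_const,
      nsmul_eq_mul, mul_comm]
  have hW : ((Finset.univ.filter fun w => w ≠ s).card : ℝ) = Fintype.card V - 1 := by
    have : Finset.univ.filter (fun w => w ≠ s) = Finset.univ.erase s := by ext w; simp
    rw [this, Finset.card_erase_of_mem (Finset.mem_univ s), Finset.card_univ,
      Nat.cast_sub (Fintype.card_pos_iff.2 ⟨s⟩), Nat.cast_one]
  rw [← hR]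
  simp only [Fintype.sum_sum_type, joinCost, joinVal, Nat.cast_zero, zero_mul,
    Finset.sum_const_zero, zero_add, hcard]
  rw [← Finset.add_sum_erase _ _ (Finset.mem_univ s), if_pos rfl, if_neg (fun h => h.1 rfl)]
  have hE : Finset.univ.erase s = Finset.univ.filter fun w => w ≠ s := by ext w; simp
  have h2 : ∑ w, ((if Q w then 1 else 0 : ℕ) : ℝ) * (1 / 3) =
      ∑ w with w ≠ s, ((if Q w then 1 else 0 : ℕ) : ℝ) * (1 / 3) := by
    rw [Finset.sum_filter]
    refine Finset.sum_congr rfl fun w _ => ?_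
    by_cases h : Q w
    · simp [h, hQs w h]
    · simp [h]
  have h3 : ((Fintype.card V : ℝ) - 1) / 3 = ∑ w with w ≠ s, (1 / 3 : ℝ) := by
    rw [Finset.sum_const, nsmul_eq_mul, hW]; ring
  rw [h2, hE, h3, Finset.mul_sum, ← mul_one_div (d : ℝ), add_assoc, add_assoc,
    ← Finset.sum_add_distrib, ← Finset.sum_add_distrib, ← Finset.sum_add_distrib]
  refine add_le_add le_rfl (Finset.sum_le_sum fun w hw => ?_)
  have hws := (Finset.mem_filter.1 hw).2
  have hf := hB.card_extra_fiber w
  rw [← hR] at hf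
  rw [if_neg hws]
  by_cases h : Q w
  · have := (hB.paired_iff w).1 h
    rw [if_pos h] at hf
    have h4 : backCount P ch w - 1 = (R.filter fun p => ch p = w).card := by omega
    rw [if_pos h, if_pos h, if_neg (fun h => by omega), if_neg (by omega), h4]
    push_cast
    linarith
  · rw [if_neg h, add_zero] at hf
    rw [if_neg h, if_neg h, hf]
    by_cases hL : L w = 0
    · by_cases hI : backCount P ch w = 0
      · rw [if_pos ⟨hws, by omega⟩, if_pos hL, hI]
        norm_num
      · rw [if_neg (fun h => hI (by omega)), if_pos hL, Nat.cast_sub (by omega)]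
        push_cast
        linarith
    · have hI : backCount P ch w = 0 := by
        by_contra hI
        exact h ((hB.paired_iff w).2 ⟨hws, by omega, by omega⟩)
      rw [if_neg (fun h => hL (by omega)), if_neg hL, hI]
      norm_num

theorem IsBackSystem.exists_join (hB : IsBackSystem s t π D P ch L Q b) (d : ℕ) :
    ∃ J, bd (joinEnds s t π Q b (extraEdges P ch Q b)) J =
        bd (joinEnds s t π Q b (extraEdges P ch Q b)) (joinBase V) ∧
      ∑ e ∈ J, (joinCost d s Q (extraEdges P ch Q b) e : ℝ) ≤
      d / 3 + (Fintype.card V - 1) / 3 + 2 / 3 *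
        ∑ w with w ≠ s, (((backCount P ch w - 1 : ℕ) : ℝ) + if L w = 0 then 1 else 0) := by
  have hy : ∀ e, 0 ≤ joinVal s (backCount P ch) L (extraEdges P ch Q b) e := by
    rintro (w | w | w | p) <;> simp only [joinVal] <;> try split_ifs
    all_goals norm_num
  have hy1 : ∀ e ∈ joinBase V, 1 / 3 ≤ joinVal s (backCount P ch) L (extraEdges P ch Q b) e := by
    rintro (w | w | w | p) he
    · simp only [joinVal]; split_ifs <;> norm_num
    · exact le_rfl
    · exact le_rfl
    · exact ((Finset.mem_filter.1 he).2 p rfl).elim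
  have hy2 : ∀ e ∈ joinBase V, (joinEnds s t π Q b (extraEdges P ch Q b) e).1 ≠
      (joinEnds s t π Q b (extraEdges P ch Q b) e).2 →
      joinFlow s (backCount P ch) L Q (extraEdges P ch Q b) e = 0 →
      1 ≤ joinVal s (backCount P ch) L (extraEdges P ch Q b) e := by
    rintro (w | w | w | p) he hne h0
    · simp only [joinFlow] at h0
      split_ifs at h0 with hw
      simp only [joinVal]
      rw [if_pos ⟨hw, h0⟩]
    · simp only [joinFlow, joinEnds] at h0 hne
      split_ifs at h0 hne with h
      · have := (hB.paired_iff w).1 h; omega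
      · exact (hne rfl).elim
    · simp only [joinFlow, joinEnds] at h0 hne
      split_ifs at h0 hne with h
      exact (hne rfl).elim
    · exact ((Finset.mem_filter.1 he).2 p rfl).elim
  have hy3 : ∀ e ∉ joinBase V, joinFlow s (backCount P ch) L Q (extraEdges P ch Q b) e ≠ 0 →
      2 / 3 ≤ joinVal s (backCount P ch) L (extraEdges P ch Q b) e := by
    rintro (w | w | w | p) he hF
    · exact (he (Finset.mem_filter.2 ⟨Finset.mem_univ _, by simp⟩)).elim
    · exact (he (Finset.mem_filter.2 ⟨Finset.mem_univ _, by simp⟩)).elim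
    · exact (he (Finset.mem_filter.2 ⟨Finset.mem_univ _, by simp⟩)).elim
    · simp only [joinFlow] at hF
      simp only [joinVal]
      split_ifs at hF ⊢ with h
      · exact le_rfl
      · exact (hF rfl).elim
  obtain ⟨J, hJ, hJc⟩ := exists_tjoin (joinEnds s t π Q b (extraEdges P ch Q b)) (joinBase V)
    (joinCost d s Q (extraEdges P ch Q b)) (joinVal s (backCount P ch) L (extraEdges P ch Q b)) hy
    (fun S hS => hB.isCirculation.one_le_sum_crosses hy hy1 hy2 hy3 hS)
  exact ⟨J, hJ, hJc.trans (hB.sum_joinCost_le d)⟩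

end JoinCost

section JoinWalk

lemma bd_map_apply {A W N : Type*} [Fintype W] [DecidableEq W] [DecidableEq N] (h : A → W × W) (κ : W → N) (J : Finset A) :
    bd (fun e => (κ (h e).1, κ (h e).2)) J =
      fun v => ∑ y, if κ y = v then bd h J y else 0 := by
  ext v
  simp only [bd, Finset.sum_apply, endPair_apply]
  have h1 : ∀ a : W, (if v = κ a then (1 : ZMod 2) else 0) =
      ∑ y, if κ y = v then (if y = a then 1 else 0) else 0 := by
    intro a
    rw [Finset.sum_eq_single a]
    · simp [eq_comm]
    · intro y _ hy; simp [hy]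
    · simp
  simp only [h1, ← Finset.sum_add_distrib]
  rw [Finset.sum_comm]
  refine Finset.sum_congr rfl fun y _ => ?_
  split_ifs <;> simp

lemma bd_map_eq {A W N : Type*} [Fintype W] [DecidableEq W] [DecidableEq N] {h : A → W × W} (κ : W → N) {J J' : Finset A}
    (hJ : bd h J = bd h J') : bd (fun e => (κ (h e).1, κ (h e).2)) J =
      bd (fun e => (κ (h e).1, κ (h e).2)) J' := by
  rw [bd_map_apply, bd_map_apply, hJ]

lemma sum_endPair_path {N : Type*} [DecidableEq N] (p : ℕ → N) (d : ℕ) :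
    ∑ i : Fin d, endPair (p i) (p (i + 1)) = endPair (p 0) (p d) := by
  rw [Fin.sum_univ_eq_sum_range (fun i => endPair (p i) (p (i + 1)))]
  induction d with
  | zero => simp [endPair_self]
  | succ d ih => rw [Finset.sum_range_succ, ih, endPair_trans]

variable {V : Type*} [Fintype V] {s t : V} {π : V → V} {D : V → Finset V} {P : Finset (V × V)}
  {ch : V × V → V} {L : V → ℕ} {Q : V → Prop} {b : V → V × V}

lemma endPair_joinEnds_inr (R : Finset (V × V)) (hQs : ∀ w, Q w → w ≠ s) {w : V} (hw : Q w)
    (e : V ⊕ V ⊕ V ⊕ V × V) :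
    endPair (joinEnds s t π Q b R e).1 (joinEnds s t π Q b R e).2 (.inr w) =
      (if e = .inl w then 1 else 0) + (if e = .inr (.inl w) then 1 else 0) +
        if e = .inr (.inr (.inl w)) then 1 else 0 := by
  have hws := hQs w hw
  rcases e with (v | v | v | p)
  · by_cases hv : v = s
    · have : v ≠ w := fun h => hws (h.symm.trans hv)
      simp [joinEnds, hv, endPair_apply, Ne.symm hws]
    · by_cases hq : Q v
      · simp [joinEnds, hv, hq, endPair_apply, eq_comm]
      · have : v ≠ w := fun h => hq (h ▸ hw)
        simp [joinEnds, hv, hq, endPair_apply, this]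
  · by_cases hq : Q v
    · simp [joinEnds, hq, endPair_apply, eq_comm]
    · have : v ≠ w := fun h => hq (h ▸ hw)
      simp [joinEnds, hq, endPair_self, this]
  · by_cases hq : Q v
    · simp [joinEnds, hq, endPair_apply, eq_comm]
    · have : v ≠ w := fun h => hq (h ▸ hw)
      simp [joinEnds, hq, endPair_self, this]
  · by_cases hp : p ∈ R <;> simp [joinEnds, hp, endPair_apply]

lemma join_parity {R : Finset (V × V)} (hQs : ∀ w, Q w → w ≠ s) {J : Finset (V ⊕ V ⊕ V ⊕ V × V)}
    (hJ : bd (joinEnds s t π Q b R) J = bd (joinEnds s t π Q b R) (joinBase V)) {w : V}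
    (hw : Q w) : ((if .inl w ∈ J then 1 else 0) + (if .inr (.inl w) ∈ J then 1 else 0) +
      if .inr (.inr (.inl w)) ∈ J then 1 else 0 : ZMod 2) = 1 := by
  have h1 := congrFun hJ (.inr w)
  simp only [bd, Finset.sum_apply, endPair_joinEnds_inr R hQs hw, Finset.sum_add_distrib,
    Finset.sum_ite_eq'] at h1
  have h2 : ∀ e : V ⊕ V ⊕ V ⊕ V × V, (∀ p, e ≠ .inr (.inr (.inr p))) → e ∈ joinBase V :=
    fun e he => Finset.mem_filter.2 ⟨Finset.mem_univ _, he⟩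
  rw [if_pos (h2 _ (by simp)), if_pos (h2 _ (by simp)), if_pos (h2 _ (by simp))] at h1
  rw [h1]
  decide

/-- The edge occurrences from which the walk is assembled. -/
def walkEnds (π : V → V) (b : V → V × V) (q : ℕ → V) (d : ℕ) :
    V ⊕ V ⊕ V ⊕ V × V ⊕ Fin d → V × V
  | .inl w => (π w, w)
  | .inr (.inl w) => (π w, w)
  | .inr (.inr (.inl w)) => b w
  | .inr (.inr (.inr (.inl p))) => p
  | .inr (.inr (.inr (.inr i))) => (q i, q (i + 1))

/-- The edge occurrences used by the walk belonging to the join `J`. -/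
def WalkUses (s : V) (Q : V → Prop) (R : Finset (V × V)) (J : Finset (V ⊕ V ⊕ V ⊕ V × V)) (d : ℕ) :
    V ⊕ V ⊕ V ⊕ V × V ⊕ Fin d → Prop
  | .inl w => w ≠ s ∧ (Q w → .inl w ∉ J ∨ .inr (.inr (.inl w)) ∈ J)
  | .inr (.inl w) => w ≠ s ∧ .inl w ∈ J ∧ (Q w → .inr (.inr (.inl w)) ∈ J)
  | .inr (.inr (.inl w)) => Q w ∧ .inr (.inr (.inl w)) ∉ J
  | .inr (.inr (.inr (.inl p))) => p ∈ R ∧ .inr (.inr (.inr p)) ∈ J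
  | .inr (.inr (.inr (.inr _))) => .inl s ∈ J

section WalkUses

variable {R : Finset (V × V)} {J : Finset (V ⊕ V ⊕ V ⊕ V × V)} {d : ℕ}

lemma walkUses_tree (w : V) : WalkUses s Q R J d (.inl w) ↔
    w ≠ s ∧ (Q w → .inl w ∉ J ∨ .inr (.inr (.inl w)) ∈ J) := Iff.rfl

lemma walkUses_double (w : V) : WalkUses s Q R J d (.inr (.inl w)) ↔
    w ≠ s ∧ .inl w ∈ J ∧ (Q w → .inr (.inr (.inl w)) ∈ J) := Iff.rfl

lemma walkUses_selected (w : V) : WalkUses s Q R J d (.inr (.inr (.inl w))) ↔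
    Q w ∧ .inr (.inr (.inl w)) ∉ J := Iff.rfl

lemma walkUses_extra (p : V × V) : WalkUses s Q R J d (.inr (.inr (.inr (.inl p)))) ↔
    p ∈ R ∧ .inr (.inr (.inr p)) ∈ J := Iff.rfl

lemma walkUses_path (i : Fin d) : WalkUses s Q R J d (.inr (.inr (.inr (.inr i)))) ↔
    .inl s ∈ J := Iff.rfl

end WalkUses

lemma card_walkUses_le {R : Finset (V × V)} (hQs : ∀ w, Q w → w ≠ s)
    {J : Finset (V ⊕ V ⊕ V ⊕ V × V)}
    (hJ : bd (joinEnds s t π Q b R) J = bd (joinEnds s t π Q b R) (joinBase V)) (d : ℕ) :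
    (Finset.univ.filter (WalkUses s Q R J d)).card + 1 ≤
      Fintype.card V + ∑ e ∈ J, joinCost d s Q R e := by
  have h1 : ∑ e ∈ J, joinCost d s Q R e = ∑ e, if e ∈ J then joinCost d s Q R e else 0 := by
    rw [← Finset.sum_filter, Finset.filter_mem_eq_inter, Finset.univ_inter]
  rw [h1, Finset.card_filter]
  simp only [Fintype.sum_sum_type]
  have h2 : Fintype.card V = ∑ w : V, 1 := by simp
  have h3 : ∑ p : V × V, (if WalkUses s Q R J d (.inr (.inr (.inr (.inl p)))) then 1 else 0) ≤
      ∑ p : V × V, if .inr (.inr (.inr p)) ∈ J then joinCost d s Q R (.inr (.inr (.inr p)))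
        else 0 := by
    refine Finset.sum_le_sum fun p _ => ?_
    simp only [walkUses_extra, joinCost]
    by_cases hp : p ∈ R <;> by_cases hpJ : (.inr (.inr (.inr p)) : V ⊕ V ⊕ V ⊕ V × V) ∈ J <;>
      simp [hp, hpJ]
  have h4 : ∑ i : Fin d, (if WalkUses s Q R J d (.inr (.inr (.inr (.inr i)))) then 1 else 0) =
      if .inl s ∈ J then d else 0 := by
    simp only [walkUses_path]
    split_ifs <;> simp
  have h5 : ∀ w, (if WalkUses s Q R J d (.inl w) then 1 else 0) +
      ((if WalkUses s Q R J d (.inr (.inl w)) then 1 else 0) +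
      (if WalkUses s Q R J d (.inr (.inr (.inl w))) then 1 else 0)) +
      (if w = s then 1 + (if .inl s ∈ J then d else 0) else 0) ≤
      1 + ((if .inl w ∈ J then joinCost d s Q R (.inl w) else 0) +
      ((if .inr (.inl w) ∈ J then joinCost d s Q R (.inr (.inl w)) else 0) +
      (if .inr (.inr (.inl w)) ∈ J then joinCost d s Q R (.inr (.inr (.inl w))) else 0))) := by
    intro w
    simp only [walkUses_tree, walkUses_double, walkUses_selected, joinCost]
    by_cases hws : w = s
    · have : ¬Q w := fun h => hQs w h hws
      subst hws
      simp [this]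
    · by_cases hq : Q w
      · have hpar := join_parity hQs hJ hq
        by_cases j1 : (.inl w : V ⊕ V ⊕ V ⊕ V × V) ∈ J <;>
        by_cases j2 : (.inr (.inl w) : V ⊕ V ⊕ V ⊕ V × V) ∈ J <;>
        by_cases j3 : (.inr (.inr (.inl w)) : V ⊕ V ⊕ V ⊕ V × V) ∈ J <;>
        simp_all
      · by_cases j1 : (.inl w : V ⊕ V ⊕ V ⊕ V × V) ∈ J <;> simp [hws, hq, j1]
  have h6 := Finset.sum_le_sum fun w (_ : w ∈ Finset.univ) => h5 w
  simp only [Finset.sum_add_distrib, Finset.sum_ite_eq', Finset.mem_univ, if_true] at h6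
  rw [h4, h2]
  omega

lemma walk_local {R : Finset (V × V)} (hQs : ∀ w, Q w → w ≠ s)
    {J : Finset (V ⊕ V ⊕ V ⊕ V × V)}
    (hJ : bd (joinEnds s t π Q b R) J = bd (joinEnds s t π Q b R) (joinBase V))
    {g : V ⊕ V ⊕ V ⊕ V × V → V → ZMod 2}
    (g1 : ∀ w, g (.inl w) = if w = s then endPair s t else endPair (π w) w)
    (g3 : ∀ w, g (.inr (.inr (.inl w))) = if Q w then endPair (b w).1 (b w).2 else 0)
    (q : ℕ → V) (d : ℕ) (w : V) :
    (if WalkUses s Q R J d (.inl w) then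
      endPair (walkEnds π b q d (.inl w)).1 (walkEnds π b q d (.inl w)).2 else 0) +
      ((if WalkUses s Q R J d (.inr (.inl w)) then endPair (walkEnds π b q d (.inr (.inl w))).1
        (walkEnds π b q d (.inr (.inl w))).2 else 0) +
      (if WalkUses s Q R J d (.inr (.inr (.inl w))) then
        endPair (walkEnds π b q d (.inr (.inr (.inl w)))).1
        (walkEnds π b q d (.inr (.inr (.inl w)))).2 else 0)) +
      (if w = s then endPair s t + (if .inl s ∈ J then endPair s t else 0) else 0) =
      g (.inl w) + (g (.inr (.inr (.inl w))) + ((if .inl w ∈ J then g (.inl w) else 0) +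
      (if .inr (.inr (.inl w)) ∈ J then g (.inr (.inr (.inl w))) else 0))) := by
  rw [g1, g3]
  simp only [walkUses_tree, walkUses_double, walkUses_selected, walkEnds]
  by_cases hws : w = s
  · have : ¬Q w := fun h => hQs w h hws
    subst hws
    simp [this]
  · have c1 := charTwo_fun (endPair (π w) w)
    by_cases hq : Q w
    · have hpar := join_parity hQs hJ hq
      have c2 := charTwo_fun (endPair (b w).1 (b w).2)
      by_cases j1 : (.inl w : V ⊕ V ⊕ V ⊕ V × V) ∈ J <;>
      by_cases j2 : (.inr (.inl w) : V ⊕ V ⊕ V ⊕ V × V) ∈ J <;>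
      by_cases j3 : (.inr (.inr (.inl w)) : V ⊕ V ⊕ V ⊕ V × V) ∈ J <;>
      simp only [hws, hq, j1, j2, j3, ne_eq, not_false_eq_true, not_true_eq_false, or_true,
        or_false, and_true, imp_false, forall_const, if_true, if_false,
        and_false, or_self, add_zero, zero_add] at hpar ⊢
      all_goals first
        | exact absurd hpar (by decide)
        | linear_combination c1
        | linear_combination - c1
        | linear_combination c2
        | linear_combination - c2
    · by_cases j1 : (.inl w : V ⊕ V ⊕ V ⊕ V × V) ∈ J <;> simp [hws, hq, j1]

lemma bd_walkUses {R : Finset (V × V)} (hQs : ∀ w, Q w → w ≠ s)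
    (hQb : ∀ w, Q w → (b w).2 = π w) {J : Finset (V ⊕ V ⊕ V ⊕ V × V)}
    (hJ : bd (joinEnds s t π Q b R) J = bd (joinEnds s t π Q b R) (joinBase V))
    {q : ℕ → V} {d : ℕ} (hq0 : q 0 = s) (hqd : q d = t) :
    bd (walkEnds π b q d) (Finset.univ.filter (WalkUses s Q R J d)) = endPair s t := by
  obtain ⟨g, hg⟩ : ∃ g : V ⊕ V ⊕ V ⊕ V × V → V → ZMod 2, ∀ e, g e =
      endPair (Sum.elim id π (joinEnds s t π Q b R e).1)
        (Sum.elim id π (joinEnds s t π Q b R e).2) := ⟨_, fun _ => rfl⟩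
  have g1 : ∀ w, g (.inl w) = if w = s then endPair s t else endPair (π w) w := by
    intro w
    rw [hg]
    by_cases hws : w = s
    · simp [joinEnds, hws, endPair_comm]
    · by_cases hq : Q w <;> simp [joinEnds, hws, hq]
  have g2 : ∀ w, g (.inr (.inl w)) = 0 := by
    intro w
    rw [hg]
    by_cases hq : Q w <;> simp [joinEnds, hq, endPair_self]
  have g3 : ∀ w, g (.inr (.inr (.inl w))) = if Q w then endPair (b w).1 (b w).2 else 0 := by
    intro w
    rw [hg]
    by_cases hq : Q w
    · simp [joinEnds, hq, hQb w hq]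
    · simp [joinEnds, hq, endPair_self]
  have g4 : ∀ p, g (.inr (.inr (.inr p))) = if p ∈ R then endPair p.1 p.2 else 0 := by
    intro p
    rw [hg]
    by_cases hp : p ∈ R <;> simp [joinEnds, hp, endPair_self]
  have hb0 : ∀ e : V ⊕ V ⊕ V ⊕ V × V, e ∈ joinBase V ↔ ∀ p, e ≠ .inr (.inr (.inr p)) :=
    fun e => by simp [joinBase]
  have key := bd_map_eq (Sum.elim id π) hJ
  simp only [bd, ← hg] at key
  have h1 : ∀ K : Finset (V ⊕ V ⊕ V ⊕ V × V), ∑ e ∈ K, g e = ∑ e, if e ∈ K then g e else 0 :=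
    fun K => by rw [← Finset.sum_filter, Finset.filter_mem_eq_inter, Finset.univ_inter]
  rw [h1, h1] at key
  simp only [Fintype.sum_sum_type, hb0, g2, ite_self, Finset.sum_const_zero, zero_add] at key
  simp only [ne_eq, reduceCtorEq, not_false_eq_true, implies_true, if_true, Sum.inr.injEq,
    forall_eq', if_false, Finset.sum_const_zero, add_zero] at key
  rw [bd, Finset.sum_filter]
  simp only [Fintype.sum_sum_type]
  have h3 : ∀ p : V × V, (if WalkUses s Q R J d (.inr (.inr (.inr (.inl p)))) then
      endPair (walkEnds π b q d (.inr (.inr (.inr (.inl p))))).1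
        (walkEnds π b q d (.inr (.inr (.inr (.inl p))))).2 else 0) =
      if .inr (.inr (.inr p)) ∈ J then g (.inr (.inr (.inr p))) else 0 := by
    intro p
    rw [g4]
    by_cases hp : p ∈ R <;> by_cases hpJ : (.inr (.inr (.inr p)) : V ⊕ V ⊕ V ⊕ V × V) ∈ J <;>
      simp [walkUses_extra, walkEnds, hp, hpJ]
  have h4 : ∑ i : Fin d, (if WalkUses s Q R J d (.inr (.inr (.inr (.inr i)))) then
      endPair (walkEnds π b q d (.inr (.inr (.inr (.inr i))))).1
        (walkEnds π b q d (.inr (.inr (.inr (.inr i))))).2 else 0) =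
      if .inl s ∈ J then endPair s t else 0 := by
    simp only [walkUses_path, walkEnds]
    split_ifs
    · rw [sum_endPair_path, hq0, hqd]
    · simp
  have h5 := fun w => walk_local hQs hJ g1 g3 q d w
  have h6 := Finset.sum_congr rfl fun w (_ : w ∈ Finset.univ) => h5 w
  simp only [Finset.sum_add_distrib, Finset.sum_ite_eq', Finset.mem_univ, if_true] at h6
  rw [h4, Finset.sum_congr rfl fun p _ => h3 p]
  have c0 := charTwo_fun (endPair s t)
  have c1 := charTwo_fun (∑ w, g (.inl w))
  have c2 := charTwo_fun (∑ w, g (.inr (.inr (.inl w))))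
  have c3 := charTwo_fun (if .inl s ∈ J then endPair s t else 0)
  linear_combination h6 + key + c1 + c2 - c0

end JoinWalk

section JoinConnected

variable {V : Type*} [Fintype V] {H : SimpleGraph V} {x : V → V → ℝ} {s t : V} {π : V → V}
  {D : V → Finset V} {P : Finset (V × V)} {ch : V × V → V} {L : V → ℕ} {Q : V → Prop}
  {b : V → V × V}

lemma IsDFSTree.mem_iff_of_descendants (hT : IsDFSTree H x Finset.univ s π D) (S : Set V) :
    ∀ k a u, (D a).card = k → u ∈ D a →
      (∀ w ∈ D a, w ≠ a → (w ∈ S ↔ π w ∈ S)) → (u ∈ S ↔ a ∈ S) := by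
  intro k
  induction k using Nat.strong_induction_on with
  | _ k ih =>
    intro a u hk hu hS
    by_cases hua : u = a
    · rw [hua]
    obtain ⟨w, -, hws, rfl, huw⟩ := hT.exists_child a (Finset.mem_univ a) u hu hua
    have hsub : D w ⊆ D (π w) := hT.subset_parent w (Finset.mem_univ w) hws
    have hnot := hT.parent_notMem w (Finset.mem_univ w) hws
    have hww := hT.self_mem w (Finset.mem_univ w)
    have hlt : (D w).card < (D (π w)).card := Finset.card_lt_card
      ⟨hsub, fun h => hnot (h (hT.self_mem _ (Finset.mem_univ _)))⟩
    rw [ih _ (hk ▸ hlt) w u rfl huw fun w' hw' _ => hS w' (hsub hw')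
      fun h => hnot (h ▸ hw')]
    exact hS w (hsub hww) fun h => hnot (h ▸ hww)

lemma IsBackSystem.walk_connected (hB : IsBackSystem s t π D P ch L Q b)
    (hT : IsDFSTree H x Finset.univ s π D) {R : Finset (V × V)} {J : Finset (V ⊕ V ⊕ V ⊕ V × V)}
    {q : ℕ → V} {d : ℕ} (S : Set V) (hs : s ∈ S)
    (hS : ∀ e ∈ Finset.univ.filter (WalkUses s Q R J d),
      (walkEnds π b q d e).1 ∈ S ↔ (walkEnds π b q d e).2 ∈ S) (v : V) : v ∈ S := by
  have hS' : ∀ e, WalkUses s Q R J d e →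
      ((walkEnds π b q d e).1 ∈ S ↔ (walkEnds π b q d e).2 ∈ S) :=
    fun e he => hS e (Finset.mem_filter.2 ⟨Finset.mem_univ _, he⟩)
  have key : ∀ k w, (D w).card = k → w ≠ s → (w ∈ S ↔ π w ∈ S) := by
    intro k
    induction k using Nat.strong_induction_on with
    | _ k ih =>
      intro w hk hws
      by_cases hM : WalkUses s Q R J d (.inl w)
      · exact (hS' _ hM).symm
      rw [walkUses_tree] at hM
      have hQw : Q w := by tauto
      have hb : WalkUses s Q R J d (.inr (.inr (.inl w))) := by
        rw [walkUses_selected]; tauto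
      have h1 : (b w).1 ∈ S ↔ (b w).2 ∈ S := hS' _ hb
      obtain ⟨h2, h3⟩ := hB.selected w hQw
      obtain ⟨-, h4, h5⟩ := hB.child _ h2
      rw [h3] at h4 h5
      rw [h4, ← h1]
      refine (hT.mem_iff_of_descendants S _ w _ rfl h5 fun w' hw' hne => ?_).symm
      have hw's : w' ≠ s := (hT.parent_mem_of_mem hw' hne).1
      refine ih _ ?_ w' rfl hw's
      rw [← hk]
      refine Finset.card_lt_card ⟨hT.trans w (Finset.mem_univ w) w' hw', fun h => hne ?_⟩
      exact hT.antisymm hw' (h (hT.self_mem w (Finset.mem_univ w)))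
  refine (hT.mem_iff_of_descendants S _ s v rfl ?_ fun w _ hws => key _ w rfl hws).2 hs
  rw [hT.root]
  exact Finset.mem_univ v

theorem IsBackSystem.exists_walk (hB : IsBackSystem s t π D P ch L Q b)
    (hT : IsDFSTree H x Finset.univ s π D) {G : SimpleGraph V} (hHG : H ≤ G)
    (hPG : ∀ p ∈ P, G.Adj p.1 p.2) (q : G.Walk s t) :
    ∃ w : G.Walk s t, (∀ u, u ∈ w.support) ∧ (w.length : ℝ) ≤
      q.length / 3 + 4 / 3 * (Fintype.card V - 1) + 2 / 3 *
        ∑ w with w ≠ s, (((backCount P ch w - 1 : ℕ) : ℝ) + if L w = 0 then 1 else 0) := by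
  obtain ⟨J, hJ, hJc⟩ := hB.exists_join q.length
  have hQs : ∀ w, Q w → w ≠ s := fun w hw => ((hB.paired_iff w).1 hw).1
  have hQb : ∀ w, Q w → (b w).2 = π w := fun w hw => by
    obtain ⟨h2, h3⟩ := hB.selected w hw
    rw [← (hB.child _ h2).2.1, h3]
  obtain ⟨w, hw, hwl⟩ := exists_spanning_walk G (walkEnds π b q.getVert q.length)
    (Finset.univ.filter (WalkUses s Q (extraEdges P ch Q b) J q.length)) (by
      rintro (w | w | w | p | i) he
      · exact (hHG (hT.adj_parent w (Finset.mem_univ w) (Finset.mem_filter.1 he).2.1)).symm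
      · exact (hHG (hT.adj_parent w (Finset.mem_univ w) (Finset.mem_filter.1 he).2.1)).symm
      · exact hPG _ (hB.selected w (Finset.mem_filter.1 he).2.1).1
      · exact hPG p (Finset.mem_filter.1 (Finset.mem_filter.1 he).2.1).1
      · exact q.adj_getVert_succ i.2) s t
    (bd_walkUses hQs hQb hJ q.getVert_zero q.getVert_length) (hB.walk_connected hT)
  refine ⟨w, hw, ?_⟩
  have h1 := card_walkUses_le hQs hJ q.length
  have h2 : (w.length : ℝ) + 1 ≤ Fintype.card V +
      ∑ e ∈ J, (joinCost q.length s Q (extraEdges P ch Q b) e : ℝ) := by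
    exact_mod_cast (Nat.add_le_add_right hwl 1).trans h1
  linarith

end JoinConnected

section BackSystem

variable {V : Type*} [Fintype V] {H : SimpleGraph V} {x : V → V → ℝ} {s t : V} {π : V → V}
  {D : V → Finset V}

lemma card_backStarts {ch : V × V → V}
    (hch : ∀ u v, IsBack s π D u v → ∀ w, ch (u, v) = w ↔ w ≠ s ∧ π w = v ∧ u ∈ D w ∧ u ≠ w)
    {P : Finset (V × V)} (hP : ∀ p ∈ P, IsBack s π D p.1 p.2) {w : V} (hw : w ≠ s) :
    (backStarts π D P w).card = backCount P ch w := by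
  have h := sum_child_eq hch (g := fun p => if p ∈ P then 1 else 0)
    (fun p hp => hP p (by by_contra h; simp [h] at hp)) w
  rw [if_neg hw, ← Finset.card_filter, ← Finset.card_filter] at h
  rw [backStarts, ← h, backCount]
  congr 1
  ext p
  simp [and_comm]

lemma exists_backSystem (hT : IsDFSTree H x Finset.univ s π D) {P : Finset (V × V)} {L : V → ℕ}
    (hP : ∀ p ∈ P, IsBack s π D p.1 p.2)
    (hL : ∀ v, (if v = s then 1 else (backStarts π D P v).card + L v) =
      (Finset.univ.filter fun b => (v, b) ∈ P).card + ∑ w with w ≠ s ∧ π w = v, L w +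
        if v = t then 1 else 0) :
    ∃ ch Q b, IsBackSystem s t π D P ch L Q b ∧
      ∀ w, w ≠ s → (backStarts π D P w).card = backCount P ch w := by
  obtain ⟨ch, hch⟩ := exists_child_of_isBack hT
  have hc : ∀ w, w ≠ s → (backStarts π D P w).card = backCount P ch w :=
    fun w => card_backStarts hch hP
  have hb : ∀ w, ∃ p, w ≠ s ∧ 1 ≤ L w ∧ 1 ≤ backCount P ch w → p ∈ P ∧ ch p = w := by
    intro w
    by_cases h : 1 ≤ backCount P ch w
    · obtain ⟨p, hp⟩ := Finset.card_pos.1 h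
      exact ⟨p, fun _ => Finset.mem_filter.1 hp⟩
    · exact ⟨(w, w), fun h' => (h h'.2.2).elim⟩
  choose b hb using hb
  refine ⟨ch, fun w => w ≠ s ∧ 1 ≤ L w ∧ 1 ≤ backCount P ch w, b, ⟨fun p hp => ?_, fun v => ?_,
    fun w => Iff.rfl, hb⟩, hc⟩
  · have := (hch _ _ (hP p hp) _).1 rfl
    exact ⟨this.1, this.2.1, this.2.2.1⟩
  · have h1 : (Finset.univ.filter fun b => (v, b) ∈ P).card =
        (P.filter fun p => p.1 = v).card := by
      rw [← Finset.card_image_of_injective (Finset.univ.filter fun b => (v, b) ∈ P)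
        (Prod.mk_right_injective v)]
      congr 1
      ext ⟨a, b⟩
      simp only [Finset.mem_image, Finset.mem_filter, Finset.mem_univ, true_and, Prod.mk.injEq]
      constructor
      · rintro ⟨b', h, rfl, rfl⟩; exact ⟨h, rfl⟩
      · rintro ⟨h, rfl⟩; exact ⟨b, h, rfl, rfl⟩
    rw [← h1, ← hL v]
    split_ifs with hv
    · rfl
    · rw [hc v hv]

lemma IsTwoVertexConnected.connected {G : SimpleGraph V} (h : IsTwoVertexConnected G) :
    G.Connected := by
  have hne : Nonempty V := Fintype.card_pos_iff.1 (by have := h.1; omega)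
  refine ⟨fun a c => ?_⟩
  by_contra hac
  obtain ⟨u, v, huv, hu, hv⟩ := h.exists_adj_cut (Finset.univ.filter fun v => G.Reachable a v)
    ⟨a, by simp⟩ fun hS => hac (by simpa using hS.ge (Finset.mem_univ c))
  simp only [Finset.mem_filter, Finset.mem_univ, true_and] at hu hv
  exact hv (hu.trans huv.reachable)

end BackSystem

theorem twoConnected_spanning_path_walk {V : Type*} [Fintype V] (G : SimpleGraph V)
    (s t : V) (h2c : IsTwoVertexConnected G)
    (G' : SimpleGraph V) (hG' : G' = SimpleGraph.fromEdgeSet (insert s(s, t) G.edgeSet)) :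
    ∃ w : G.Walk s t, (∀ u : V, u ∈ w.support) ∧
      (w.length : ℝ) ≤ (10 / 9) * optLP G' +
        ((Fintype.card V : ℝ) + (G.dist s t : ℝ) - 2) / 3 := by
  obtain ⟨x, z, hx, hxG, hcard, hopt⟩ := h2c.exists_lpPoint s t
  let H : SimpleGraph V :=
    { Adj := fun a b => x a b ≠ 0
      symm := ⟨fun a b h => by rw [hx.symm]; exact h⟩
      loopless := ⟨fun a h => h (hx.diag a)⟩ }
  have hn : ∃ v, v ≠ s := by
    have : Nontrivial V := Fintype.one_lt_card_iff_nontrivial.1 (by have := h2c.1; omega)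
    exact exists_ne s
  obtain ⟨π, D, hT⟩ := exists_dfsTree H x s hx.connected
  obtain ⟨f, hf0, hf1, hfb, hfL, hfc⟩ := exists_backFlow hx hT (fun _ _ => Iff.rfl) hn hcard
  obtain ⟨P, L, hP, hL, hPc⟩ := exists_backEdges hT hf0 hf1 (fun u v h => (hfb u v h).2) hfL
  obtain ⟨ch, Q, b, hB, hc⟩ := exists_backSystem hT (fun p hp => (hfb _ _ (hP p hp)).2) hL
  obtain ⟨q, hq⟩ := h2c.connected.exists_walk_length_eq_dist s t
  obtain ⟨w, hw, hwl⟩ := hB.exists_walk hT (G := G) (fun a b h => hxG a b h)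
    (fun p hp => hxG _ _ (hfb _ _ (hP p hp)).1) q
  refine ⟨w, hw, ?_⟩
  have h1 : ∑ w with w ≠ s, (((backCount P ch w - 1 : ℕ) : ℝ) + if L w = 0 then 1 else 0) =
      ∑ w with w ≠ s, ((((backStarts π D P w).card - 1 : ℕ) : ℝ) + if L w = 0 then 1 else 0) :=
    Finset.sum_congr rfl fun w hw => by rw [hc w (Finset.mem_filter.1 hw).2]
  rw [h1, hq] at hwl
  rw [hG']
  linarith
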